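/- arXiv:1507.05933 — 3 statements merged into one kernel-verified Lean document; each statement's English description precedes it below -/
import Mathlib

section
/- Let G ∈ G¹ (a graph with no odd cycle longer than 3). An orientation D of the line graph L(G) is kernel-perfect if and only if every clique of L(G) contains a vertex that is a sink within that clique (i.e., a vertex e such that f → e for every other vertex f of the clique). -/
open SimpleGraph

/-- Adjacency in the line graph `L(G)`: two distinct edges sharing an endpoint. -/
def lineAdj {V : Type*} (G : SimpleGraph V) (e f : G.edgeSet) : Prop :=
  e ≠ f ∧ ∃ x : V, x ∈ (e : Sym2 V) ∧ x ∈ (f : Sym2 V)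

/-- `D` is an orientation of the (loopless) adjacency relation `Adj`:
every arc of `D` is an edge, and every edge gets at least one of its two arcs. -/
def IsOrientation {α : Type*} (Adj : α → α → Prop) (D : α → α → Prop) : Prop :=
  (∀ a b, D a b → Adj a b) ∧ (∀ a b, Adj a b → D a b ∨ D b a)

/-- A digraph (relation) is kernel-perfect if every induced subdigraph has a kernel:
an independent set `S` such that every vertex outside `S` has an out-neighbor in `S`. -/
def KernelPerfect {α : Type*} (D : α → α → Prop) : Prop :=
  ∀ Z : Set α, ∃ S ⊆ Z, (∀ a ∈ S, ∀ b ∈ S, ¬ D a b) ∧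
    ∀ z ∈ Z, z ∉ S → ∃ s ∈ S, D z s

/-- Out-degree of a vertex in a digraph given as a relation. -/
noncomputable def outDeg {α : Type*} (D : α → α → Prop) (a : α) : ℕ := {b | D a b}.ncard

/-- Degree of a vertex. -/
noncomputable def deg {V : Type*} (G : SimpleGraph V) (v : V) : ℕ := (G.neighborSet v).ncard

/-- Maximum degree. -/
noncomputable def maxDeg {V : Type*} (G : SimpleGraph V) : ℕ := sSup (Set.range (deg G))

/-- `G` is `f`-edge-orientable: `L(G)` admits a kernel-perfect orientation with
`1 + d⁺(e) ≤ f e` for every edge `e`. -/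
def EdgeOrientable {V : Type*} (G : SimpleGraph V) (f : G.edgeSet → ℕ) : Prop :=
  ∃ D : G.edgeSet → G.edgeSet → Prop,
    IsOrientation (lineAdj G) D ∧ KernelPerfect D ∧ ∀ e, outDeg D e + 1 ≤ f e

open Classical in
/-- The function `f_{k,v}`: `deg v` on edges incident to `v`, and `k` elsewhere. -/
noncomputable def fkv {V : Type*} (G : SimpleGraph V) (k : ℕ) (v : V) (e : G.edgeSet) : ℕ :=
  if v ∈ (e : Sym2 V) then deg G v else k

/-- `G` is strongly `k`-edge-orientable. -/
def StronglyEdgeOrientable {V : Type*} (G : SimpleGraph V) (k : ℕ) : Prop :=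
  ∀ v : V, EdgeOrientable G (fkv G k v)

/-- `G` is `f`-edge-choosable. -/
def FEdgeChoosable {V : Type*} (G : SimpleGraph V) (f : G.edgeSet → ℕ) : Prop :=
  ∀ ℓ : G.edgeSet → Finset ℕ, (∀ e, f e ≤ (ℓ e).card) →
    ∃ φ : G.edgeSet → ℕ, (∀ e, φ e ∈ ℓ e) ∧
      ∀ e₁ e₂, lineAdj G e₁ e₂ → φ e₁ ≠ φ e₂

/-- `G ∈ G*`: any two distinct odd cycles share at most one edge. -/
def InGStar {V : Type*} (G : SimpleGraph V) : Prop :=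
  ∀ (u w : V) (c₁ : G.Walk u u) (c₂ : G.Walk w w),
    c₁.IsCycle → c₂.IsCycle → Odd c₁.length → Odd c₂.length →
    {e | e ∈ c₁.edges} ≠ {e | e ∈ c₂.edges} →
    ({e | e ∈ c₁.edges} ∩ {e | e ∈ c₂.edges}).ncard ≤ 1

/-- `G` is 2-connected: connected, and still connected after deleting any one vertex. -/
def TwoConn {V : Type*} (G : SimpleGraph V) : Prop :=
  G.Connected ∧ ∀ v : V, (G.induce {w | w ≠ v}).Connected

/-- A block of `G`: a maximal 2-connected subgraph. -/
def IsBlock {V : Type*} (G : SimpleGraph V) (B : G.Subgraph) : Prop :=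
  TwoConn B.coe ∧ ∀ B' : G.Subgraph, TwoConn B'.coe → B ≤ B' → B = B'

/-- Vertex type of the theta graph with path lengths `l`: two hubs
(`Sum.inl false`, `Sum.inl true`) plus the internal vertices of each path. -/
def ThetaVert (l : List ℕ) : Type := Bool ⊕ (Σ i : Fin l.length, Fin (l.get i - 1))

/-- The theta graph `Θ_{l₁,…,l_k}`: two hubs joined by internally disjoint paths,
the `i`-th of length `l i`. -/
def thetaGraph (l : List ℕ) : SimpleGraph (ThetaVert l) :=
  SimpleGraph.fromRel (fun a b =>
    match a, b with
    | Sum.inl false, Sum.inl true => 1 ∈ l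
    | Sum.inl false, Sum.inr ⟨_, j⟩ => j.val = 0
    | Sum.inl true, Sum.inr ⟨i, j⟩ => j.val = l.get i - 2
    | Sum.inr ⟨i, j⟩, Sum.inr ⟨i', j'⟩ => i.val = i'.val ∧ j'.val = j.val + 1
    | _, _ => False)

/-- `v` (outside `c`) touches `w ∈ c`: some `v,w`-path meets `c` only at `w`. -/
def Touches {V : Type*} (G : SimpleGraph V) {u : V} (c : G.Walk u u) (v w : V) : Prop :=
  w ∈ c.support ∧ ∃ p : G.Walk v w, p.IsPath ∧ ∀ x ∈ p.support, x ∈ c.support → x = w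

/-- The subdigraph of `D` induced on `Z` has a kernel. -/
def HasKernel {α : Type*} (D : α → α → Prop) (Z : Set α) : Prop :=
  ∃ S ⊆ Z, (∀ a ∈ S, ∀ b ∈ S, ¬ D a b) ∧ ∀ z ∈ Z, z ∉ S → ∃ s ∈ S, D z s

theorem HasKernel.congr {α : Type*} {D D' : α → α → Prop} {Z : Set α}
    (h : HasKernel D Z) (hD : ∀ a ∈ Z, ∀ b ∈ Z, (D a b ↔ D' a b)) : HasKernel D' Z := by
  obtain ⟨S, hS, hi, ha⟩ := h
  refine ⟨S, hS, fun a ha' b hb h => hi a ha' b hb ((hD a (hS ha') b (hS hb)).2 h), ?_⟩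
  intro z hz hzS
  obtain ⟨s, hs, h⟩ := ha z hz hzS
  exact ⟨s, hs, (hD z hz s (hS hs)).1 h⟩

/-- If one side of a clique cutset rejects the sink `c` of the clique, then `c` can be moved
to that side. -/
theorem HasKernel.of_detach {α : Type*} {D : α → α → Prop} {A B C : Set α} {c : α}
    (hc : c ∈ C) (hAC : Disjoint A C) (hABd : Disjoint A B)
    (hAB : ∀ a ∈ A, ∀ b ∈ B, ¬ D a b ∧ ¬ D b a)
    (hsink : ∀ f ∈ C, f ≠ c → D f c)
    (hrej : ¬ ∃ S ⊆ B ∪ {c}, c ∈ S ∧ (∀ a ∈ S, ∀ b ∈ S, ¬ D a b) ∧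
      ∀ z ∈ B ∪ {c}, z ∉ S → ∃ s ∈ S, D z s)
    (h : HasKernel (fun a b => D a b ∧ ¬ (a ∈ A ∧ b = c) ∧ ¬ (a = c ∧ b ∈ A))
      (A ∪ (B ∪ {c}) ∪ C \ {c})) : HasKernel D (A ∪ B ∪ C) := by
  obtain ⟨S, hS, hi, ha⟩ := h
  have hcA : c ∉ A := fun h => Set.disjoint_left.1 hAC h hc
  have hZ : A ∪ (B ∪ {c}) ∪ C \ {c} = A ∪ B ∪ C := by
    ext x
    by_cases hx : x = c
    · subst hx; simp [hc]
    · simp [hx, or_assoc]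
  rw [hZ] at hS ha
  by_cases hcS : c ∈ S
  · refine absurd ⟨S ∩ (B ∪ {c}), Set.inter_subset_right, ⟨hcS, by simp⟩, ?_, ?_⟩ hrej
    · rintro a ⟨haS, haB⟩ b ⟨hbS, hbB⟩ hab
      have hBA : ∀ x ∈ B ∪ {c}, x ∉ A := by
        rintro x (hx | rfl) hxA
        exacts [Set.disjoint_left.1 hABd hxA hx, hcA hxA]
      exact hi a haS b hbS ⟨hab, fun h => hBA a haB h.1, fun h => hBA b hbB h.2⟩
    · rintro z hz hzS
      have hz' : z ∉ S := fun h => hzS ⟨h, hz⟩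
      have hzc : z ≠ c := fun h => hz' (h ▸ hcS)
      have hzB : z ∈ B := by grind
      obtain ⟨s, hs, hD, -, -⟩ := ha z (by grind) hz'
      refine ⟨s, ⟨hs, ?_⟩, hD⟩
      by_contra hsB
      have hsc : s ≠ c := by grind
      rcases hS hs with (hsA | hsB') | hsC
      · exact (hAB s hsA z hzB).2 hD
      · grind
      · exact hi s hs c hcS ⟨hsink s hsC hsc, fun h => Set.disjoint_left.1 hAC h.1 hsC,
          fun h => hsc h.1⟩
  · refine ⟨S, hS, fun a haS b hbS hab => hi a haS b hbS ⟨hab, ?_, ?_⟩, fun z hz hzS => ?_⟩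
    · rintro ⟨-, rfl⟩; exact hcS hbS
    · rintro ⟨rfl, -⟩; exact hcS haS
    · obtain ⟨s, hs, h, -⟩ := ha z hz hzS
      exact ⟨s, hs, h⟩

/-- Kernels can be glued along a clique cutset `C` whose subcliques have sinks. -/
theorem HasKernel.of_clique_cutset {α : Type*} [Finite α] (n : ℕ) :
    ∀ (D : α → α → Prop) (A B C : Set α), C.ncard = n →
    (∀ a, ¬ D a a) → Disjoint A C → Disjoint B C → Disjoint A B →
    (∀ a ∈ A, ∀ b ∈ B, ¬ D a b ∧ ¬ D b a) →
    (∀ K ⊆ C, K.Nonempty → ∃ s ∈ K, ∀ f ∈ K, f ≠ s → D f s) →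
    (∀ Z ⊆ A ∪ C, HasKernel D Z) → (∀ Z ⊆ B ∪ C, HasKernel D Z) →
    HasKernel D (A ∪ B ∪ C) := by
  induction n with
  | zero =>
    intro D A B C hn hirr hAC hBC hAB hDAB hC hA hB
    have hC0 : C = ∅ := (Set.ncard_eq_zero).1 hn
    subst hC0
    obtain ⟨S, hS, hi, ha⟩ := hA A (by simp)
    obtain ⟨T, hT, hi', ha'⟩ := hB B (by simp)
    refine ⟨S ∪ T, by grind, ?_, ?_⟩
    · rintro a (h | h) b (h' | h')
      · exact hi a h b h'
      · exact (hDAB a (hS h) b (hT h')).1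
      · exact (hDAB b (hS h') a (hT h)).2
      · exact hi' a h b h'
    · rintro z ((hz | hz) | hz) hzS
      · obtain ⟨s, hs, h⟩ := ha z hz (by grind)
        exact ⟨s, Or.inl hs, h⟩
      · obtain ⟨s, hs, h⟩ := ha' z hz (by grind)
        exact ⟨s, Or.inr hs, h⟩
      · exact hz.elim
  | succ n ih =>
    intro D A B C hn hirr hAC hBC hAB hDAB hC hA hB
    obtain ⟨c, hc, hsink⟩ := hC C le_rfl (Set.nonempty_of_ncard_ne_zero (by omega))
    have hcA : c ∉ A := fun h => Set.disjoint_left.1 hAC h hc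
    have hcB : c ∉ B := fun h => Set.disjoint_left.1 hBC h hc
    have key : ∀ A B : Set α, c ∉ A → c ∉ B → Disjoint A C → Disjoint B C → Disjoint A B →
        (∀ a ∈ A, ∀ b ∈ B, ¬ D a b ∧ ¬ D b a) →
        (∀ Z ⊆ A ∪ C, HasKernel D Z) → (∀ Z ⊆ B ∪ C, HasKernel D Z) →
        (¬ ∃ S ⊆ B ∪ {c}, c ∈ S ∧ (∀ a ∈ S, ∀ b ∈ S, ¬ D a b) ∧
          ∀ z ∈ B ∪ {c}, z ∉ S → ∃ s ∈ S, D z s) → HasKernel D (A ∪ B ∪ C) := by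
      intro A B hcA hcB hAC hBC hAB hDAB hA hB hrej
      refine HasKernel.of_detach hc hAC hAB hDAB hsink hrej (ih _ _ _ _ ?_ ?_ ?_ ?_ ?_ ?_ ?_ ?_ ?_)
      · rw [Set.ncard_sdiff_singleton_of_mem hc]; omega
      · exact fun a h => hirr a h.1
      · exact hAC.mono_right Set.sdiff_subset
      · rw [Set.disjoint_left] at *
        grind
      · rw [Set.disjoint_left] at *
        grind
      · intro a ha b hb
        rcases hb with hb | rfl
        · exact ⟨fun h => (hDAB a ha b hb).1 h.1, fun h => (hDAB a ha b hb).2 h.1⟩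
        · exact ⟨fun h => h.2.1 ⟨ha, rfl⟩, fun h => h.2.2 ⟨rfl, ha⟩⟩
      · intro K hK hne
        obtain ⟨s, hs, h⟩ := hC K (hK.trans Set.sdiff_subset) hne
        refine ⟨s, hs, fun f hf hfs => ⟨h f hf hfs, ?_, ?_⟩⟩
        · rintro ⟨-, rfl⟩; exact (hK hs).2 rfl
        · rintro ⟨rfl, -⟩; exact (hK hf).2 rfl
      · intro Z hZ
        refine (hA Z (by grind)).congr fun a ha b hb => ?_
        have h1 : a ≠ c := by rintro rfl; have := hZ ha; grind
        have h2 : b ≠ c := by rintro rfl; have := hZ hb; grind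
        simp [h1, h2]
      · intro Z hZ
        rw [Set.disjoint_left] at *
        refine (hB Z (by grind)).congr fun a ha b hb => ?_
        have h1 : a ∉ A := by intro h; have := hZ ha; grind
        have h2 : b ∉ A := by intro h; have := hZ hb; grind
        simp [h1, h2]
    by_cases hrB : ∃ S ⊆ B ∪ {c}, c ∈ S ∧ (∀ a ∈ S, ∀ b ∈ S, ¬ D a b) ∧
          ∀ z ∈ B ∪ {c}, z ∉ S → ∃ s ∈ S, D z s
    swap
    · exact key A B hcA hcB hAC hBC hAB hDAB hA hB hrB
    by_cases hrA : ∃ S ⊆ A ∪ {c}, c ∈ S ∧ (∀ a ∈ S, ∀ b ∈ S, ¬ D a b) ∧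
          ∀ z ∈ A ∪ {c}, z ∉ S → ∃ s ∈ S, D z s
    swap
    · rw [Set.union_comm A B]
      exact key B A hcB hcA hBC hAC hAB.symm (fun a ha b hb => (hDAB b hb a ha).symm) hB hA hrA
    obtain ⟨S, hS, hcS, hi, ha⟩ := hrA
    obtain ⟨T, hT, hcT, hi', ha'⟩ := hrB
    refine ⟨S ∪ T, ?_, ?_, ?_⟩
    · rintro x (hx | hx)
      · rcases hS hx with h | rfl
        exacts [Or.inl (Or.inl h), Or.inr hc]
      · rcases hT hx with h | rfl
        exacts [Or.inl (Or.inr h), Or.inr hc]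
    · have cross : ∀ a ∈ S, ∀ b ∈ T, ¬ D a b ∧ ¬ D b a := by
        intro a h b h'
        rcases hS h with hA' | rfl
        · rcases hT h' with hB' | rfl
          · exact hDAB a hA' b hB'
          · exact ⟨hi a h b hcS, hi b hcS a h⟩
        · exact ⟨hi' a hcT b h', hi' b h' a hcT⟩
      rintro a (h | h) b (h' | h')
      exacts [hi a h b h', (cross a h b h').1, (cross b h' a h).2, hi' a h b h']
    · rintro z ((hz | hz) | hz) hzS
      · obtain ⟨s, hs, h⟩ := ha z (Or.inl hz) (by grind)
        exact ⟨s, Or.inl hs, h⟩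
      · obtain ⟨s, hs, h⟩ := ha' z (Or.inl hz) (by grind)
        exact ⟨s, Or.inr hs, h⟩
      · exact ⟨c, Or.inl hcS, hsink z hz (by rintro rfl; exact hzS (Or.inl hcS))⟩

theorem SimpleGraph.Walk.exists_isPath_or_odd_cycle {V : Type*} {H : SimpleGraph V} {u v : V}
    (p : H.Walk u v) : (∃ (w : V) (c : H.Walk w w), c.IsCycle ∧ Odd c.length) ∨
      ∃ q : H.Walk u v, q.IsPath ∧ (Odd p.length ↔ Odd q.length) := by
  classical
  induction p with
  | nil => exact Or.inr ⟨.nil, by simp, Iff.rfl⟩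
  | @cons x y v h p ih =>
    rcases ih with ih | ⟨q, hq, hpq⟩
    · exact Or.inl ih
    by_cases hx : x ∈ q.support
    · have hlen : (q.takeUntil x hx).length + (q.dropUntil x hx).length = q.length := by
        rw [← Walk.length_append, Walk.take_spec]
      by_cases hodd : Odd (q.takeUntil x hx).length
      · refine Or.inr ⟨q.dropUntil x hx, hq.dropUntil hx, ?_⟩
        rw [Walk.length_cons]
        grind
      · refine Or.inl ⟨x, .cons h (q.takeUntil x hx), ?_, ?_⟩
        · refine (Walk.cons_isCycle_iff _ _).2 ⟨hq.takeUntil hx, fun he => hodd ?_⟩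
          rw [(hq.takeUntil hx).length_eq_one_of_mem_edges (Sym2.eq_swap ▸ he)]
          exact odd_one
        · rw [Walk.length_cons]; grind
    · refine Or.inr ⟨.cons h q, hq.cons hx, ?_⟩
      simp only [Walk.length_cons]
      grind

theorem SimpleGraph.colorable_two_of_no_odd_cycle {V : Type*} {H : SimpleGraph V}
    (h : ∀ (u : V) (c : H.Walk u u), c.IsCycle → ¬ Odd c.length) : H.Colorable 2 := by
  rw [two_colorable_iff_forall_loop_even]
  intro u w
  rcases w.exists_isPath_or_odd_cycle with ⟨x, c, hc, ho⟩ | ⟨q, hq, hwq⟩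
  · exact absurd ho (h x c hc)
  · have h0 : q.length = 0 := Walk.length_eq_zero_iff.2 (Walk.isPath_iff_nil.1 hq)
    rw [h0] at hwq
    grind

/-- The graph `H` with all edges meeting `T` removed. -/
def SimpleGraph.avoid {V : Type*} (H : SimpleGraph V) (T : Set V) : SimpleGraph V where
  Adj x y := H.Adj x y ∧ x ∉ T ∧ y ∉ T
  symm := ⟨fun _ _ h => ⟨h.1.symm, h.2.2, h.2.1⟩⟩
  loopless := ⟨fun _ h => h.1.ne rfl⟩

theorem SimpleGraph.avoid_le {V : Type*} (H : SimpleGraph V) (T : Set V) : H.avoid T ≤ H :=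
  fun _ _ h => h.1

theorem SimpleGraph.notMem_of_mem_support_avoid {V : Type*} {H : SimpleGraph V} {T : Set V}
    {x y : V} (p : (H.avoid T).Walk x y) (hx : x ∉ T) : ∀ z ∈ p.support, z ∉ T := by
  induction p with
  | nil => simpa using hx
  | cons h p ih =>
    simp only [Walk.support_cons, List.mem_cons]
    rintro z (rfl | hz)
    exacts [hx, ih h.2.2 z hz]

theorem SimpleGraph.Walk.exists_reachable_avoid {V : Type*} {H : SimpleGraph V} {T : Set V}
    {x t : V} (p : H.Walk x t) (hx : x ∉ T) (ht : t ∈ T) :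
    ∃ z, (H.avoid T).Reachable x z ∧ z ∉ T ∧ ∃ s ∈ T, H.Adj z s := by
  induction p with
  | nil => exact absurd ht hx
  | @cons x y t h p ih =>
    by_cases hy : y ∈ T
    · exact ⟨x, .rfl, hx, y, hy, h⟩
    · obtain ⟨z, hz, h'⟩ := ih hy ht
      have hxy : (H.avoid T).Adj x y := ⟨h, hx, hy⟩
      exact ⟨z, hxy.reachable.trans hz, h'⟩

/-- If all odd cycles are triangles, then a path outside a triangle `T` that connects
neighbours of distinct vertices of `T` is trivial. -/
theorem SimpleGraph.eq_of_reachable_avoid_triangle {V : Type*} {H : SimpleGraph V}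
    (hodd : ∀ (u : V) (c : H.Walk u u), c.IsCycle → Odd c.length → c.length = 3)
    {T : Set V} (hT : T.Pairwise H.Adj) {x z g t k : V} (hg : g ∈ T) (ht : t ∈ T) (hk : k ∈ T)
    (hgt : g ≠ t) (hgk : g ≠ k) (htk : t ≠ k) (hx : x ∉ T)
    (hxz : (H.avoid T).Reachable x z) (hgx : H.Adj g x) (hzt : H.Adj z t) : x = z := by
  obtain ⟨p, hp⟩ := hxz.exists_isPath
  have hsup := notMem_of_mem_support_avoid p hx
  let p' : H.Walk x z := p.mapLe (H.avoid_le T)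
  have hp' : p'.IsPath := hp.mapLe _
  have hsup' : ∀ y ∈ p'.support, y ∉ T := by simpa [p'] using hsup
  have hq : (p'.concat hzt).IsPath := hp'.concat (fun h => hsup' _ h ht) hzt
  have hgq : g ∉ (p'.concat hzt).support := by
    simp only [Walk.support_concat, List.mem_append, List.mem_singleton]
    rintro (h | h)
    exacts [hsup' _ h hg, hgt h]
  have hpath : (Walk.cons hgx (p'.concat hzt)).IsPath := hq.cons hgq
  have hlen : (Walk.cons hgx (p'.concat hzt)).length = p'.length + 2 := by simp
  have hkq : k ∉ (p'.concat hzt).support := by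
    simp only [Walk.support_concat, List.mem_append, List.mem_singleton]
    rintro (h | h)
    exacts [hsup' _ h hk, htk h.symm]
  have h1 := hodd _ _ (hpath.isCycle_append (q := (hT ht hg hgt.symm).toWalk) (by simp [hgt.symm])
    (by simpa using hgq) (by omega))
  have h2 := hodd _ _ (hpath.isCycle_append
    (q := .cons (hT ht hk htk) (hT hk hg hgk.symm).toWalk)
    (by simp [hgt.symm, htk, hgk.symm]) (by
      simp only [Walk.support_cons, List.tail_cons, List.disjoint_left]
      intro y hy
      simp
      grind) (by omega))
  simp only [Walk.length_append, hlen, Walk.length_cons, Walk.length_nil, Adj.toWalk] at h1 h2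
  have h0 : p'.length = 0 := by grind
  exact Walk.eq_of_length_eq_zero h0

theorem SimpleGraph.not_adj_five_cycle {V : Type*} {H : SimpleGraph V}
    (hodd : ∀ (u : V) (c : H.Walk u u), c.IsCycle → Odd c.length → c.length = 3)
    {a b c d e : V} (hab : H.Adj a b) (hbc : H.Adj b c) (hcd : H.Adj c d) (hde : H.Adj d e)
    (hea : H.Adj e a) (hac : a ≠ c) (had : a ≠ d) (hbd : b ≠ d) (hbe : b ≠ e) (hce : c ≠ e) :
    False := by
  have h := hodd a (.cons hab (.cons hbc (.cons hcd (.cons hde (.cons hea .nil))))) (by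
    rw [Walk.cons_isCycle_iff]
    have := hab.ne; have := hbc.ne; have := hcd.ne; have := hde.ne; have := hea.ne
    simp
    grind) (by simp; decide)
  simp at h

/-- A graph without cut vertices in which every odd cycle is a triangle and which contains the
triangle `T` has, up to isolated vertices, a dominating edge in `T` or is complete on four
vertices. -/
theorem SimpleGraph.edge_dominating_or_four_vertices {V : Type*} {H : SimpleGraph V}
    (hodd : ∀ (u : V) (c : H.Walk u u), c.IsCycle → Odd c.length → c.length = 3)
    (hconn : ∀ v x y : V, x ≠ v → y ≠ v → (∃ x', H.Adj x x') → (∃ y', H.Adj y y') →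
      (H.avoid {v}).Reachable x y)
    {a b c : V} (hab : H.Adj a b) (hbc : H.Adj b c) (hac : H.Adj a c) :
    (∃ u v, H.Adj u v ∧ ∀ x y, H.Adj x y → x = u ∨ x = v ∨ y = u ∨ y = v) ∨
      ∃ d, H.Adj a d ∧ H.Adj b d ∧ H.Adj c d ∧
        ∀ x y, H.Adj x y → x = a ∨ x = b ∨ x = c ∨ x = d := by
  classical
  have hab' := hab.ne
  have hbc' := hbc.ne
  have hac' := hac.ne
  let T : Set V := {a, b, c}
  have hmem : ∀ x, x ∈ T ↔ x = a ∨ x = b ∨ x = c := by simp [T]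
  have hT : T.Pairwise H.Adj := by
    intro x hx y hy hxy
    rw [hmem] at hx hy
    have := hab.symm; have := hbc.symm; have := hac.symm
    grind
  have hother : ∀ g, ∃ t ∈ T, t ≠ g := fun g => by
    by_cases h : a = g
    · exact ⟨b, by simp [T], by grind⟩
    · exact ⟨a, by simp [T], h⟩
  have hthird : ∀ g t, ∃ k ∈ T, g ≠ k ∧ t ≠ k := fun g t => by
    by_cases ha : g = a ∨ t = a
    · by_cases hb : g = b ∨ t = b
      · exact ⟨c, by simp [T], by grind, by grind⟩
      · exact ⟨b, by simp [T], by grind, by grind⟩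
    · exact ⟨a, by simp [T], by grind, by grind⟩
  have key : ∀ x z g t, g ∈ T → t ∈ T → g ≠ t → x ∉ T → (H.avoid T).Reachable x z →
      H.Adj g x → H.Adj z t → x = z := by
    intro x z g t hg ht hgt hx hxz hgx hzt
    obtain ⟨k, hk, hgk, htk⟩ := hthird g t
    exact eq_of_reachable_avoid_triangle hodd hT hg ht hk hgt hgk htk hx hxz hgx hzt
  have hmono : ∀ v x y, ((H.avoid {v}).avoid T).Reachable x y → (H.avoid T).Reachable x y :=
    fun v x y h => h.mono (show (H.avoid {v}).avoid T ≤ H.avoid T from fun _ _ h => ⟨h.1.1, h.2⟩)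
  have hTadj : ∀ t ∈ T, ∃ y, H.Adj t y := fun t ht => by
    obtain ⟨g, hg, hgt⟩ := hother t
    exact ⟨g, hT ht hg hgt.symm⟩
  have htwo : ∀ x ∉ T, ∀ g ∈ T, H.Adj g x → ∃ t ∈ T, t ≠ g ∧ H.Adj t x := by
    intro x hx g hg hgx
    obtain ⟨s, hs, hsg⟩ := hother g
    obtain ⟨p⟩ := hconn g x s hgx.ne' hsg ⟨g, hgx.symm⟩ (hTadj s hs)
    obtain ⟨z, hz, hzT, t, ht, hzt⟩ := p.exists_reachable_avoid hx hs
    have htg : t ≠ g := hzt.2.2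
    obtain rfl := key x z g t hg ht htg.symm hx (hmono _ _ _ hz) hgx hzt.1
    exact ⟨t, ht, htg, hzt.1.symm⟩
  have hout : ∀ x ∉ T, ∀ y ∉ T, ∀ g ∈ T, H.Adj g x → ¬ H.Adj x y := by
    intro x hx y hy g hg hgx hxy
    obtain ⟨p⟩ := hconn x y g hxy.ne' hgx.ne ⟨x, hxy.symm⟩ (hTadj g hg)
    obtain ⟨z, hz, hzT, t, ht, hzt⟩ := p.exists_reachable_avoid hy hg
    have hxy' : (H.avoid T).Adj x y := ⟨hxy, hx, hy⟩
    have hxz := hxy'.reachable.trans (hmono _ _ _ hz)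
    have hne : z ≠ x := hzt.2.1
    by_cases hgt : g = t
    · subst hgt
      obtain ⟨g', hg', hne', hgx'⟩ := htwo x hx g hg hgx
      exact hne (key x z g' g hg' ht hne' hx hxz hgx' hzt.1).symm
    · exact hne (key x z g t hg ht hgt hx hxz hgx hzt.1).symm
  have hdom : ∀ w ∉ T, (∃ w', H.Adj w w') → ∃ g ∈ T, H.Adj g w := by
    intro w hw hw'
    obtain ⟨p⟩ := hconn a w b (by grind) (by grind) hw' ⟨c, hbc⟩
    obtain ⟨z, hz, hzT, t, ht, hzt⟩ := p.exists_reachable_avoid hw (by simp [T])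
    obtain ⟨q⟩ := (hmono _ _ _ hz).symm
    cases q with
    | nil => exact ⟨t, ht, hzt.1.symm⟩
    | cons h q => exact absurd h.1 (hout z hzT _ h.2.2 t ht hzt.1.symm)
  have hmeet : ∀ x y, H.Adj x y → x ∉ T → y ∈ T := by
    intro x y hxy hx
    by_contra hy
    obtain ⟨g, hg, hgx⟩ := hdom x hx ⟨y, hxy⟩
    exact hout x hx y hy g hg hgx hxy
  by_cases hd : ∃ d, H.Adj a d ∧ H.Adj b d ∧ H.Adj c d
  · obtain ⟨d, had, hbd, hcd⟩ := hd
    refine Or.inr ⟨d, had, hbd, hcd, fun x y hxy => ?_⟩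
    by_contra! hx
    have hxT : x ∉ T := by rw [hmem]; grind
    obtain ⟨g, hg, hgx⟩ := hdom x hxT ⟨y, hxy⟩
    obtain ⟨t, ht, htg, htx⟩ := htwo x hxT g hg hgx
    obtain ⟨k, hk, hgk, htk⟩ := hthird g t
    have hTd : ∀ s ∈ T, H.Adj s d := fun s hs => by rw [hmem] at hs; grind
    refine not_adj_five_cycle hodd hgx htx.symm (hT ht hk htk) (hTd k hk) (hTd g hg).symm
      htg.symm hgk ?_ ?_ (hTd t ht).ne
    · rintro rfl; exact hxT hk
    · exact hx.2.2.2
  · left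
    by_cases hw : ∃ w ∉ T, ∃ w', H.Adj w w'
    · obtain ⟨w, hw, hw'⟩ := hw
      obtain ⟨u, hu, huw⟩ := hdom w hw hw'
      obtain ⟨v, hv, hvu, hvw⟩ := htwo w hw u hu huw
      obtain ⟨k, hk, huk, hvk⟩ := hthird u v
      have hkw : ∀ x, H.Adj u x → H.Adj v x → ¬ H.Adj k x := by
        intro x h1 h2 h3
        refine hd ⟨x, ?_⟩
        rw [hmem] at hu hv hk
        grind
      have hkx : ∀ x ∉ T, ¬ H.Adj k x := by
        intro x hx hkx
        have hwx : w ≠ x := by rintro rfl; exact hkw w huw hvw hkx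
        obtain ⟨s, hs, hsk, hsx⟩ := htwo x hx k hk hkx
        have hs' : s = u ∨ s = v := by
          rw [hmem] at hu hv hk hs
          grind
        rcases hs' with rfl | rfl
        · exact not_adj_five_cycle hodd huw hvw.symm (hT hv hk hvk) hkx hsx.symm
            hvu.symm huk (by rintro rfl; exact hw hk) hwx (by rintro rfl; exact hx hv)
        · exact not_adj_five_cycle hodd hvw huw.symm (hT hu hk huk) hkx hsx.symm
            hvu hvk (by rintro rfl; exact hw hk) hwx (by rintro rfl; exact hx hu)
      refine ⟨u, v, hT hu hv hvu.symm, fun x y hxy => ?_⟩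
      have hall : ∀ s ∈ T, s = u ∨ s = v ∨ s = k := by
        intro s hs
        rw [hmem] at hu hv hk hs
        grind
      by_contra! hcon
      by_cases hx : x ∈ T
      · by_cases hy : y ∈ T
        · have := hall x hx; have := hall y hy; have := hxy.ne; grind
        · have : x = k := by have := hall x hx; grind
          exact hkx y hy (this ▸ hxy)
      · have hy := hmeet x y hxy hx
        have : y = k := by have := hall y hy; grind
        exact hkx x hx (this ▸ hxy.symm)
    · push Not at hw
      refine ⟨a, b, hab, fun x y hxy => ?_⟩
      have hx : x ∈ T := by by_contra hx; exact hw x hx y hxy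
      have hy : y ∈ T := by by_contra hy; exact hw y hy x hxy.symm
      rw [hmem] at hx hy
      have := hxy.ne
      grind
/-- In a clique `C` all of whose subcliques have sinks, some vertex `p` of a given set `P` splits
`C` into the vertices that dominate `p` and a set `U` of vertices that are dominated by everything
outside `U`, with `U` disjoint from `P`. -/
theorem exists_split_of_sinks {α : Type*} [Finite α] {D : α → α → Prop} (n : ℕ) :
    ∀ C P : Set α, C.ncard = n → P ⊆ C → P.Nonempty →
    (∀ K ⊆ C, K.Nonempty → ∃ s ∈ K, ∀ f ∈ K, f ≠ s → D f s) →
    ∃ p ∈ P, ∃ U ⊆ C, Disjoint U P ∧ (∀ f ∈ C, f ∉ U → f ≠ p → D f p) ∧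
      ∀ f ∈ C, f ∉ U → ∀ g ∈ U, D f g := by
  induction n with
  | zero =>
    intro C P hn hPC hP _
    rw [Set.ncard_eq_zero] at hn
    subst hn
    exact absurd (hP.mono hPC) Set.not_nonempty_empty
  | succ n ih =>
    intro C P hn hPC hP hC
    obtain ⟨s, hs, hsink⟩ := hC C le_rfl (hP.mono hPC)
    by_cases hsP : s ∈ P
    · exact ⟨s, hsP, ∅, by simp, by simp, fun f hf _ => hsink f hf, by simp⟩
    · obtain ⟨p, hp, U, hU, hUP, h1, h2⟩ := ih (C \ {s}) P
        (by rw [Set.ncard_sdiff_singleton_of_mem hs]; omega) (by grind) hP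
        (fun K hK => hC K (hK.trans Set.sdiff_subset))
      refine ⟨p, hp, insert s U, by grind, ?_, ?_, ?_⟩
      · rw [Set.disjoint_left] at *
        grind
      · intro f hf hfU hfp
        exact h1 f (by grind) (by grind) hfp
      · intro f hf hfU g hg
        rcases hg with rfl | hg
        · exact hsink f hf (by grind)
        · exact h2 f (by grind) (by grind) g hg

/-- A kernel exists in the union of two cliques `A`, `B` with a common vertex `e` if the remaining
arcs between `A` and `B` form a matching and span triangles with sinks. -/
theorem HasKernel.of_two_cliques {α : Type*} {D : α → α → Prop} {A B : Set α} {e : α}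
    (heA : e ∈ A) (heB : e ∈ B) (hirr : ∀ a, ¬ D a a)
    (hA : ∀ K ⊆ A, K.Nonempty → ∃ s ∈ K, ∀ f ∈ K, f ≠ s → D f s)
    (hB : ∀ K ⊆ B, K.Nonempty → ∃ s ∈ K, ∀ f ∈ K, f ≠ s → D f s)
    (htri : ∀ s ∈ A, ∀ t ∈ B, s ≠ e → t ≠ e → (D s t ∨ D t s) →
      (D e s ∧ D t s) ∨ (D s e ∧ D t e) ∨ (D s t ∧ D e t))
    (huA : ∀ s ∈ A, ∀ t ∈ B, ∀ t' ∈ B, s ≠ e → t ≠ e → t' ≠ e →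
      (D s t ∨ D t s) → (D s t' ∨ D t' s) → t = t')
    (huB : ∀ t ∈ B, ∀ s ∈ A, ∀ s' ∈ A, t ≠ e → s ≠ e → s' ≠ e →
      (D s t ∨ D t s) → (D s' t ∨ D t s') → s = s')
    (hpick : ∀ q ∈ A ∪ B, (∀ f ∈ A ∪ B, D q f → D f q) → HasKernel D (A ∪ B)) :
    HasKernel D (A ∪ B) := by
  have hpair : ∀ s ∈ A, ∀ t ∈ B, (¬ D s t ∧ ¬ D t s) →
      (∀ f ∈ A ∪ B, f ≠ s → f ≠ t → D f s ∨ D f t) → HasKernel D (A ∪ B) := by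
    intro s hs t ht hst h
    refine ⟨{s, t}, by grind, ?_, ?_⟩
    · rintro a (rfl | rfl) b (rfl | rfl)
      exacts [hirr _, hst.1, hst.2, hirr _]
    · intro z hz hzS
      simpa using h z hz (by grind) (by grind)
  have hone : (∀ f ∈ A ∪ B, f ≠ e → D f e) → HasKernel D (A ∪ B) := fun h =>
    hpair e heA e heB ⟨hirr e, hirr e⟩ fun f hf hfe _ => Or.inl (h f hf hfe)
  have hboth : ∀ s ∈ A, ∀ t ∈ B, s ≠ e → t ≠ e → (∀ f ∈ A, f ≠ s → D f s) →
      (∀ f ∈ B, f ≠ t → D f t) → HasKernel D (A ∪ B) := by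
    intro s hs t ht hse hte h1 h2
    by_cases hst : D s t
    · refine hpick t (Or.inr ht) ?_
      rintro f (hf | hf) hD
      · by_cases hfe : f = e
        · subst hfe; exact h2 _ heB hte.symm
        · rw [huB t ht f hf s hs hte hfe hse (Or.inr hD) (Or.inl hst)]; exact hst
      · exact h2 f hf (by rintro rfl; exact hirr _ hD)
    by_cases hts : D t s
    · refine hpick s (Or.inl hs) ?_
      rintro f (hf | hf) hD
      · exact h1 f hf (by rintro rfl; exact hirr _ hD)
      · by_cases hfe : f = e
        · subst hfe; exact h1 _ heA hse.symm
        · rw [huA s hs f hf t ht hse hfe hte (Or.inl hD) (Or.inr hts)]; exact hts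
    · refine hpair s hs t ht ⟨hst, hts⟩ ?_
      rintro f (hf | hf) hfs hft
      exacts [Or.inl (h1 f hf hfs), Or.inr (h2 f hf hft)]
  have main : ∀ A' B' : Set α, e ∈ A' → e ∈ B' → A' ∪ B' = A ∪ B →
      (∀ K ⊆ A', K.Nonempty → ∃ s ∈ K, ∀ f ∈ K, f ≠ s → D f s) →
      (∀ K ⊆ B', K.Nonempty → ∃ s ∈ K, ∀ f ∈ K, f ≠ s → D f s) →
      (∀ s ∈ A', ∀ t ∈ B', s ≠ e → t ≠ e → (D s t ∨ D t s) →
        (D e s ∧ D t s) ∨ (D s e ∧ D t e) ∨ (D s t ∧ D e t)) →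
      (∀ s ∈ A', ∀ t ∈ B', ∀ t' ∈ B', s ≠ e → t ≠ e → t' ≠ e →
        (D s t ∨ D t s) → (D s t' ∨ D t' s) → t = t') →
      (∀ t ∈ B', ∀ s ∈ A', ∀ s' ∈ A', t ≠ e → s ≠ e → s' ≠ e →
        (D s t ∨ D t s) → (D s' t ∨ D t s') → s = s') →
      (∀ s ∈ A', ∀ t ∈ B', (¬ D s t ∧ ¬ D t s) →
        (∀ f ∈ A ∪ B, f ≠ s → f ≠ t → D f s ∨ D f t) → HasKernel D (A ∪ B)) →
      (∀ s ∈ A', ∀ t ∈ B', s ≠ e → t ≠ e → (∀ f ∈ A', f ≠ s → D f s) →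
        (∀ f ∈ B', f ≠ t → D f t) → HasKernel D (A ∪ B)) →
      (∀ f ∈ B', f ≠ e → D f e) → HasKernel D (A ∪ B) := by
    intro A' B' heA heB hE hA hB htri huA huB hpair hboth heB'
    obtain ⟨s, hs, hsA⟩ := hA A' le_rfl ⟨e, heA⟩
    have hsE : s ∈ A ∪ B := hE ▸ Or.inl hs
    by_cases hse : s = e
    · subst hse
      refine hone fun f hf hfe => ?_
      rw [← hE] at hf
      exact hf.elim (fun h => hsA f h hfe) (fun h => heB' f h hfe)
    by_cases hs' : ∀ f ∈ A ∪ B, D s f → D f s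
    · exact hpick s hsE hs'
    push Not at hs'
    obtain ⟨t, htE, hst, hts⟩ := hs'
    have htA : t ∉ A' := fun h => hts (hsA t h (by rintro rfl; exact hirr _ hst))
    have ht : t ∈ B' := by rw [← hE] at htE; exact htE.resolve_left htA
    have hte : t ≠ e := by rintro rfl; exact htA heA
    obtain ⟨r, ⟨hr, hre⟩, hrB⟩ := hB (B' \ {e}) Set.sdiff_subset ⟨t, ht, hte⟩
    have hre' : r ≠ e := hre
    by_cases hrt : r = t
    · subst hrt
      rcases htri s hs r ht hse hte (Or.inl hst) with h | h | h
      · exact absurd h.2 hts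
      · obtain ⟨q, ⟨hq, hqs⟩, hqA⟩ := hA (A' \ {s}) Set.sdiff_subset ⟨e, heA, Ne.symm hse⟩
        by_cases hqe : q = e
        · subst hqe
          refine hone fun f hf hfe => ?_
          rw [← hE] at hf
          by_cases hfs : f = s
          · rw [hfs]; exact h.1
          · exact hf.elim (fun h => hqA f ⟨h, hfs⟩ hfe) (fun h => heB' f h hfe)
        · have hn : ¬ (D q r ∨ D r q) := fun h' =>
            hqs (huB r ht q hq s hs hte hqe hse h' (Or.inl hst))
          refine hpair q hq r ht (not_or.1 hn) fun f hf hfq hfr => ?_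
          rw [← hE] at hf
          by_cases hfs : f = s
          · rw [hfs]; exact Or.inr hst
          by_cases hfe : f = e
          · rw [hfe]; exact Or.inl (hqA e ⟨heA, Ne.symm hse⟩ (Ne.symm hqe))
          · exact hf.elim (fun h => Or.inl (hqA f ⟨h, hfs⟩ hfq))
              (fun h => Or.inr (hrB f ⟨h, hfe⟩ hfr))
      · refine hboth s hs r ht hse hte hsA fun f hf hfr => ?_
        by_cases hfe : f = e
        · rw [hfe]; exact h.2
        · exact hrB f ⟨hf, hfe⟩ hfr
    · have hn : ¬ (D s r ∨ D r s) := fun h' =>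
        hrt (huA s hs r hr t ht hse hre' hte h' (Or.inl hst))
      refine hpair s hs r hr (not_or.1 hn) fun f hf hfs hfr => ?_
      rw [← hE] at hf
      by_cases hfe : f = e
      · rw [hfe]; exact Or.inl (hsA e heA (Ne.symm hse))
      · exact hf.elim (fun h => Or.inl (hsA f h hfs)) (fun h => Or.inr (hrB f ⟨h, hfe⟩ hfr))
  obtain ⟨s, hs, hsA⟩ := hA A le_rfl ⟨e, heA⟩
  obtain ⟨t, ht, htB⟩ := hB B le_rfl ⟨e, heB⟩
  by_cases hte : t = e
  · subst hte
    exact main A B heA heB rfl hA hB htri huA huB hpair hboth htB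
  by_cases hse : s = e
  · subst hse
    refine main B A heB heA (Set.union_comm B A) hB hA ?_ ?_ ?_ ?_ ?_ hsA
    · intro x hx y hy hxe hye h
      have := htri y hy x hx hye hxe h.symm
      tauto
    · exact fun x hx y hy y' hy' h1 h2 h3 h4 h5 => huB x hx y hy y' hy' h1 h2 h3 h4.symm h5.symm
    · exact fun x hx y hy y' hy' h1 h2 h3 h4 h5 => huA x hx y hy y' hy' h1 h2 h3 h4.symm h5.symm
    · exact fun x hx y hy h1 h2 => hpair y hy x hx h1.symm fun f hf hy hx => (h2 f hf hx hy).symm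
    · exact fun x hx y hy h1 h2 h3 h4 => hboth y hy x hx h2 h1 h4 h3
  · exact hboth s hs t ht hse hte hsA htB

/-- The octahedron: three pairs of nonadjacent vertices. One of the pairs is a kernel if all
triangles have sinks. -/
theorem HasKernel.of_octahedron {α : Type*} {D : α → α → Prop} {E : Set α} {e f g : Bool → α}
    (hE : ∀ x, x ∈ E ↔ ∃ i, x = e i ∨ x = f i ∨ x = g i)
    (he : ∀ i j, ¬ D (e i) (e j)) (hf : ∀ i j, ¬ D (f i) (f j)) (hg : ∀ i j, ¬ D (g i) (g j))
    (hef : ∀ i j, D (e i) (f j) ∨ D (f j) (e i)) (heg : ∀ i j, D (e i) (g j) ∨ D (g j) (e i))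
    (hfg : ∀ i j, D (f i) (g j) ∨ D (g j) (f i))
    (htri : ∀ i j k, (D (f j) (e i) ∧ D (g k) (e i)) ∨ (D (e i) (f j) ∧ D (g k) (f j)) ∨
      (D (e i) (g k) ∧ D (f j) (g k))) : HasKernel D E := by
  have key : ∀ e : Bool → α, (∀ i, e i ∈ E) → (∀ i j, ¬ D (e i) (e j)) → ¬ HasKernel D E →
      ∃ z ∈ E, (∀ i, z ≠ e i) ∧ ∀ i, ¬ D z (e i) := by
    intro e heE he h
    by_contra! hcon
    refine h ⟨Set.range e, by grind, by rintro _ ⟨i, rfl⟩ _ ⟨j, rfl⟩; exact he i j, ?_⟩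
    intro z hz hzS
    obtain ⟨i, hi⟩ := hcon z hz (fun i h => hzS ⟨i, h.symm⟩)
    exact ⟨e i, ⟨i, rfl⟩, hi⟩
  by_contra hcon
  obtain ⟨x, hx, hxe, hxD⟩ := key e (fun i => (hE _).2 ⟨i, Or.inl rfl⟩) he hcon
  obtain ⟨y, hy, hyf, hyD⟩ := key f (fun i => (hE _).2 ⟨i, Or.inr (Or.inl rfl)⟩) hf hcon
  obtain ⟨z, hz, hzg, hzD⟩ := key g (fun i => (hE _).2 ⟨i, Or.inr (Or.inr rfl)⟩) hg hcon
  rw [hE] at hx hy hz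
  obtain ⟨i, hx⟩ := hx
  obtain ⟨j, hy⟩ := hy
  obtain ⟨k, hz⟩ := hz
  rcases hx with rfl | rfl | rfl
  · exact hxe i rfl
  · rcases hy with rfl | rfl | rfl
    · exact (hef j i).elim (hyD i) (hxD j)
    · exact hyf j rfl
    · rcases hz with rfl | rfl | rfl
      · have := htri k i j
        have := hxD k; have := hyD i; have := hzD j
        tauto
      · exact (hfg k j).elim (hzD j) (hyD k)
      · exact hzg k rfl
  · rcases hy with rfl | rfl | rfl
    · rcases hz with rfl | rfl | rfl
      · exact (heg k i).elim (hzD i) (hxD k)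
      · have := htri j k i
        have := hxD j; have := hyD k; have := hzD i
        tauto
      · exact hzg k rfl
    · exact hyf j rfl
    · rcases hz with rfl | rfl | rfl
      · exact (heg k i).elim (hzD i) (hxD k)
      · exact (hfg k j).elim (hzD j) (hyD k)
      · exact hzg k rfl

/-- Two edges meet if they are distinct and share an endpoint. -/
def Sym2.Meets {V : Type*} (e f : Sym2 V) : Prop := e ≠ f ∧ ∃ x, x ∈ e ∧ x ∈ f

/-- `D` is a digraph of pairs of meeting edges in which each clique of edges in `E` has a sink. -/
structure SinkOrientation {V : Type*} (E : Set (Sym2 V)) (D : Sym2 V → Sym2 V → Prop) : Prop where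
  meets : ∀ a b, D a b → a.Meets b
  sink : ∀ K ⊆ E, K.Pairwise Sym2.Meets → K.Nonempty → ∃ e ∈ K, ∀ f ∈ K, f ≠ e → D f e

/-- The members of `E` at the vertex `x`. -/
def edgesAt {V : Type*} (E : Set (Sym2 V)) (x : V) : Set (Sym2 V) := {e ∈ E | x ∈ e}

theorem SinkOrientation.mono {V : Type*} {E E' : Set (Sym2 V)} {D : Sym2 V → Sym2 V → Prop}
    (h : SinkOrientation E D) (hE : E' ⊆ E) : SinkOrientation E' D :=
  ⟨h.meets, fun K hK => h.sink K (hK.trans hE)⟩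

theorem SinkOrientation.irrefl {V : Type*} {E : Set (Sym2 V)} {D : Sym2 V → Sym2 V → Prop}
    (h : SinkOrientation E D) (a : Sym2 V) : ¬ D a a := fun h' => (h.meets a a h').1 rfl

theorem SinkOrientation.total {V : Type*} {E : Set (Sym2 V)} {D : Sym2 V → Sym2 V → Prop}
    (h : SinkOrientation E D) {a b : Sym2 V} (ha : a ∈ E) (hb : b ∈ E) (hab : a.Meets b) :
    D a b ∨ D b a := by
  have hba : b.Meets a := ⟨hab.1.symm, hab.2.imp fun _ h => h.symm⟩
  obtain ⟨s, hs, h'⟩ := h.sink {a, b} (by grind)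
    (Set.pairwise_pair.2 fun _ => ⟨hab, hba⟩) ⟨a, by simp⟩
  rcases hs with rfl | rfl
  · exact Or.inr (h' b (by simp) hab.1.symm)
  · exact Or.inl (h' a (by simp) hab.1)

theorem SinkOrientation.triangle {V : Type*} {E : Set (Sym2 V)} {D : Sym2 V → Sym2 V → Prop}
    (h : SinkOrientation E D) {a b c : Sym2 V} (ha : a ∈ E) (hb : b ∈ E) (hc : c ∈ E)
    (hab : a.Meets b) (hac : a.Meets c) (hbc : b.Meets c) :
    (D b a ∧ D c a) ∨ (D a b ∧ D c b) ∨ (D a c ∧ D b c) := by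
  have hsymm : ∀ {x y : Sym2 V}, x.Meets y → y.Meets x :=
    fun h => ⟨h.1.symm, h.2.imp fun _ h => h.symm⟩
  obtain ⟨s, hs, h'⟩ := h.sink {a, b, c} (by grind) (by
    intro x hx y hy hxy
    have := hsymm hab; have := hsymm hac; have := hsymm hbc
    simp only [Set.mem_insert_iff, Set.mem_singleton_iff] at hx hy
    rcases hx with rfl | rfl | rfl <;> rcases hy with rfl | rfl | rfl <;> trivial) ⟨a, by simp⟩
  have := hab.1; have := hac.1; have := hbc.1
  simp only [Set.mem_insert_iff, Set.mem_singleton_iff] at hs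
  rcases hs with rfl | rfl | rfl
  · exact Or.inl ⟨h' b (by simp) (by grind), h' c (by simp) (by grind)⟩
  · exact Or.inr (Or.inl ⟨h' a (by simp) (by grind), h' c (by simp) (by grind)⟩)
  · exact Or.inr (Or.inr ⟨h' a (by simp) (by grind), h' b (by simp) (by grind)⟩)

theorem SinkOrientation.sink_edgesAt {V : Type*} {E : Set (Sym2 V)} {D : Sym2 V → Sym2 V → Prop}
    (h : SinkOrientation E D) (x : V) :
    ∀ K ⊆ edgesAt E x, K.Nonempty → ∃ s ∈ K, ∀ f ∈ K, f ≠ s → D f s :=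
  fun K hK => h.sink K (fun _ he => (hK he).1)
    fun _ he _ hf hef => ⟨hef, x, (hK he).2, (hK hf).2⟩

/-- Every sink orientation of a proper subset of `E` has a kernel. -/
def KernelBelow {V : Type*} (E : Set (Sym2 V)) : Prop :=
  ∀ E' ⊂ E, ∀ D : Sym2 V → Sym2 V → Prop, SinkOrientation E' D → HasKernel D E'

theorem KernelBelow.pick {V : Type*} {E : Set (Sym2 V)} {D : Sym2 V → Sym2 V → Prop}
    (ih : KernelBelow E) (h : SinkOrientation E D) {q : Sym2 V} (hq : q ∈ E)
    (hqD : ∀ f ∈ E, D q f → D f q) : HasKernel D E := by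
  obtain ⟨S, hS, hi, ha⟩ := ih {f ∈ E | f ≠ q ∧ ¬ D f q} (by
    refine ⟨fun f hf => hf.1, fun h => (h hq).2.1 rfl⟩) D (h.mono fun f hf => hf.1)
  refine ⟨insert q S, by grind, ?_, ?_⟩
  · rintro a (rfl | ha') b (rfl | hb)
    · exact h.irrefl _
    · exact fun h => (hS hb).2.2 (hqD b (hS hb).1 h)
    · exact (hS ha').2.2
    · exact hi a ha' b hb
  · intro z hz hzS
    by_cases hzq : D z q
    · exact ⟨q, by simp, hzq⟩
    · obtain ⟨s, hs, hD⟩ := ha z ⟨hz, by grind, hzq⟩ (by grind)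
      exact ⟨s, by simp [hs], hD⟩

/-- Let `p = xy` be a sink at `x` that lies in no triangle. If some `f` at `y` dominates `p` and
all edges at `y` dominated by `p`, then `f` can be deleted. -/
theorem KernelBelow.reduce {V : Type*} {E : Set (Sym2 V)} {D : Sym2 V → Sym2 V → Prop}
    (ih : KernelBelow E) (h : SinkOrientation E D) {x y : V} (hxy : x ≠ y) (hp : s(x, y) ∈ E)
    (hpx : ∀ e ∈ E, x ∈ e → e ≠ s(x, y) → D e s(x, y))
    (hnt : ∀ e ∈ E, ∀ f ∈ E, x ∈ e → y ∈ f → e ≠ s(x, y) → f ≠ s(x, y) → ¬ e.Meets f)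
    {U : Set (Sym2 V)} (hU : U ⊆ edgesAt E y) (hpU : s(x, y) ∉ U)
    (h1 : ∀ f ∈ edgesAt E y, f ∉ U → f ≠ s(x, y) → D f s(x, y))
    (h2 : ∀ f ∈ edgesAt E y, f ∉ U → ∀ g ∈ U, D f g)
    {f : Sym2 V} (hf : f ∈ edgesAt E y) (hfU : f ∉ U) (hfp : f ≠ s(x, y)) : HasKernel D E := by
  set p := s(x, y) with hpdef
  have hxp : x ∈ p := by simp [hpdef]
  have hyp : y ∈ p := by simp [hpdef]
  have hUx : ∀ g ∈ U, x ∉ g := fun g hg hx =>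
    hpU ((show g = p from (Sym2.mem_and_mem_iff hxy).1 ⟨hx, (hU hg).2⟩) ▸ hg)
  have hpg : ∀ g ∈ U, D p g := fun g hg => h2 p ⟨hp, hyp⟩ hpU g hg
  obtain ⟨S, hS, hi, ha⟩ := ih (E \ {f})
    ⟨Set.sdiff_subset, fun h => (h hf.1).2 rfl⟩
    (fun a b => D a b ∧ (a = p → b ∈ U) ∧ (b = p → a ∉ U)) ⟨fun a b h' => h.meets a b h'.1, by
      intro K hK hKm hKne
      by_cases hpK : p ∈ K
      · by_cases hKx : ∀ e ∈ K, x ∈ e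
        · exact ⟨p, hpK, fun e he hep => ⟨hpx e (hK he).1 (hKx e he) hep,
            fun h => absurd h hep, fun _ heU => hUx e heU (hKx e he)⟩⟩
        have hKy : ∀ e ∈ K, y ∈ e := by
          by_contra! hcon
          obtain ⟨e, he, hye⟩ := hcon
          push Not at hKx
          obtain ⟨g, hg, hxg⟩ := hKx
          have hep : e ≠ p := by rintro rfl; exact hye hyp
          have hgp : g ≠ p := by rintro rfl; exact hxg hxp
          obtain ⟨-, w, hwe, hwp⟩ := hKm he hpK hep
          obtain ⟨-, w', hwg, hwp'⟩ := hKm hg hpK hgp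
          rw [hpdef, Sym2.mem_iff] at hwp hwp'
          have hxe : x ∈ e := by grind
          have hyg : y ∈ g := by grind
          exact hnt e (hK he).1 g (hK hg).1 hxe hyg hep hgp
            (hKm he hg (by rintro rfl; exact hye hyg))
        by_cases hKU : (K ∩ U).Nonempty
        · obtain ⟨s, ⟨hsK, hsU⟩, hs⟩ := h.sink_edgesAt y (K ∩ U)
            (fun e he => hU he.2) hKU
          refine ⟨s, hsK, fun g hg hgs => ⟨?_, fun _ => hsU, fun h => absurd (h ▸ hsU) hpU⟩⟩
          by_cases hgU : g ∈ U
          · exact hs g ⟨hg, hgU⟩ hgs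
          · exact h2 g ⟨(hK hg).1, hKy g hg⟩ hgU s hsU
        · have hKU' : ∀ g ∈ K, g ∉ U := fun g hg hgU => hKU ⟨g, hg, hgU⟩
          exact ⟨p, hpK, fun g hg hgp => ⟨h1 g ⟨(hK hg).1, hKy g hg⟩ (hKU' g hg) hgp,
            fun h => absurd h hgp, fun _ => hKU' g hg⟩⟩
      · obtain ⟨s, hs, h'⟩ := h.sink K (fun e he => (hK he).1) hKm hKne
        exact ⟨s, hs, fun g hg hgs => ⟨h' g hg hgs, by rintro rfl; exact absurd hg hpK,
          by rintro rfl; exact absurd hs hpK⟩⟩⟩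
  refine ⟨S, hS.trans Set.sdiff_subset, ?_, ?_⟩
  · intro a haS b hbS hab
    refine hi a haS b hbS ⟨hab, ?_, ?_⟩
    · rintro rfl
      by_contra hbU
      have hm := h.meets _ _ hab
      refine hi b hbS p haS ⟨?_, fun h => absurd h.symm hm.1, fun _ => hbU⟩
      obtain ⟨w, hwp, hwb⟩ := hm.2
      rw [hpdef, Sym2.mem_iff] at hwp
      rcases hwp with rfl | rfl
      · exact hpx b (hS hbS).1 hwb hm.1.symm
      · exact h1 b ⟨(hS hbS).1, hwb⟩ hbU hm.1.symm
    · rintro rfl haU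
      exact hi p hbS a haS ⟨hpg a haU, fun _ => haU, fun _ => hpU⟩
  · intro z hz hzS
    by_cases hzf : z = f
    · subst hzf
      by_cases hpS : p ∈ S
      · exact ⟨p, hpS, h1 z hf hfU hfp⟩
      · obtain ⟨s, hs, -, hsU, -⟩ := ha p ⟨hp, fun h => hfp h.symm⟩ hpS
        exact ⟨s, hs, h2 z hf hfU s (hsU rfl)⟩
    · obtain ⟨s, hs, hD, -⟩ := ha z ⟨hz, hzf⟩ hzS
      exact ⟨s, hs, hD⟩

/-- Induction step in the presence of a vertex of degree one. -/
theorem KernelBelow.of_pendant {V : Type*} [Finite V] {E : Set (Sym2 V)}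
    {D : Sym2 V → Sym2 V → Prop}
    (ih : KernelBelow E) (h : SinkOrientation E D) {x y : V} (hxy : x ≠ y) (hp : s(x, y) ∈ E)
    (hx : ∀ e ∈ E, x ∈ e → e = s(x, y)) : HasKernel D E := by
  have hpy : s(x, y) ∈ edgesAt E y := ⟨hp, by simp⟩
  obtain ⟨p, rfl, U, hU, hUP, h1, h2⟩ := exists_split_of_sinks _ (edgesAt E y) {s(x, y)} rfl
    (by simpa using hpy) (by simp) (h.sink_edgesAt y)
  rw [Set.disjoint_singleton_right] at hUP
  by_cases hf : ∃ f ∈ edgesAt E y, f ∉ U ∧ f ≠ s(x, y)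
  · obtain ⟨f, hf, hfU, hfp⟩ := hf
    exact ih.reduce h hxy hp (fun e he hxe hep => absurd (hx e he hxe) hep)
      (fun e he f hf hxe hyf hep => absurd (hx e he hxe) hep) hU hUP h1 h2 hf hfU hfp
  push Not at hf
  obtain ⟨S, hS, hi, ha⟩ := ih (E \ {s(x, y)}) ⟨Set.sdiff_subset, fun h => (h hp).2 rfl⟩ D
    (h.mono Set.sdiff_subset)
  by_cases hSy : ∃ s ∈ S, y ∈ s
  · obtain ⟨s, hs, hys⟩ := hSy
    refine ⟨S, hS.trans Set.sdiff_subset, hi, fun z hz hzS => ?_⟩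
    by_cases hzp : z = s(x, y)
    · subst hzp
      refine ⟨s, hs, h2 _ hpy hUP s ?_⟩
      by_contra hsU
      exact (hS hs).2 (hf s ⟨(hS hs).1, hys⟩ hsU)
    · exact ha z ⟨hz, hzp⟩ hzS
  · push Not at hSy
    have hnm : ∀ s ∈ S, ∀ w, w ∈ s → w ∉ s(x, y) := by
      intro s hs w hw hw'
      rw [Sym2.mem_iff] at hw'
      rcases hw' with rfl | rfl
      · exact (hS hs).2 (hx s (hS hs).1 hw)
      · exact hSy s hs hw
    refine ⟨insert s(x, y) S, by grind, ?_, ?_⟩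
    · rintro a (rfl | ha') b (rfl | hb) hab
      · exact h.irrefl _ hab
      · obtain ⟨w, hw, hw'⟩ := (h.meets _ _ hab).2
        exact hnm b hb w hw' hw
      · obtain ⟨w, hw, hw'⟩ := (h.meets _ _ hab).2
        exact hnm a ha' w hw hw'
      · exact hi a ha' b hb hab
    · intro z hz hzS
      obtain ⟨s, hs, hD⟩ := ha z ⟨hz, by grind⟩ (by grind)
      exact ⟨s, by simp [hs], hD⟩

/-- Induction step for bipartite graphs. -/
theorem KernelBelow.of_bipartite {V : Type*} [Finite V] {E : Set (Sym2 V)}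
    {D : Sym2 V → Sym2 V → Prop} (ih : KernelBelow E) (h : SinkOrientation E D) (X : Set V)
    (hX : ∀ x y, s(x, y) ∈ E → (x ∈ X ↔ y ∉ X)) : HasKernel D E := by
  have hmem : ∀ e ∈ E, ∀ x ∈ e, ∃ y, e = s(x, y) ∧ x ≠ y ∧ (x ∈ X ↔ y ∉ X) := by
    intro e he x hx
    obtain ⟨y, rfl⟩ := hx
    have := hX x y he
    exact ⟨y, rfl, by rintro rfl; tauto, this⟩
  have huniq : ∀ e ∈ E, ∀ x ∈ e, ∀ y ∈ e, (x ∈ X ↔ y ∈ X) → x = y := by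
    intro e he x hx y hy hxy
    obtain ⟨z, rfl, -, hz⟩ := hmem e he x hx
    rw [Sym2.mem_iff] at hy
    grind
  have hsink : ∀ x, ∃ p, (edgesAt E x).Nonempty →
      p ∈ edgesAt E x ∧ ∀ e ∈ edgesAt E x, e ≠ p → D e p := fun x => by
    by_cases hx : (edgesAt E x).Nonempty
    · obtain ⟨p, hp⟩ := h.sink_edgesAt x _ le_rfl hx
      exact ⟨p, fun _ => hp⟩
    · exact ⟨s(x, x), fun h => absurd h hx⟩
  choose p hp' using hsink
  have hp := fun x hx => (hp' x hx).1
  have hpD := fun x hx => (hp' x hx).2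
  by_cases hcol : ∃ x ∈ X, ∃ x' ∈ X, x ≠ x' ∧ (edgesAt E x).Nonempty ∧ (edgesAt E x').Nonempty ∧
      ∃ y, y ∈ p x ∧ y ∈ p x'
  · obtain ⟨x, hxX, x', hxX', hne, hx, hx', y, hy, hy'⟩ := hcol
    have hyX : y ∉ X := by
      intro hyX
      have := huniq _ (hp x hx).1 x (hp x hx).2 y hy (by simp [hxX, hyX])
      have := huniq _ (hp x' hx').1 x' (hp x' hx').2 y hy' (by simp [hxX', hyX])
      grind
    have hform : ∀ x ∈ X, (edgesAt E x).Nonempty → y ∈ p x → x ≠ y ∧ p x = s(x, y) := by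
      intro x hxX hx hy
      have hxy : x ≠ y := by rintro rfl; exact hyX hxX
      exact ⟨hxy, (Sym2.mem_and_mem_iff hxy).1 ⟨(hp x hx).2, hy⟩⟩
    have hred : ∀ x ∈ X, (edgesAt E x).Nonempty → y ∈ p x → ∀ U ⊆ edgesAt E y, p x ∉ U →
        (∀ f ∈ edgesAt E y, f ∉ U → f ≠ p x → D f (p x)) →
        (∀ f ∈ edgesAt E y, f ∉ U → ∀ g ∈ U, D f g) →
        ∀ f ∈ edgesAt E y, f ∉ U → f ≠ p x → HasKernel D E := by
      intro x hxX hx hy U hU hpU h1 h2 f hf hfU hfp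
      obtain ⟨hxy, hpx⟩ := hform x hxX hx hy
      have hpE := (hp x hx).1
      have hps := hpD x hx
      rw [hpx] at hpU h1 hfp hpE hps
      refine ih.reduce h hxy hpE (fun e he hxe hep => hps e ⟨he, hxe⟩ hep) ?_ hU hpU h1 h2
        hf hfU hfp
      rintro e he g hg hxe hyg hep hgp ⟨-, w, hwe, hwg⟩
      by_cases hwX : w ∈ X
      · obtain rfl := huniq e he x hxe w hwe (by simp [hxX, hwX])
        exact hgp ((Sym2.mem_and_mem_iff hxy).1 ⟨hwg, hyg⟩)
      · obtain rfl := huniq g hg y hyg w hwg (by simp [hyX, hwX])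
        exact hep ((Sym2.mem_and_mem_iff hxy).1 ⟨hxe, hwe⟩)
    have hpne : p x ≠ p x' := by
      intro heq
      exact hne (huniq _ (hp x hx).1 x (hp x hx).2 x' (heq ▸ (hp x' hx').2) (by simp [hxX, hxX']))
    obtain ⟨q, hq, U, hU, hUP, h1, h2⟩ := exists_split_of_sinks _ (edgesAt E y) {p x, p x'} rfl
      (by
        rintro _ (rfl | rfl)
        exacts [⟨(hp x hx).1, hy⟩, ⟨(hp x' hx').1, hy'⟩]) ⟨p x, by simp⟩ (h.sink_edgesAt y)
    have hxU : p x ∉ U := fun h => Set.disjoint_left.1 hUP h (by simp)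
    have hxU' : p x' ∉ U := fun h => Set.disjoint_left.1 hUP h (by simp)
    rcases hq with rfl | rfl
    · exact hred x hxX hx hy U hU hxU h1 h2 (p x') ⟨(hp x' hx').1, hy'⟩ hxU' hpne.symm
    · exact hred x' hxX' hx' hy' U hU hxU' h1 h2 (p x) ⟨(hp x hx).1, hy⟩ hxU hpne
  · push Not at hcol
    refine ⟨{q | ∃ x ∈ X, (edgesAt E x).Nonempty ∧ q = p x}, ?_, ?_, ?_⟩
    · rintro _ ⟨x, -, hx, rfl⟩
      exact (hp x hx).1
    · rintro _ ⟨x, hxX, hx, rfl⟩ _ ⟨x', hxX', hx', rfl⟩ hD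
      obtain ⟨hne, y, hy, hy'⟩ := h.meets _ _ hD
      exact hcol x hxX x' hxX' (by rintro rfl; exact hne rfl) hx hx' y hy hy'
    · intro z hz hzS
      obtain ⟨x, hxz, hxX⟩ : ∃ x ∈ z, x ∈ X := by
        induction z using Sym2.ind with
        | _ a b =>
          by_cases ha : a ∈ X
          · exact ⟨a, by simp, ha⟩
          · exact ⟨b, by simp, by have := hX a b hz; tauto⟩
      have hx : (edgesAt E x).Nonempty := ⟨z, hz, hxz⟩
      exact ⟨p x, ⟨x, hxX, hx, rfl⟩, hpD x hx z ⟨hz, hxz⟩ (by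
        rintro rfl; exact hzS ⟨x, hxX, hx, rfl⟩)⟩

/-- Induction step in the presence of a cut vertex. -/
theorem KernelBelow.of_not_reachable {V : Type*} [Finite V] {E : Set (Sym2 V)}
    {D : Sym2 V → Sym2 V → Prop} (ih : KernelBelow E) (h : SinkOrientation E D)
    {v x x' y y' : V} (hx : s(x, x') ∈ E) (hxv : v ∉ s(x, x'))
    (hy : s(y, y') ∈ E) (hyv : v ∉ s(y, y'))
    (hxy : ¬ ((fromEdgeSet E).avoid {v}).Reachable x y) : HasKernel D E := by
  set H := (fromEdgeSet E).avoid {v}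
  have hreach : ∀ e ∈ E, v ∉ e → ∀ z ∈ e, ∀ w ∈ e, H.Reachable z w := by
    intro e he hve z hz w hw
    by_cases hzw : z = w
    · rw [hzw]
    · obtain rfl := (Sym2.mem_and_mem_iff hzw).1 ⟨hz, hw⟩
      rw [Sym2.mem_iff] at hve
      refine Adj.reachable ⟨⟨he, hzw⟩, ?_, ?_⟩ <;> simp <;> grind
  let A : Set (Sym2 V) := {e ∈ E | v ∉ e ∧ ∃ z ∈ e, H.Reachable x z}
  let B : Set (Sym2 V) := {e ∈ E | v ∉ e ∧ e ∉ A}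
  let C : Set (Sym2 V) := edgesAt E v
  have hE : A ∪ B ∪ C = E := by
    ext e
    simp only [A, B, C, edgesAt, Set.mem_union, Set.mem_ofPred_eq]
    by_cases hz : ∃ z ∈ e, H.Reachable x z <;> simp only [hz] <;> tauto
  have hxA : s(x, x') ∈ A := ⟨hx, hxv, x, by simp, .rfl⟩
  have hyB : s(y, y') ∈ B := by
    refine ⟨hy, hyv, ?_⟩
    rintro ⟨-, -, z, hz, hxz⟩
    exact hxy (hxz.trans (hreach _ hy hyv z hz y (by simp)))
  have hAB : ∀ a ∈ A, ∀ b ∈ B, ¬ ∃ w, w ∈ a ∧ w ∈ b := by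
    rintro a ⟨ha, hva, z, hz, hxz⟩ b ⟨hb, hvb, hbA⟩ ⟨w, hwa, hwb⟩
    exact hbA ⟨hb, hvb, w, hwb, hxz.trans (hreach a ha hva z hz w hwa)⟩
  rw [← hE]
  refine HasKernel.of_clique_cutset _ D A B C rfl h.irrefl ?_ ?_ ?_ ?_ (h.sink_edgesAt v) ?_ ?_
  · exact Set.disjoint_left.2 fun e he he' => he.2.1 he'.2
  · exact Set.disjoint_left.2 fun e he he' => he.2.1 he'.2
  · exact Set.disjoint_left.2 fun e he he' => he'.2.2 he
  · intro a ha b hb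
    refine ⟨fun hD => hAB a ha b hb (h.meets _ _ hD).2, fun hD => hAB a ha b hb ?_⟩
    exact (h.meets _ _ hD).2.imp fun _ h => h.symm
  · intro Z hZ
    have hZE : Z ⊆ E := by rw [← hE]; grind
    refine ih Z ⟨hZE, fun hEZ => ?_⟩ D (h.mono hZE)
    rcases hZ (hEZ hy) with h' | h'
    exacts [hyB.2.2 h', hyv h'.2]
  · intro Z hZ
    have hZE : Z ⊆ E := by rw [← hE]; grind
    refine ih Z ⟨hZE, fun hEZ => ?_⟩ D (h.mono hZE)
    rcases hZ (hEZ hx) with h' | h'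
    exacts [h'.2.2 hxA, hxv h'.2]

theorem Sym2.meets_iff_of_hubs {V : Type*} {a b c d : V} (hab : a ≠ b) (hbd : b ≠ d)
    (hcb : c ≠ b) : s(a, c).Meets s(b, d) ↔ c = d ∨ a = d := by
  constructor
  · rintro ⟨-, w, hw, hw'⟩
    rw [Sym2.mem_iff] at hw hw'
    grind
  · intro h
    refine ⟨?_, ?_⟩
    · rw [Ne, Sym2.eq_iff]; grind
    · rcases h with rfl | rfl
      · exact ⟨c, by simp, by simp⟩
      · exact ⟨a, by simp, by simp⟩

/-- Induction step in the presence of an edge `ab` meeting all other edges. -/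
theorem KernelBelow.of_hubs {V : Type*} {E : Set (Sym2 V)} {D : Sym2 V → Sym2 V → Prop}
    (ih : KernelBelow E) (h : SinkOrientation E D) (hdiag : ∀ e ∈ E, ¬ e.IsDiag) {a b : V}
    (hab : s(a, b) ∈ E) (hdom : ∀ e ∈ E, a ∈ e ∨ b ∈ e) : HasKernel D E := by
  have hne : a ≠ b := hdiag _ hab
  have hE : edgesAt E a ∪ edgesAt E b = E := by
    ext e
    simp only [edgesAt, Set.mem_union, Set.mem_ofPred_eq]
    have := hdom e
    tauto
  have hA : ∀ s ∈ edgesAt E a, s ≠ s(a, b) → ∃ c, s = s(a, c) ∧ a ≠ c ∧ c ≠ b := by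
    rintro _ ⟨hs, c, rfl⟩ hse
    exact ⟨c, rfl, hdiag _ hs, by rintro rfl; exact hse rfl⟩
  have hB : ∀ t ∈ edgesAt E b, t ≠ s(a, b) → ∃ c, t = s(b, c) ∧ b ≠ c ∧ c ≠ a := by
    rintro _ ⟨ht, c, rfl⟩ hte
    exact ⟨c, rfl, hdiag _ ht, by rintro rfl; exact hte Sym2.eq_swap⟩
  have hmeet : ∀ s ∈ edgesAt E a, ∀ t ∈ edgesAt E b, s ≠ s(a, b) → t ≠ s(a, b) →
      (D s t ∨ D t s) → ∃ c, s = s(a, c) ∧ t = s(b, c) ∧ a ≠ c ∧ b ≠ c := by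
    intro s hs t ht hse hte hst
    have hst' : s.Meets t := hst.elim (h.meets _ _) fun h' =>
      ⟨(h.meets _ _ h').1.symm, (h.meets _ _ h').2.imp fun _ h => h.symm⟩
    obtain ⟨c, rfl, hac, hcb⟩ := hA s hs hse
    obtain ⟨d, rfl, hbd, hda⟩ := hB t ht hte
    obtain rfl := ((Sym2.meets_iff_of_hubs hne hbd hcb).1 hst').resolve_right hda.symm
    exact ⟨c, rfl, rfl, hac, hbd⟩
  have key := HasKernel.of_two_cliques (D := D) (A := edgesAt E a) (B := edgesAt E b)
    (e := s(a, b)) ⟨hab, by simp⟩ ⟨hab, by simp⟩ h.irrefl (h.sink_edgesAt a) (h.sink_edgesAt b)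
  rw [hE] at key
  refine key ?_ ?_ ?_ fun q hq hqD => ih.pick h hq hqD
  · intro s hs t ht hse hte hst
    obtain ⟨c, rfl, rfl, hac, hbc⟩ := hmeet s hs t ht hse hte hst
    refine (h.triangle hs.1 hab ht.1 ⟨hse, a, by simp, by simp⟩ ⟨?_, c, by simp, by simp⟩
      ⟨hte.symm, b, by simp, by simp⟩).imp_right (Or.imp_right id)
    rw [Ne, Sym2.eq_iff]
    grind
  · intro s hs t ht t' ht' hse hte hte' hst hst'
    obtain ⟨c, rfl, rfl, -, -⟩ := hmeet s hs t ht hse hte hst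
    obtain ⟨d, hd, rfl, -, -⟩ := hmeet _ hs t' ht' hse hte' hst'
    rw [Sym2.congr_right] at hd
    rw [hd]
  · intro t ht s hs s' hs' hte hse hse' hst hst'
    obtain ⟨c, rfl, rfl, -, -⟩ := hmeet s hs t ht hse hte hst
    obtain ⟨d, rfl, hd, -, -⟩ := hmeet s' hs' _ ht hse' hte hst'
    rw [Sym2.congr_right] at hd
    rw [hd]

/-- A sink orientation of the six edges of a complete graph on four vertices has a kernel. -/
theorem SinkOrientation.hasKernel_of_four_vertices {V : Type*} {E : Set (Sym2 V)}
    {D : Sym2 V → Sym2 V → Prop} (h : SinkOrientation E D) (hdiag : ∀ e ∈ E, ¬ e.IsDiag)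
    {a b c d : V} (hab : s(a, b) ∈ E) (hac : s(a, c) ∈ E) (had : s(a, d) ∈ E) (hbc : s(b, c) ∈ E)
    (hbd : s(b, d) ∈ E) (hcd : s(c, d) ∈ E)
    (hE : ∀ x y, s(x, y) ∈ E → x = a ∨ x = b ∨ x = c ∨ x = d) : HasKernel D E := by
  have hab' : a ≠ b := hdiag _ hab
  have hac' : a ≠ c := hdiag _ hac
  have had' : a ≠ d := hdiag _ had
  have hbc' : b ≠ c := hdiag _ hbc
  have hbd' : b ≠ d := hdiag _ hbd
  have hcd' : c ≠ d := hdiag _ hcd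
  let e : Bool → Sym2 V := fun i => bif i then s(a, b) else s(c, d)
  let f : Bool → Sym2 V := fun i => bif i then s(a, c) else s(b, d)
  let g : Bool → Sym2 V := fun i => bif i then s(a, d) else s(b, c)
  have heE : ∀ i, e i ∈ E := by rintro (_ | _) <;> simpa [e]
  have hfE : ∀ i, f i ∈ E := by rintro (_ | _) <;> simpa [f]
  have hgE : ∀ i, g i ∈ E := by rintro (_ | _) <;> simpa [g]
  have hef : ∀ i j, (e i).Meets (f j) := by
    rintro (_ | _) (_ | _) <;> simp [e, f, Sym2.Meets] <;> grind
  have heg : ∀ i j, (e i).Meets (g j) := by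
    rintro (_ | _) (_ | _) <;> simp [e, g, Sym2.Meets] <;> grind
  have hfg : ∀ i j, (f i).Meets (g j) := by
    rintro (_ | _) (_ | _) <;> simp [f, g, Sym2.Meets] <;> grind
  have hee : ∀ i j, ¬ (e i).Meets (e j) := by
    rintro (_ | _) (_ | _) <;> simp [e, Sym2.Meets] <;> grind
  have hff : ∀ i j, ¬ (f i).Meets (f j) := by
    rintro (_ | _) (_ | _) <;> simp [f, Sym2.Meets] <;> grind
  have hgg : ∀ i j, ¬ (g i).Meets (g j) := by
    rintro (_ | _) (_ | _) <;> simp [g, Sym2.Meets] <;> grind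
  refine HasKernel.of_octahedron (e := e) (f := f) (g := g) ?_
    (fun i j hD => hee i j (h.meets _ _ hD)) (fun i j hD => hff i j (h.meets _ _ hD))
    (fun i j hD => hgg i j (h.meets _ _ hD)) (fun i j => h.total (heE i) (hfE j) (hef i j))
    (fun i j => h.total (heE i) (hgE j) (heg i j)) (fun i j => h.total (hfE i) (hgE j) (hfg i j))
    (fun i j k => h.triangle (heE i) (hfE j) (hgE k) (hef i j) (heg i k) (hfg j k))
  intro p
  constructor
  · intro hp
    induction p using Sym2.ind with
    | _ x y =>
      have h1 := hE x y hp
      have h2 := hE y x (Sym2.eq_swap ▸ hp)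
      have h3 : x ≠ y := hdiag _ hp
      simp only [Bool.exists_bool, e, f, g, cond_true, cond_false, Sym2.eq_iff]
      grind
  · rintro ⟨i, rfl | rfl | rfl⟩
    exacts [heE i, hfE i, hgE i]

/-- Maffray's theorem for sets of edges: a sink orientation of a set of edges has a kernel if all
odd cycles are triangles. -/
theorem SinkOrientation.hasKernel {V : Type*} [Finite V] {G : SimpleGraph V}
    (hG : ∀ (u : V) (c : G.Walk u u), c.IsCycle → Odd c.length → c.length = 3) (E : Set (Sym2 V)) :
    E ⊆ G.edgeSet → ∀ D : Sym2 V → Sym2 V → Prop, SinkOrientation E D → HasKernel D E := by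
  induction E using WellFoundedLT.induction with
  | _ E ih' =>
  intro hEG D h
  have ih : KernelBelow E := fun E' hE' => ih' E' hE' (hE'.1.trans hEG)
  have hdiag : ∀ e ∈ E, ¬ e.IsDiag := fun e he => G.not_isDiag_of_mem_edgeSet (hEG he)
  by_contra hcon
  set H := fromEdgeSet E with hH
  have hadj : ∀ x y, H.Adj x y ↔ s(x, y) ∈ E := fun x y => by
    rw [hH, fromEdgeSet_adj, and_iff_left_iff_imp]
    exact fun h => hdiag _ h
  have hHG : H ≤ G := fun x y hxy => hEG ((hadj x y).1 hxy)
  have hodd : ∀ (u : V) (c : H.Walk u u), c.IsCycle → Odd c.length → c.length = 3 := by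
    intro u c hc ho
    have := hG u (c.mapLe hHG) (hc.mapLe hHG) (by simpa using ho)
    simpa using this
  have hpend : ∀ x v, (∃ y, H.Adj x y) → x ≠ v → ∃ y, s(x, y) ∈ E ∧ v ∉ s(x, y) := by
    rintro x v ⟨y, hxy⟩ hxv
    rw [hadj] at hxy
    by_contra! hall
    have hy : ∀ y, s(x, y) ∈ E → v = y := fun y hy =>
      (Sym2.mem_iff.1 (hall y hy)).resolve_left hxv.symm
    refine hcon (ih.of_pendant h (hdiag _ hxy) hxy ?_)
    rintro _ he ⟨z, rfl⟩
    rw [← hy z he, ← hy y hxy]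
  have hconn : ∀ v x y : V, x ≠ v → y ≠ v → (∃ x', H.Adj x x') → (∃ y', H.Adj y y') →
      (H.avoid {v}).Reachable x y := by
    intro v x y hxv hyv hx hy
    obtain ⟨x', hx, hvx⟩ := hpend x v hx hxv
    obtain ⟨y', hy, hvy⟩ := hpend y v hy hyv
    by_contra hxy
    exact hcon (ih.of_not_reachable h hx hvx hy hvy hxy)
  by_cases hbip : ∀ (u : V) (c : H.Walk u u), c.IsCycle → ¬ Odd c.length
  · obtain ⟨C⟩ := colorable_two_of_no_odd_cycle hbip
    refine hcon (ih.of_bipartite h {x | C x = 0} fun x y hxy => ?_)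
    have := C.valid ((hadj x y).2 hxy)
    simp only [Set.mem_ofPred_eq]
    omega
  push Not at hbip
  obtain ⟨u, w, hw, ho⟩ := hbip
  have h3 := hodd u w hw ho
  obtain ⟨a, b, c, hab, hbc, hac⟩ : ∃ a b c, H.Adj a b ∧ H.Adj b c ∧ H.Adj a c := by
    clear hw ho
    match w, h3 with
    | .cons hab (.cons hbc (.cons hca .nil)), _ => exact ⟨_, _, _, hab, hbc, hca.symm⟩
  rcases edge_dominating_or_four_vertices hodd hconn hab hbc hac with
    ⟨u, v, huv, hdom⟩ | ⟨d, had, hbd, hcd, hfour⟩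
  · refine hcon (ih.of_hubs h hdiag ((hadj u v).1 huv) fun e he => ?_)
    induction e using Sym2.ind with
    | _ x y =>
      have := hdom x y ((hadj x y).2 he)
      simp only [Sym2.mem_iff]
      grind
  · simp only [hadj] at *
    exact hcon (h.hasKernel_of_four_vertices hdiag hab hac had hbc hbd hcd hfour)

/-- Maffray: for `G ∈ G¹` (every odd cycle is a triangle), an
orientation of `L(G)` is kernel-perfect iff every (nonempty) clique of `L(G)`
has a sink. -/
theorem stmt11 {V : Type*} [Fintype V] (G : SimpleGraph V)
    (hG1 : ∀ (u : V) (c : G.Walk u u), c.IsCycle → Odd c.length → c.length = 3)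
    (D : G.edgeSet → G.edgeSet → Prop) (hor : IsOrientation (lineAdj G) D) :
    KernelPerfect D ↔
      ∀ K : Set G.edgeSet, (∀ a ∈ K, ∀ b ∈ K, a ≠ b → lineAdj G a b) →
        K.Nonempty → ∃ e ∈ K, ∀ f ∈ K, f ≠ e → D f e := by
  constructor
  · intro hD K hK hne
    obtain ⟨S, hS, hi, ha⟩ := hD K
    have hSne : S.Nonempty := by
      obtain ⟨k, hk⟩ := hne
      by_cases hkS : k ∈ S
      · exact ⟨k, hkS⟩
      · obtain ⟨s, hs, -⟩ := ha k hk hkS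
        exact ⟨s, hs⟩
    obtain ⟨e, he⟩ := hSne
    have huniq : ∀ s ∈ S, s = e := by
      intro s hs
      by_contra hse
      rcases hor.2 s e (hK s (hS hs) e (hS he) hse) with h | h
      exacts [hi s hs e he h, hi e he s hs h]
    refine ⟨e, hS he, fun f hf hfe => ?_⟩
    obtain ⟨s, hs, h⟩ := ha f hf (fun h => hfe (huniq f h))
    rwa [← huniq s hs]
  · intro hD Z
    have hmem : ∀ e, e ∈ Subtype.val '' Z ↔ ∃ h : e ∈ G.edgeSet, ⟨e, h⟩ ∈ Z := by simp
    obtain ⟨S, hS, hi, ha⟩ := SinkOrientation.hasKernel hG1 (Subtype.val '' Z)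
      (by rintro _ ⟨e, -, rfl⟩; exact e.2)
      (fun a b => ∃ (ha : a ∈ G.edgeSet) (hb : b ∈ G.edgeSet), D ⟨a, ha⟩ ⟨b, hb⟩)
      ⟨by
        rintro a b ⟨ha, hb, h⟩
        have := hor.1 _ _ h
        exact ⟨fun hab => this.1 (Subtype.ext hab), this.2⟩, by
        intro K hK hKm hKne
        have hKG : ∀ e ∈ K, e ∈ G.edgeSet := fun e he => ((hmem e).1 (hK he)).1
        obtain ⟨s, hs, h⟩ := hD (Subtype.val ⁻¹' K) (by
          intro a ha b hb hab
          exact ⟨hab, (hKm ha hb fun h => hab (Subtype.ext h)).2⟩) (by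
          obtain ⟨e, he⟩ := hKne
          exact ⟨⟨e, hKG e he⟩, he⟩)
        exact ⟨s, hs, fun f hf hfs => ⟨hKG f hf, s.2, h ⟨f, hKG f hf⟩ hf (by
          rintro rfl; exact hfs rfl)⟩⟩⟩
    refine ⟨Subtype.val ⁻¹' S, fun e he => ?_, fun a ha b hb h => hi a ha b hb ⟨a.2, b.2, h⟩,
      fun z hz hzS => ?_⟩
    · exact ((hmem e).1 (hS he)).2
    · obtain ⟨s, hs, _, hsG, h⟩ := ha z ⟨z, hz, rfl⟩ hzS
      exact ⟨⟨s, hsG⟩, hs, h⟩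
end

section
/- Every bipartite graph G is strongly Δ(G)-edge-orientable: for every vertex v, the line graph L(G) admits a kernel-perfect orientation D such that d⁺_D(e) ≤ Δ(G) − 1 for every edge e, and d⁺_D(e) ≤ deg(v) − 1 for every edge e incident to v. -/
open SimpleGraph

open Finset in
theorem card_filter_mem_of_regular {E V : Type*} [DecidableEq V] (g : E → V) {k : ℕ}
    (s : Finset E) (hg : ∀ v, #{e ∈ s | g e = v} = k) (X : Finset V) :
    #{e ∈ s | g e ∈ X} = #X * k := by
  rw [card_eq_sum_card_fiberwise (s := {e ∈ s | g e ∈ X}) (f := g) (t := X)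
    (fun e he => (mem_filter.1 he).2)]
  refine sum_const_nat fun v hv => ?_
  rw [← hg v, filter_filter]
  congr 1
  ext e
  simp only [mem_filter]
  grind

open Finset in
/-- A nonempty regular bipartite multigraph, given by the endpoint maps `a` and `b` on a finite
set of edges, has a perfect matching. -/
theorem exists_perfect_matching_of_regular {E V : Type*} [Fintype V] [DecidableEq V] (a b : E → V)
    {k : ℕ} (hk : 0 < k) (s : Finset E) (ha : ∀ v, #{e ∈ s | a e = v} = k)
    (hb : ∀ v, #{e ∈ s | b e = v} = k) :
    ∃ m : V → E, (∀ v, m v ∈ s) ∧ (∀ v, a (m v) = v) ∧ Function.Bijective (b ∘ m) := by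
  have hall : ∀ X : Finset V, #X ≤ #(X.biUnion fun v => {e ∈ s | a e = v}.image b) := by
    intro X
    set Y := X.biUnion fun v => {e ∈ s | a e = v}.image b with hY
    refine Nat.le_of_mul_le_mul_right ?_ hk
    rw [← card_filter_mem_of_regular a s ha, ← card_filter_mem_of_regular b s hb]
    refine card_le_card fun e he => ?_
    simp only [mem_filter, hY, mem_biUnion, mem_image] at he ⊢
    exact ⟨he.1, a e, he.2, e, ⟨he.1, rfl⟩, rfl⟩
  obtain ⟨f, hf, hmem⟩ :=
    (all_card_le_biUnion_card_iff_exists_injective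
      fun v => {e ∈ s | a e = v}.image b).1 hall
  simp only [mem_image, mem_filter] at hmem
  choose m hm hbm using hmem
  refine ⟨m, fun v => (hm v).1, fun v => (hm v).2, Finite.injective_iff_bijective.1 ?_⟩
  have : b ∘ m = f := funext hbm
  rwa [this]

open Finset in
/-- A `k`-regular bipartite multigraph is `k`-edge-colorable. -/
theorem exists_edgeColoring_of_regular {E V : Type*} [Fintype V] [DecidableEq V] (a b : E → V)
    (k : ℕ) (s : Finset E) (ha : ∀ v, #{e ∈ s | a e = v} = k)
    (hb : ∀ v, #{e ∈ s | b e = v} = k) :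
    ∃ c : E → ℕ, (∀ e ∈ s, c e < k) ∧
      ∀ e ∈ s, ∀ f ∈ s, a e = a f ∨ b e = b f → c e = c f → e = f := by
  classical
  induction k generalizing s with
  | zero =>
    have hempty : ∀ e, e ∉ s := fun e he =>
      filter_eq_empty_iff.1 (card_eq_zero.1 (ha (a e))) he rfl
    exact ⟨fun _ => 0, fun e he => (hempty e he).elim, fun e he => (hempty e he).elim⟩
  | succ k ih =>
    obtain ⟨m, hms, ham, hbm⟩ := exists_perfect_matching_of_regular a b k.succ_pos s ha hb
    have ha' : ∀ v, #{e ∈ s \ univ.image m | a e = v} = k := by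
      intro v
      have : {e ∈ s \ univ.image m | a e = v} = {e ∈ s | a e = v}.erase (m v) := by
        ext e
        simp only [mem_filter, mem_sdiff, mem_image, mem_univ, true_and, mem_erase]
        grind
      rw [this, card_erase_of_mem (by simp [hms, ham]), ha, Nat.add_sub_cancel]
    have hb' : ∀ v, #{e ∈ s \ univ.image m | b e = v} = k := by
      intro v
      obtain ⟨u, hu⟩ := hbm.surjective v
      have : {e ∈ s \ univ.image m | b e = v} = {e ∈ s | b e = v}.erase (m u) := by
        ext e
        simp only [mem_filter, mem_sdiff, mem_image, mem_univ, true_and, mem_erase]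
        have hinj : ∀ w, b (m w) = v → w = u := fun w hw => hbm.injective (hw.trans hu.symm)
        grind
      rw [this, card_erase_of_mem (by simpa [hms] using hu), hb, Nat.add_sub_cancel]
    obtain ⟨c, hc, hinj⟩ := ih _ ha' hb'
    have hmatch : ∀ u w, a (m u) = a (m w) ∨ b (m u) = b (m w) → m u = m w := by
      rintro u w (h | h)
      · rw [ham, ham] at h
        rw [h]
      · rw [hbm.injective h]
    refine ⟨fun e => if e ∈ univ.image m then k else c e, fun e he => ?_, fun e he f hf hef => ?_⟩
    · have := hc e
      simp only [mem_sdiff] at this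
      grind
    · have h1 := hc e
      have h2 := hc f
      have h3 := hinj e
      simp only [mem_sdiff] at h1 h2 h3
      by_cases h4 : e ∈ univ.image m <;> by_cases h5 : f ∈ univ.image m
      · simp only [mem_image, mem_univ, true_and] at h4 h5
        obtain ⟨u, rfl⟩ := h4
        obtain ⟨w, rfl⟩ := h5
        exact fun _ => hmatch u w hef
      · simp only [h4, h5, if_true, if_false]
        grind
      · simp only [h4, h5, if_true, if_false]
        grind
      · simp only [h4, h5, if_false]
        exact h3 ⟨he, h4⟩ f ⟨hf, h5⟩ hef

open Finset in
/-- **Kőnig's edge coloring theorem**: a bipartite multigraph with maximum degree at most `k` is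
`k`-edge-colorable. -/
theorem exists_edgeColoring_of_card_fiber_le {E V : Type*} [Fintype E] [Fintype V] [DecidableEq V]
    (a b : E → V) (k : ℕ) (ha : ∀ v, #{e | a e = v} ≤ k) (hb : ∀ v, #{e | b e = v} ≤ k) :
    ∃ c : E → ℕ, (∀ e, c e < k) ∧ ∀ e f, a e = a f ∨ b e = b f → c e = c f → e = f := by
  have hdeficit : ∀ g : E → V, (∀ v, #{e | g e = v} ≤ k) →
      Fintype.card (Σ v, Fin (k - #{e | g e = v})) + Fintype.card E = Fintype.card V * k := by
    intro g hg
    rw [Fintype.card_sigma, ← card_univ (α := E),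
      card_eq_sum_card_fiberwise (f := g) (t := univ) (fun _ _ => mem_coe.2 (mem_univ _)),
      ← sum_add_distrib]
    simp [Nat.sub_add_cancel (hg _)]
  -- Dummy edges, matching up the degree deficits on the two sides, make the multigraph regular.
  obtain ⟨φ⟩ : Nonempty ((Σ v, Fin (k - #{e | a e = v})) ≃ Σ v, Fin (k - #{e | b e = v})) :=
    Fintype.card_eq.1 (Nat.add_right_cancel ((hdeficit a ha).trans (hdeficit b hb).symm))
  have hfiber : ∀ n : V → ℕ, ∀ v, #{x : Σ v, Fin (n v) | x.1 = v} = n v := by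
    intro n v
    rw [card_filter, Fintype.sum_sigma]
    simp [apply_ite card]
  have hsum : ∀ {α β : Type _} [Fintype α] [Fintype β] (g : α → V) (h : β → V) (v : V),
      #{x | Sum.elim g h x = v} = #{x | g x = v} + #{x | h x = v} := by
    intro α β _ _ g h v
    simp_rw [card_filter]
    exact Fintype.sum_sum_type _
  obtain ⟨c, hc, hinj⟩ := exists_edgeColoring_of_regular
    (Sum.elim a Sigma.fst) (Sum.elim b fun x => (φ x).1) k univ
    (fun v => by rw [hsum, hfiber, Nat.add_sub_cancel' (ha v)])
    (fun v => by
      rw [hsum, card_equiv φ (t := {y | y.1 = v}) (by simp), hfiber, Nat.add_sub_cancel' (hb v)])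
  exact ⟨c ∘ Sum.inl, fun e => hc _ (mem_univ _), fun e f hef h =>
    Sum.inl_injective (hinj _ (mem_univ _) _ (mem_univ _) hef h)⟩

/-- The digraph on the edges of a bipartite multigraph in which adjacent edges point from higher
to lower color at `a`-endpoints, and from lower to higher color at `b`-endpoints. -/
def colorOrientation {E V : Type*} (a b : E → V) (c : E → ℕ) (e f : E) : Prop :=
  (a e = a f ∧ c f < c e) ∨ (b e = b f ∧ c e < c f)

theorem colorOrientation_kernelPerfect {E V : Type*} [Finite E] (a b : E → V) (c : E → ℕ)
    (hc : ∀ e f, a e = a f ∨ b e = b f → c e = c f → e = f) :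
    KernelPerfect (colorOrientation a b c) := by
  intro Z
  induction Z using WellFoundedLT.induction with
  | ind Z ih =>
  let M : Set E := {e | e ∈ Z ∧ ∀ f ∈ Z, a f = a e → c e ≤ c f}
  by_cases hM : ∀ e ∈ M, ∀ f ∈ M, b e = b f → e = f
  · refine ⟨M, fun e he => he.1, ?_, fun z hz hzM => ?_⟩
    · rintro e he f hf (⟨h, hlt⟩ | ⟨h, hlt⟩)
      · exact hlt.not_ge (he.2 f hf.1 h.symm)
      · exact hlt.ne (congrArg c (hM e he f hf h))
    · obtain ⟨s, ⟨hsZ, hsa⟩, hmin⟩ := Set.exists_min_image {f ∈ Z | a f = a z} c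
        (Set.toFinite _) ⟨z, hz, rfl⟩
      have hsM : s ∈ M := ⟨hsZ, fun f hf h => hmin f ⟨hf, h.trans hsa⟩⟩
      refine ⟨s, hsM, Or.inl ⟨hsa.symm, (hmin z ⟨hz, rfl⟩).lt_of_ne fun h => hzM ?_⟩⟩
      rwa [← hc s z (Or.inl hsa) h]
  · obtain ⟨e, he, f, hf, hb, hlt⟩ : ∃ e ∈ M, ∃ f ∈ M, b e = b f ∧ c e < c f := by
      push Not at hM
      obtain ⟨e, he, f, hf, hb, hne⟩ := hM
      rcases lt_trichotomy (c e) (c f) with h | h | h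
      · exact ⟨e, he, f, hf, hb, h⟩
      · exact (hne (hc e f (Or.inr hb) h)).elim
      · exact ⟨f, hf, e, he, hb.symm, h⟩
    obtain ⟨S, hSZ, hind, hdom⟩ := ih (Z \ {e}) (Set.sdiff_singleton_ssubset.2 he.1)
    refine ⟨S, fun x hx => (hSZ hx).1, hind, fun z hz hzS => ?_⟩
    by_cases hze : z = e
    · subst hze
      by_cases hfS : f ∈ S
      · exact ⟨f, hfS, Or.inr ⟨hb, hlt⟩⟩
      · obtain ⟨s, hs, ⟨h, hlt'⟩ | ⟨h, hlt'⟩⟩ :=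
          hdom f ⟨hf.1, fun h => hlt.ne (congrArg c h.symm)⟩ hfS
        · exact (hlt'.not_ge (hf.2 s (hSZ hs).1 h.symm)).elim
        · exact ⟨s, hs, Or.inr ⟨hb.trans h, hlt.trans hlt'⟩⟩
    · exact hdom z ⟨hz, hze⟩ hzS

theorem outDeg_colorOrientation_lt_card {E V : Type*} (a b : E → V) (c : E → ℕ)
    (hc : ∀ e f, a e = a f ∨ b e = b f → c e = c f → e = f) {e : E} {T : Finset ℕ} (he : c e ∈ T)
    (hT : ∀ f, colorOrientation a b c e f → c f ∈ T) :
    outDeg (colorOrientation a b c) e < T.card := by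
  classical
  have hinj : Set.InjOn c {f | colorOrientation a b c e f} := by
    rintro f (hf | hf) g (hg | hg) h
    · exact hc f g (Or.inl (hf.1.symm.trans hg.1)) h
    · omega
    · omega
    · exact hc f g (Or.inr (hf.1.symm.trans hg.1)) h
  have hmaps : ∀ f ∈ {f | colorOrientation a b c e f}, c f ∈ (T.erase (c e) : Set ℕ) := by
    intro f hf
    refine Finset.mem_coe.2 (Finset.mem_erase.2 ⟨?_, hT f hf⟩)
    rcases hf with hf | hf
    · exact hf.2.ne
    · exact hf.2.ne'
  calc outDeg (colorOrientation a b c) e ≤ (T.erase (c e) : Set ℕ).ncard :=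
        Set.ncard_le_ncard_of_injOn c hmaps hinj (Finset.finite_toSet _)
    _ = (T.erase (c e)).card := Set.ncard_coe_finset _
    _ < T.card := Finset.card_erase_lt_of_mem he

open Finset in
/-- The colors in a Kőnig coloring can be rearranged so that those used at `v` come last. -/
theorem exists_edgeColoring_top_at {E V : Type*} [Fintype E] [Fintype V] [DecidableEq V]
    (a b : E → V) (k : ℕ) (ha : ∀ v, #{e | a e = v} ≤ k) (hb : ∀ v, #{e | b e = v} ≤ k) (v : V) :
    ∃ c : E → ℕ, #(univ.image c) ≤ k ∧
      (∀ e f, a e = a f ∨ b e = b f → c e = c f → e = f) ∧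
      ∀ e f, a e = v → c e < c f → ∃ g, a g = v ∧ c g = c f := by
  classical
  obtain ⟨c, hc, hinj⟩ := exists_edgeColoring_of_card_fiber_le a b k ha hb
  let r : ℕ → ℕ := fun i => if ∃ g, a g = v ∧ c g = i then i + k else i
  have hr : ∀ e f, r (c e) = r (c f) → c e = c f := by
    intro e f
    have := hc e
    have := hc f
    simp only [r]
    split_ifs <;> omega
  refine ⟨r ∘ c, ?_, fun e f hef h => hinj e f hef (hr e f h), fun e f he hlt => ?_⟩
  · calc #(univ.image (r ∘ c)) = #((univ.image c).image r) := by rw [image_image]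
      _ ≤ #(univ.image c) := card_image_le
      _ ≤ #(range k) := card_le_card fun i hi => by
        obtain ⟨e, -, rfl⟩ := mem_image.1 hi
        exact mem_range.2 (hc e)
      _ = k := card_range k
  · by_contra hne
    have h1 : ¬ ∃ g, a g = v ∧ c g = c f := fun ⟨g, hg, h⟩ => hne ⟨g, hg, congrArg r h⟩
    have h2 : ∃ g, a g = v ∧ c g = c e := ⟨e, he, rfl⟩
    have := hc f
    simp only [Function.comp_apply, r, h1, h2, if_true, if_false] at hlt
    omega

theorem deg_le_maxDeg {V : Type*} [Finite V] (G : SimpleGraph V) (v : V) : deg G v ≤ maxDeg G :=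
  le_csSup (Set.finite_range _).bddAbove ⟨v, rfl⟩

open Finset in
theorem card_fiber_le_deg {V : Type*} [Finite V] [DecidableEq V] (G : SimpleGraph V)
    [Fintype G.edgeSet] (a b : G.edgeSet → V) (hab : ∀ e : G.edgeSet, (e : Sym2 V) = s(a e, b e))
    (v : V) : #{e | a e = v} ≤ deg G v := by
  rw [← Set.ncard_coe_finset]
  refine Set.ncard_le_ncard_of_injOn b (fun e he => ?_) (fun e he f hf h => ?_) (Set.toFinite _)
  · have hadj : G.Adj (a e) (b e) := by
      rw [← SimpleGraph.mem_edgeSet, ← hab]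
      exact e.2
    simpa [(by simpa using he : a e = v)] using hadj
  · simp only [coe_filter, mem_univ, true_and, Set.mem_ofPred_eq] at he hf
    exact Subtype.ext (by rw [hab, hab, he, hf, h])

theorem exists_endpoint_maps {V : Type*} (G : SimpleGraph V) (hbip : G.Colorable 2) (v : V) :
    ∃ a b : G.edgeSet → V, (∀ e : G.edgeSet, (e : Sym2 V) = s(a e, b e)) ∧
      (∀ e f, a e ≠ b f) ∧ ∀ e, b e ≠ v := by
  obtain ⟨C⟩ := hbip
  have : ∀ e : G.edgeSet, ∃ x y, (e : Sym2 V) = s(x, y) ∧ C x = C v ∧ C y ≠ C v := by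
    rintro ⟨e, he⟩
    induction e using Sym2.ind with
    | _ x y =>
    have hxy : C x ≠ C y := C.valid he
    by_cases hx : C x = C v
    · exact ⟨x, y, rfl, hx, fun hy => hxy (hx.trans hy.symm)⟩
    · exact ⟨y, x, Sym2.eq_swap, by omega, hx⟩
  choose a b hab ha hb using this
  exact ⟨a, b, hab, fun e f h => hb f (h ▸ ha e), fun e h => hb e (congrArg C h)⟩

/-- every bipartite graph `G` is strongly `Δ(G)`-edge-orientable:
for every `v`, `L(G)` has a kernel-perfect orientation with `d⁺(e) ≤ Δ(G) − 1`
for all edges and `d⁺(e) ≤ deg(v) − 1` for edges incident to `v`. -/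
theorem stmt12 {V : Type*} [Fintype V] (G : SimpleGraph V)
    (hbip : G.Colorable 2) :
    ∀ v : V, ∃ D : G.edgeSet → G.edgeSet → Prop,
      IsOrientation (lineAdj G) D ∧ KernelPerfect D ∧
      (∀ e, outDeg D e + 1 ≤ maxDeg G) ∧
      (∀ e : G.edgeSet, v ∈ (e : Sym2 V) → outDeg D e + 1 ≤ deg G v) := by
  classical
  intro v
  obtain ⟨a, b, hab, hdisj, hbv⟩ := exists_endpoint_maps G hbip v
  have hba : ∀ e : G.edgeSet, (e : Sym2 V) = s(b e, a e) := fun e => (hab e).trans Sym2.eq_swap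
  obtain ⟨c, hcard, hc, htop⟩ := exists_edgeColoring_top_at a b (maxDeg G)
    (fun x => (card_fiber_le_deg G a b hab x).trans (deg_le_maxDeg G x))
    (fun x => (card_fiber_le_deg G b a hba x).trans (deg_le_maxDeg G x)) v
  refine ⟨colorOrientation a b c, ⟨?_, ?_⟩, colorOrientation_kernelPerfect a b c hc,
    fun e => ?_, fun e hve => ?_⟩
  · rintro e f (⟨h, hlt⟩ | ⟨h, hlt⟩)
    · exact ⟨fun h' => hlt.ne (congrArg c h'.symm), a e, by simp [hab e], by simp [hab f, h]⟩
    · exact ⟨fun h' => hlt.ne (congrArg c h'), b e, by simp [hab e], by simp [hab f, h]⟩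
  · rintro e f ⟨hne, x, hxe, hxf⟩
    have hadj : a e = a f ∨ b e = b f := by
      rw [hab, Sym2.mem_iff] at hxe hxf
      have := hdisj e f
      have := hdisj f e
      grind
    have hcne : c e ≠ c f := fun h => hne (hc e f hadj h)
    unfold colorOrientation
    grind
  · exact (outDeg_colorOrientation_lt_card a b c hc (Finset.mem_image_of_mem c (Finset.mem_univ e))
      fun f _ => Finset.mem_image_of_mem c (Finset.mem_univ f)).trans_le hcard
  · have hae : a e = v := by
      rw [hab, Sym2.mem_iff] at hve
      exact (hve.resolve_right fun h => hbv e h.symm).symm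
    refine (outDeg_colorOrientation_lt_card a b c hc
      (T := (Finset.univ.filter fun f => a f = v).image c) ?_ ?_).trans_le
      (Finset.card_image_le.trans (card_fiber_le_deg G a b hab v))
    · exact Finset.mem_image_of_mem c (by simpa using hae)
    · rintro f (⟨h, -⟩ | ⟨-, hlt⟩)
      · exact Finset.mem_image_of_mem c (by simpa using h.symm.trans hae)
      · obtain ⟨g, hg, hgf⟩ := htop e f hae hlt
        exact Finset.mem_image.2 ⟨g, by simpa using hg, hgf⟩
end

section
/- If G ∈ G* and t ≥ max{4, Δ(G)}, then G is t-edge-orientable: L(G) admits a kernel-perfect orientation with every out-degree at most t − 1. -/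
open SimpleGraph

/-- `D` orients the line graph of the edge set `E` kernel-perfectly, with `1 + d⁺(e) ≤ f e`. -/
def OrientableOn {V : Type*} (E : Set (Sym2 V)) (f : Sym2 V → ℕ) : Prop :=
  ∃ D : Sym2 V → Sym2 V → Prop,
    (∀ a b, D a b → a ∈ E ∧ b ∈ E ∧ a ≠ b ∧ ∃ x, x ∈ a ∧ x ∈ b) ∧
    (∀ a ∈ E, ∀ b ∈ E, a ≠ b → (∃ x, x ∈ a ∧ x ∈ b) → D a b ∨ D b a) ∧
    (∀ Z ⊆ E, ∃ S ⊆ Z, (∀ a ∈ S, ∀ b ∈ S, ¬ D a b) ∧ ∀ z ∈ Z, z ∉ S → ∃ s ∈ S, D z s) ∧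
    ∀ e ∈ E, {b | D e b}.ncard + 1 ≤ f e

section Orientation

variable {V : Type*}

theorem OrientableOn.mono {E : Set (Sym2 V)} {f g : Sym2 V → ℕ} (h : OrientableOn E f)
    (hfg : ∀ e ∈ E, f e ≤ g e) : OrientableOn E g := by
  obtain ⟨D, h1, h2, h3, h4⟩ := h
  exact ⟨D, h1, h2, h3, fun e he => (h4 e he).trans (hfg e he)⟩

theorem OrientableOn.edgeOrientable {G : SimpleGraph V} {f : ℕ}
    (h : OrientableOn G.edgeSet (fun _ => f)) : EdgeOrientable G (fun _ => f) := by
  obtain ⟨D, h1, h2, h3, h4⟩ := h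
  refine ⟨fun a b => D a b, ⟨?_, ?_⟩, ?_, ?_⟩
  · intro a b hab
    obtain ⟨-, -, hne, hx⟩ := h1 _ _ hab
    exact ⟨fun h => hne (congrArg _ h), hx⟩
  · rintro a b ⟨hne, hx⟩
    exact h2 a a.2 b b.2 (fun h => hne (Subtype.ext h)) hx
  · intro Z
    obtain ⟨S, hS, hi, hd⟩ := h3 (Subtype.val '' Z) (by rintro _ ⟨a, -, rfl⟩; exact a.2)
    refine ⟨Subtype.val ⁻¹' S, ?_, fun a ha b hb => hi a ha b hb, ?_⟩
    · intro a ha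
      obtain ⟨b, hb, hba⟩ := hS ha
      rwa [← Subtype.ext hba]
    · intro z hz hzS
      obtain ⟨s, hs, hD⟩ := hd z ⟨z, hz, rfl⟩ hzS
      obtain ⟨b, hb, rfl⟩ := hS hs
      exact ⟨b, hs, hD⟩
  · intro e
    refine le_trans (Nat.add_le_add_right (le_of_eq ?_) 1) (h4 e e.2)
    rw [outDeg, ← Set.ncard_image_of_injective _ Subtype.val_injective]
    congr 1
    ext b
    constructor
    · rintro ⟨c, hc, rfl⟩
      exact hc
    · intro hb
      exact ⟨⟨b, (h1 _ _ hb).2.1⟩, hb, rfl⟩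

/-- Two orientations are combined by directing all edges between the parts from `E₂` to `E₁`. -/
theorem OrientableOn.union [Finite V] {E₁ E₂ : Set (Sym2 V)} {f₁ f₂ f : Sym2 V → ℕ}
    (h₁ : OrientableOn E₁ f₁) (h₂ : OrientableOn E₂ f₂) (hdisj : Disjoint E₁ E₂)
    (hf₁ : ∀ e ∈ E₁, f₁ e ≤ f e)
    (hf₂ : ∀ e ∈ E₂, f₂ e + {b | b ∈ E₁ ∧ ∃ x, x ∈ e ∧ x ∈ b}.ncard ≤ f e) :
    OrientableOn (E₁ ∪ E₂) f := by
  obtain ⟨D₁, a1, a2, a3, a4⟩ := h₁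
  obtain ⟨D₂, b1, b2, b3, b4⟩ := h₂
  have hd : ∀ a, a ∈ E₁ → a ∈ E₂ → False := fun a h h' => Set.disjoint_left.1 hdisj h h'
  refine ⟨fun a b => D₁ a b ∨ D₂ a b ∨ (a ∈ E₂ ∧ b ∈ E₁ ∧ ∃ x, x ∈ a ∧ x ∈ b),
    ?_, ?_, ?_, ?_⟩
  · rintro a b (h | h | ⟨ha, hb, hx⟩)
    · have := a1 a b h
      exact ⟨.inl this.1, .inl this.2.1, this.2.2⟩
    · have := b1 a b h
      exact ⟨.inr this.1, .inr this.2.1, this.2.2⟩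
    · exact ⟨.inr ha, .inl hb, fun h => hd b hb (h ▸ ha), hx⟩
  · rintro a (ha | ha) b (hb | hb) hne ⟨x, hx, hx'⟩
    · exact (a2 a ha b hb hne ⟨x, hx, hx'⟩).imp .inl .inl
    · exact .inr (.inr (.inr ⟨hb, ha, x, hx', hx⟩))
    · exact .inl (.inr (.inr ⟨ha, hb, x, hx, hx'⟩))
    · exact (b2 a ha b hb hne ⟨x, hx, hx'⟩).imp (.inr ∘ .inl) (.inr ∘ .inl)
  · intro Z hZ
    obtain ⟨S₁, hS₁, i₁, d₁⟩ := a3 (Z ∩ E₁) Set.inter_subset_right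
    obtain ⟨S₂, hS₂, i₂, d₂⟩ := b3 {z | z ∈ Z ∧ z ∈ E₂ ∧ ∀ s ∈ S₁, ¬ ∃ x, x ∈ z ∧ x ∈ s}
      (fun z hz => hz.2.1)
    refine ⟨S₁ ∪ S₂, ?_, ?_, ?_⟩
    · rintro a (ha | ha)
      · exact (hS₁ ha).1
      · exact (hS₂ ha).1
    · have c1 : ∀ a b, a ∈ S₁ → ¬ D₂ a b := fun a b ha h => hd a (hS₁ ha).2 (b1 a b h).1
      have c1' : ∀ a b, b ∈ S₁ → ¬ D₂ a b := fun a b ha h => hd b (hS₁ ha).2 (b1 a b h).2.1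
      have c2 : ∀ a b, a ∈ S₂ → ¬ D₁ a b := fun a b ha h => hd a (a1 a b h).1 (hS₂ ha).2.1
      have c2' : ∀ a b, b ∈ S₂ → ¬ D₁ a b := fun a b ha h => hd b (a1 a b h).2.1 (hS₂ ha).2.1
      rintro a (ha | ha) b (hb | hb) (h | h | ⟨ha', hb', hx⟩)
      · exact i₁ a ha b hb h
      · exact c1 _ _ ha h
      · exact hd a (hS₁ ha).2 ha'
      · exact c2' _ _ hb h
      · exact c1 _ _ ha h
      · exact hd a (hS₁ ha).2 ha'
      · exact c2 _ _ ha h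
      · exact c1' _ _ hb h
      · exact (hS₂ ha).2.2 b hb hx
      · exact c2 _ _ ha h
      · exact i₂ a ha b hb h
      · exact hd b hb' (hS₂ hb).2.1
    · intro z hz hzS
      have hz1 : z ∉ S₁ := fun h => hzS (.inl h)
      have hz2 : z ∉ S₂ := fun h => hzS (.inr h)
      rcases hZ hz with hzE | hzE
      · obtain ⟨s, hs, h⟩ := d₁ z ⟨hz, hzE⟩ hz1
        exact ⟨s, .inl hs, .inl h⟩
      · by_cases hx : ∃ s ∈ S₁, ∃ x, x ∈ z ∧ x ∈ s
        · obtain ⟨s, hs, h⟩ := hx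
          exact ⟨s, .inl hs, .inr (.inr ⟨hzE, (hS₁ hs).2, h⟩)⟩
        · push Not at hx
          obtain ⟨s, hs, h⟩ := d₂ z ⟨hz, hzE, fun s hs => by push Not; exact hx s hs⟩ hz2
          exact ⟨s, .inr hs, .inr (.inl h)⟩
  · rintro e (he | he)
    · refine le_trans (Nat.add_le_add_right (Set.ncard_le_ncard ?_) 1) ((a4 e he).trans (hf₁ e he))
      rintro b (h | h | h)
      · exact h
      · exact (hd e he (b1 e b h).1).elim
      · exact (hd e he h.1).elim
    · have h5 : {b | D₁ e b ∨ D₂ e b ∨ (e ∈ E₂ ∧ b ∈ E₁ ∧ ∃ x, x ∈ e ∧ x ∈ b)} ⊆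
          {b | D₂ e b} ∪ {b | b ∈ E₁ ∧ ∃ x, x ∈ e ∧ x ∈ b} := by
        rintro b (h | h | h)
        · exact (hd e (a1 e b h).1 he).elim
        · exact .inl h
        · exact .inr h.2
      have h6 := (Set.ncard_le_ncard h5).trans (Set.ncard_union_le _ _)
      have := b4 e he
      have := hf₂ e he
      exact le_trans (Nat.add_le_add_right h6 1) (by omega)

theorem exists_kernel_of_measure {α : Type*} [Finite α] (D : α → α → Prop) (r : α → ℕ)
    (hD : ∀ a b, D a b → r b < r a) (Z : Set α) :
    ∃ S ⊆ Z, (∀ a ∈ S, ∀ b ∈ S, ¬ D a b) ∧ ∀ z ∈ Z, z ∉ S → ∃ s ∈ S, D z s := by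
  obtain ⟨n, hn⟩ : ∃ n, Z.ncard = n := ⟨_, rfl⟩
  induction n generalizing Z with
  | zero =>
    rw [Set.ncard_eq_zero] at hn
    subst hn
    exact ⟨∅, le_rfl, by simp, by simp⟩
  | succ n ih =>
    have hne : Z.Nonempty := by
      rw [← Set.ncard_pos]
      omega
    obtain ⟨m, hm, hmax⟩ := Set.exists_max_image Z r (Set.toFinite Z) hne
    obtain ⟨S, hS, hi, hd⟩ := ih (Z \ {m}) (by
      rw [Set.ncard_sdiff_singleton_of_mem hm, hn]; rfl)
    by_cases h : ∃ s ∈ S, D m s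
    · refine ⟨S, hS.trans Set.sdiff_subset, hi, fun z hz hzS => ?_⟩
      by_cases hzm : z = m
      · exact hzm ▸ h
      · exact hd z ⟨hz, hzm⟩ hzS
    · push Not at h
      refine ⟨insert m S, Set.insert_subset hm (hS.trans Set.sdiff_subset), ?_, ?_⟩
      · rintro a (rfl | ha) b (rfl | hb) hab
        · exact lt_irrefl _ (hD _ _ hab)
        · exact h b hb hab
        · exact (hD _ _ hab).not_ge (hmax a (hS ha).1)
        · exact hi a ha b hb hab
      · intro z hz hzS
        obtain ⟨s, hs, hD⟩ := hd z ⟨hz, fun h => hzS (.inl h)⟩ (fun h => hzS (.inr h))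
        exact ⟨s, .inr hs, hD⟩

/-- Galvin's kernel lemma: the two ends `p`, `q` rank elements in opposite ways. -/
theorem exists_kernel_of_opposite_ranks {α β γ : Type*} [Finite α] (p : α → β) (q : α → γ)
    (c : α → ℕ) (Z : Set α) :
    ∃ S ⊆ Z, (∀ a ∈ S, ∀ b ∈ S, ¬ ((p a = p b ∧ c a < c b) ∨ (q a = q b ∧ c b < c a))) ∧
      ∀ z ∈ Z, z ∉ S → ∃ s ∈ S, (p z = p s ∧ c z < c s) ∨ (q z = q s ∧ c s < c z) := by
  obtain ⟨n, hn⟩ : ∃ n, Z.ncard = n := ⟨_, rfl⟩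
  induction n generalizing Z with
  | zero =>
    rw [Set.ncard_eq_zero] at hn
    subst hn
    exact ⟨∅, le_rfl, by simp, by simp⟩
  | succ n ih =>
    by_cases hT : ∃ e ∈ Z, ∃ f ∈ Z, (∀ g ∈ Z, p g = p f → c g ≤ c f) ∧ q e = q f ∧ c f < c e
    · obtain ⟨e, he, f, hf, hbest, hq, hc⟩ := hT
      obtain ⟨S, hS, hi, hd⟩ := ih (Z \ {e}) (by
        rw [Set.ncard_sdiff_singleton_of_mem he, hn]; rfl)
      refine ⟨S, hS.trans Set.sdiff_subset, hi, fun z hz hzS => ?_⟩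
      by_cases hze : z = e
      · subst hze
        by_cases hfS : f ∈ S
        · exact ⟨f, hfS, .inr ⟨hq, hc⟩⟩
        · obtain ⟨s, hs, h⟩ := hd f ⟨hf, fun h => by simp at h; subst h; omega⟩ hfS
          refine ⟨s, hs, ?_⟩
          rcases h with ⟨h, h'⟩ | ⟨h, h'⟩
          · exact absurd (hbest s (hS hs).1 h.symm) (by omega)
          · exact .inr ⟨hq.trans h, by omega⟩
      · exact hd z ⟨hz, hze⟩ hzS
    · push Not at hT
      refine ⟨{z ∈ Z | ∀ g ∈ Z, p g = p z → c g ≤ c z}, Set.sep_subset _ _, ?_, ?_⟩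
      · rintro a ⟨ha, ha'⟩ b ⟨hb, hb'⟩ (⟨h, h'⟩ | ⟨h, h'⟩)
        · exact absurd (ha' b hb h.symm) (by omega)
        · exact absurd (hT a ha b hb hb' h) (by omega)
      · intro z hz hzS
        obtain ⟨m, ⟨hm, hpm⟩, hmax⟩ := Set.exists_max_image {g ∈ Z | p g = p z} c
          (Set.toFinite _) ⟨z, hz, rfl⟩
        have hm' : ∀ g ∈ Z, p g = p m → c g ≤ c m :=
          fun g hg h => hmax g ⟨hg, h.trans hpm⟩
        refine ⟨m, ⟨hm, hm'⟩, .inl ⟨hpm.symm, ?_⟩⟩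
        by_contra hlt
        exact hzS ⟨hz, fun g hg h => (hm' g hg (h.trans hpm.symm)).trans (by omega)⟩

end Orientation

section Bipartite

variable {V : Type*}

theorem exists_perm_of_row_col_sums {n : Type*} [Fintype n] [DecidableEq n] {k : ℕ} (hk : 0 < k)
    (M : n → n → ℕ) (hr : ∀ i, ∑ j, M i j = k) (hc : ∀ j, ∑ i, M i j = k) :
    ∃ σ : Equiv.Perm n, ∀ i, M i (σ i) ≠ 0 := by
  let f (i : n) : Finset n := {j | M i j ≠ 0}
  have hf (A : Finset n) : A.card ≤ (A.biUnion f).card := by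
    have h₀ (i : n) : ∑ j ∈ f i, M i j = k := by
      rw [← hr i]
      exact Finset.sum_filter_ne_zero _
    have h₁ : ∑ i ∈ A, ∑ j ∈ f i, M i j = A.card * k := by simp [h₀]
    have h₂ : ∑ i, ∑ j ∈ A.biUnion f, M i j = (A.biUnion f).card * k := by
      rw [Finset.sum_comm]
      simp [hc]
    suffices A.card * k ≤ (A.biUnion f).card * k from Nat.le_of_mul_le_mul_right this hk
    rw [← h₁, ← h₂]
    trans ∑ i ∈ A, ∑ j ∈ A.biUnion f, M i j
    · exact Finset.sum_le_sum fun i hi =>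
        Finset.sum_le_sum_of_subset (Finset.subset_biUnion_of_mem f hi)
    · exact Finset.sum_le_sum_of_subset (by simp)
  obtain ⟨g, hg, hg'⟩ := (Finset.all_card_le_biUnion_card_iff_exists_injective f).1 hf
  rw [Finite.injective_iff_bijective] at hg
  exact ⟨Equiv.ofBijective g hg, fun i => by simpa [f] using hg' i⟩

/-- A matrix of natural numbers with all row and column sums `k` is a sum of `k` permutation
matrices. -/
theorem exists_perms_of_row_col_sums {n : Type*} [Fintype n] [DecidableEq n] (k : ℕ)
    (M : n → n → ℕ) (hr : ∀ i, ∑ j, M i j = k) (hc : ∀ j, ∑ i, M i j = k) :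
    ∃ σ : Fin k → Equiv.Perm n, ∀ i j, M i j = ∑ c, if σ c i = j then 1 else 0 := by
  induction k generalizing M with
  | zero =>
    refine ⟨fun c => c.elim0, fun i j => ?_⟩
    have := hr i
    rw [Finset.sum_eq_zero_iff] at this
    simpa using this j (Finset.mem_univ j)
  | succ k ih =>
    obtain ⟨τ, hτ⟩ := exists_perm_of_row_col_sums (Nat.succ_pos k) M hr hc
    have hle : ∀ i j, (if τ i = j then 1 else 0) ≤ M i j := by
      intro i j
      split_ifs with h
      · subst h
        exact Nat.one_le_iff_ne_zero.2 (hτ i)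
      · exact Nat.zero_le _
    have hs : ∀ j, ∑ i, (if τ i = j then 1 else 0) = 1 := by
      intro j
      rw [Finset.sum_eq_single (τ.symm j)] <;> simp
      intro b hb h
      exact absurd (by rw [← h]; simp) hb
    obtain ⟨σ, hσ⟩ := ih (fun i j => M i j - if τ i = j then 1 else 0)
      (fun i => by
        rw [Finset.sum_tsub_distrib _ (fun j _ => hle i j), hr i]; simp)
      (fun j => by
        rw [Finset.sum_tsub_distrib _ (fun i _ => hle i j), hc j, hs j]; rfl)
    refine ⟨Fin.cons τ σ, fun i j => ?_⟩
    rw [Fin.sum_univ_succ]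
    simp only [Fin.cons_zero, Fin.cons_succ]
    rw [← hσ i j]
    have := hle i j
    omega

/-- König's edge colouring theorem. -/
theorem exists_bipartite_edgeColoring [Fintype V] (H : SimpleGraph V) (B : V → Bool)
    (k : ℕ) (hk : ∀ v, deg H v ≤ k) :
    ∃ c : V → V → Fin k → Prop,
      (∀ x y, H.Adj x y → B x = true → ∃ i, c x y i) ∧
      (∀ x y y' i, c x y i → c x y' i → y = y') ∧ (∀ x x' y i, c x y i → c x' y i → x = x') := by
  classical
  have hd : ∀ i, ∑ j, (if H.Adj i j then 1 else 0) = deg H i := by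
    intro i
    rw [deg, Finset.sum_boole, Set.ncard_eq_toFinset_card']
    simp only [Nat.cast_id]
    congr 1
    ext j
    simp
  have hM : ∀ i, ∑ j, ((if H.Adj i j then 1 else 0) + if i = j then k - deg H i else 0) = k := by
    intro i
    rw [Finset.sum_add_distrib, hd]
    simp [hk i]
  obtain ⟨σ, hσ⟩ := exists_perms_of_row_col_sums k
    (fun i j => (if H.Adj i j then 1 else 0) + if i = j then k - deg H i else 0) hM (by
      intro j
      refine Eq.trans (Finset.sum_congr rfl fun i _ => ?_) (hM j)
      by_cases h : i = j
      · subst h; rfl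
      · simp [H.adj_comm, h, Ne.symm h])
  refine ⟨fun x y i => σ i x = y, ?_, ?_, ?_⟩
  · intro x y hxy _
    by_contra hno
    push Not at hno
    have := hσ x y
    simp [hno, hxy] at this
  · rintro x y y' i rfl rfl
    rfl
  · intro x x' y i h h'
    exact (σ i).injective (h.trans h'.symm)

theorem exists_perm_lt_card {k : ℕ} (T : Set (Fin k)) :
    ∃ π : Equiv.Perm (Fin k), ∀ i ∈ T, (π i).val < T.ncard := by
  classical
  have hle : T.ncard ≤ k := by
    have := Set.ncard_le_card T
    simpa using this
  have e : {i // i ∈ T} ≃ {i : Fin k // i.val < T.ncard} := by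
    refine Fintype.equivOfCardEq ?_
    rw [← Nat.card_eq_fintype_card, ← Nat.card_eq_fintype_card]
    refine Eq.trans (b := T.ncard) rfl ?_
    rw [Nat.card_eq_fintype_card, Fintype.card_subtype, Fin.card_filter_val_lt]
    omega
  refine ⟨e.extendSubtype, fun i hi => ?_⟩
  exact e.extendSubtype_mem i hi

/-- König's theorem with the colours at `v` forming an initial segment. -/
theorem exists_bipartite_edgeColoring_at [Fintype V] (H : SimpleGraph V) (B : V → Bool)
    (k : ℕ) (hk : ∀ v, deg H v ≤ k) (v : V) (hv : B v = true) :
    ∃ c : V → V → ℕ,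
      (∀ x y, H.Adj x y → B x = true → c x y < k) ∧
      (∀ y, H.Adj v y → c v y < deg H v) ∧
      (∀ x y y', H.Adj x y → H.Adj x y' → B x = true → c x y = c x y' → y = y') ∧
      (∀ x x' y, H.Adj x y → H.Adj x' y → B x = true → B x' = true →
        c x y = c x' y → x = x') := by
  classical
  obtain ⟨col, hcol, hcol1, hcol2⟩ := exists_bipartite_edgeColoring H B k hk
  have : ∀ x y, ∃ i : ℕ, H.Adj x y → B x = true → ∃ j : Fin k, j.val = i ∧ col x y j := by
    intro x y
    by_cases h : H.Adj x y ∧ B x = true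
    · obtain ⟨i, hi⟩ := hcol x y h.1 h.2
      exact ⟨i, fun _ _ => ⟨i, rfl, hi⟩⟩
    · exact ⟨0, fun h1 h2 => absurd ⟨h1, h2⟩ h⟩
  choose g hg using this
  let T : Set (Fin k) := {i | ∃ y, H.Adj v y ∧ g v y = i.val}
  have hT : T.ncard ≤ deg H v := by
    have hsub : Fin.val '' T ⊆ g v '' H.neighborSet v := by
      rintro _ ⟨i, ⟨y, hy, hi⟩, rfl⟩
      exact ⟨y, hy, hi⟩
    have h1 := Set.ncard_le_ncard hsub
    rw [Set.ncard_image_of_injective _ Fin.val_injective] at h1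
    exact h1.trans (Set.ncard_image_le)
  obtain ⟨π, hπ⟩ := exists_perm_lt_card T
  refine ⟨fun x y => if h : g x y < k then π ⟨g x y, h⟩ else 0, ?_, ?_, ?_, ?_⟩
  · intro x y h hB
    obtain ⟨j, hj, -⟩ := hg x y h hB
    dsimp only
    rw [dif_pos (hj ▸ j.2)]
    exact (π _).2
  · intro y h
    obtain ⟨j, hj, -⟩ := hg v y h hv
    dsimp only
    rw [dif_pos (hj ▸ j.2)]
    exact (hπ _ ⟨y, h, rfl⟩).trans_le hT
  · intro x y y' h h' hB
    obtain ⟨j, hj, hc⟩ := hg x y h hB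
    obtain ⟨j', hj', hc'⟩ := hg x y' h' hB
    dsimp only
    rw [dif_pos (hj ▸ j.2), dif_pos (hj' ▸ j'.2)]
    intro heq
    have := π.injective (Fin.val_injective heq)
    have h3 : j = j' := Fin.ext (by rw [hj, hj']; exact congrArg Fin.val this)
    exact hcol1 x y y' j hc (h3 ▸ hc')
  · intro x x' y h h' hB hB'
    obtain ⟨j, hj, hc⟩ := hg x y h hB
    obtain ⟨j', hj', hc'⟩ := hg x' y h' hB'
    dsimp only
    rw [dif_pos (hj ▸ j.2), dif_pos (hj' ▸ j'.2)]
    intro heq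
    have := π.injective (Fin.val_injective heq)
    have h3 : j = j' := Fin.ext (by rw [hj, hj']; exact congrArg Fin.val this)
    exact hcol2 x x' y j hc (h3 ▸ hc')

open Classical in
/-- The function equal to `deg G v` at the edges at `v` and to `k` elsewhere. -/
noncomputable def capAt (G : SimpleGraph V) (k : ℕ) (v : V) (e : Sym2 V) : ℕ :=
  if v ∈ e then deg G v else k

theorem orientableOn_bipartite_of_true [Fintype V] (H : SimpleGraph V) (B : V → Bool)
    (hB : ∀ x y, H.Adj x y → B x ≠ B y) (k : ℕ) (hk : ∀ v, deg H v ≤ k) (v : V) (hv : B v = true) :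
    OrientableOn H.edgeSet (capAt H k v) := by
  classical
  obtain ⟨col, hc1, hc2, hc3, hc4⟩ := exists_bipartite_edgeColoring_at H B k hk v hv
  have hch : ∀ e : Sym2 V, ∃ x y : V, e ∈ H.edgeSet → e = s(x, y) ∧ B x = true ∧ B y = false := by
    intro e
    induction e with | _ x y =>
    by_cases he : H.Adj x y
    · have := hB x y he
      cases hx : B x
      · exact ⟨y, x, fun _ => ⟨Sym2.eq_swap, by grind, hx⟩⟩
      · exact ⟨x, y, fun _ => ⟨rfl, hx, by grind⟩⟩
    · exact ⟨x, y, fun h => absurd h he⟩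
  choose p q hpq using hch
  have hadj : ∀ e ∈ H.edgeSet, H.Adj (p e) (q e) := fun e he => by
    have := (hpq e he).1
    rw [this] at he
    exact he
  set c : Sym2 V → ℕ := fun e => col (p e) (q e) with hc
  have hpm : ∀ e ∈ H.edgeSet, p e ∈ e := fun e he =>
    (congrArg (p e ∈ ·) (hpq e he).1).mpr (Sym2.mem_mk_left _ _)
  have hqm : ∀ e ∈ H.edgeSet, q e ∈ e := fun e he =>
    (congrArg (q e ∈ ·) (hpq e he).1).mpr (Sym2.mem_mk_right _ _)
  have hvp : ∀ e ∈ H.edgeSet, v ∈ e → p e = v := by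
    intro e he hve
    rw [(hpq e he).1, Sym2.mem_iff] at hve
    rcases hve with h | h
    · exact h.symm
    · rw [h, (hpq e he).2.2] at hv
      exact absurd hv (by simp)
  have hpv : ∀ e ∈ H.edgeSet, p e = v → v ∈ e := by
    intro e he h
    rw [(hpq e he).1, ← h]
    exact Sym2.mem_mk_left _ _
  have hclt : ∀ e ∈ H.edgeSet, c e < capAt H k v e := by
    intro e he
    rw [capAt]
    split_ifs with h
    · have := hadj e he
      simp only [hc]
      rw [hvp e he h] at this ⊢
      exact hc2 _ this
    · exact hc1 _ _ (hadj e he) (hpq e he).2.1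
  have hpinj : ∀ e ∈ H.edgeSet, ∀ f ∈ H.edgeSet, p e = p f → c e = c f → e = f := by
    intro e he f hf hp hcc
    rw [(hpq e he).1, (hpq f hf).1, hp]
    simp only [hc, hp] at hcc
    rw [hc3 (p f) (q e) (q f) (hp ▸ hadj e he) (hadj f hf) (hpq f hf).2.1 hcc]
  have hqinj : ∀ e ∈ H.edgeSet, ∀ f ∈ H.edgeSet, q e = q f → c e = c f → e = f := by
    intro e he f hf hp hcc
    rw [(hpq e he).1, (hpq f hf).1, hp]
    simp only [hc, hp] at hcc
    rw [hc4 (p e) (p f) (q f) (hp ▸ hadj e he) (hadj f hf) (hpq e he).2.1 (hpq f hf).2.1 hcc]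
  refine ⟨fun e f => e ∈ H.edgeSet ∧ f ∈ H.edgeSet ∧
    ((p e = p f ∧ c e < c f) ∨ (q e = q f ∧ c f < c e)), ?_, ?_, ?_, ?_⟩
  · rintro e f ⟨he, hf, h⟩
    refine ⟨he, hf, ?_, ?_⟩
    · rintro rfl
      rcases h with h | h <;> exact lt_irrefl _ h.2
    · rcases h with h | h
      · exact ⟨p e, hpm e he, h.1 ▸ hpm f hf⟩
      · exact ⟨q e, hqm e he, h.1 ▸ hqm f hf⟩
  · rintro e he f hf hne ⟨x, hx, hx'⟩
    rw [(hpq e he).1, Sym2.mem_iff] at hx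
    rw [(hpq f hf).1, Sym2.mem_iff] at hx'
    have e1 := (hpq e he).2
    have f1 := (hpq f hf).2
    have h1 := fun h => mt (hpinj e he f hf h) hne
    have h2 := fun h => mt (hqinj e he f hf h) hne
    rcases hx with rfl | rfl <;> rcases hx' with hx' | hx'
    · rcases lt_or_gt_of_ne (h1 hx') with h | h
      · exact .inl ⟨he, hf, .inl ⟨hx', h⟩⟩
      · exact .inr ⟨hf, he, .inl ⟨hx'.symm, h⟩⟩
    · simp [hx', f1.2] at e1
    · simp [hx', f1.1] at e1
    · rcases lt_or_gt_of_ne (h2 hx') with h | h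
      · exact .inr ⟨hf, he, .inr ⟨hx'.symm, h⟩⟩
      · exact .inl ⟨he, hf, .inr ⟨hx', h⟩⟩
  · intro Z hZ
    obtain ⟨S, hS, hi, hd⟩ := exists_kernel_of_opposite_ranks p q c Z
    refine ⟨S, hS, fun a ha b hb h => hi a ha b hb h.2.2, fun z hz hzS => ?_⟩
    obtain ⟨s, hs, h⟩ := hd z hz hzS
    exact ⟨s, hs, hZ hz, hZ (hS hs), h⟩
  · intro e he
    have hlt := hclt e he
    have hX : {f | f ∈ H.edgeSet ∧ p e = p f ∧ c e < c f}.ncard ≤ capAt H k v e - (c e + 1) := by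
      rw [← Nat.card_Ico, ← Set.ncard_coe_finset]
      refine Set.ncard_le_ncard_of_injOn c ?_ ?_
      · rintro f ⟨hf, hp, hlt⟩
        have := hclt f hf
        have : capAt H k v f = capAt H k v e := by
          rw [capAt, capAt]
          have : v ∈ f ↔ v ∈ e :=
            ⟨fun h => hpv e he (hp.trans (hvp f hf h)),
              fun h => hpv f hf (hp.symm.trans (hvp e he h))⟩
          simp [this]
        simp
        omega
      · rintro f ⟨hf, hp, -⟩ g ⟨hg, hp', -⟩ h
        exact hpinj f hf g hg (hp.symm.trans hp') h
    have hY : {f | f ∈ H.edgeSet ∧ q e = q f ∧ c f < c e}.ncard ≤ c e := by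
      conv_rhs => rw [← Finset.card_range (c e), ← Set.ncard_coe_finset]
      refine Set.ncard_le_ncard_of_injOn c ?_ ?_
      · rintro f ⟨hf, hp, hlt⟩
        simpa using hlt
      · rintro f ⟨hf, hp, -⟩ g ⟨hg, hp', -⟩ h
        exact hqinj f hf g hg (hp.symm.trans hp') h
    have hsub : {f | e ∈ H.edgeSet ∧ f ∈ H.edgeSet ∧
        ((p e = p f ∧ c e < c f) ∨ (q e = q f ∧ c f < c e))} ⊆
        {f | f ∈ H.edgeSet ∧ p e = p f ∧ c e < c f} ∪
          {f | f ∈ H.edgeSet ∧ q e = q f ∧ c f < c e} := by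
      rintro f ⟨-, hf, h | h⟩
      · exact .inl ⟨hf, h⟩
      · exact .inr ⟨hf, h⟩
    have h6 := (Set.ncard_le_ncard hsub).trans (Set.ncard_union_le _ _)
    exact le_trans (Nat.add_le_add_right h6 1) (by omega)

/-- Bipartite graphs are strongly edge-orientable. -/
theorem orientableOn_bipartite [Fintype V] (H : SimpleGraph V) (B : V → Bool)
    (hB : ∀ x y, H.Adj x y → B x ≠ B y) (k : ℕ) (hk : ∀ v, deg H v ≤ k) (v : V) :
    OrientableOn H.edgeSet (capAt H k v) := by
  cases hv : B v
  · exact orientableOn_bipartite_of_true H (fun x => !B x)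
      (fun x y h => by simpa using hB x y h) k hk v (by simp [hv])
  · exact orientableOn_bipartite_of_true H B hB k hk v hv

/-- A graph whose cycles are all even has a proper 2-colouring. -/
theorem exists_bool_coloring_of_even_cycles (H : SimpleGraph V)
    (hH : ∀ (u : V) (c : H.Walk u u), c.IsCycle → Even c.length) :
    ∃ B : V → Bool, ∀ x y, H.Adj x y → B x ≠ B y := by
  classical
  have key : ∀ {u w : V} (p : H.Walk u w), Even (p.length + p.bypass.length) := by
    intro u w p
    induction p with
    | nil => exact ⟨0, rfl⟩
    | @cons u x w h p ih =>
      rw [Walk.bypass]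
      split_ifs with hs
      · have hpath := p.bypass_isPath
        have h1 : (p.bypass.takeUntil u hs).IsPath := hpath.takeUntil hs
        have h2 : p.bypass.length = (p.bypass.takeUntil u hs).length +
            (p.bypass.dropUntil u hs).length := by
          rw [← Walk.length_append, Walk.take_spec]
        have h3 : Odd (p.bypass.takeUntil u hs).length := by
          by_cases he : s(u, x) ∈ (p.bypass.takeUntil u hs).edges
          · rw [h1.length_eq_one_of_mem_edges (Sym2.eq_swap ▸ he)]
            exact odd_one
          · have := hH u (Walk.cons h (p.bypass.takeUntil u hs))
              ((Walk.cons_isCycle_iff _ h).2 ⟨h1, he⟩)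
            rw [Walk.length_cons] at this
            grind
        rw [Walk.length_cons]
        grind
      · simp only [Walk.length_cons]
        grind
  have h2 : H.Colorable 2 := by
    rw [two_colorable_iff_forall_loop_even]
    intro u p
    have := key p
    have h0 : p.bypass.length = 0 := by
      exact Walk.length_eq_zero_iff.2 (Walk.isPath_iff_nil.1 p.bypass_isPath)
    rw [h0] at this
    simpa using this
  obtain ⟨C⟩ := h2
  refine ⟨fun x => decide (C x = 0), fun x y h heq => ?_⟩
  have := C.valid h
  simp at heq
  grind

end Bipartite

section Walks

variable {V : Type*} {G : SimpleGraph V}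

/-- Two walks with common ends which have no other common vertices. -/
def IntDisj {a b : V} (p q : G.Walk a b) : Prop :=
  ∀ z, z ∈ p.support → z ∈ q.support → z = a ∨ z = b

theorem IntDisj.symm {a b : V} {p q : G.Walk a b} (h : IntDisj p q) : IntDisj q p :=
  fun z hz hz' => h z hz' hz

theorem intDisj_toWalk {a b : V} (p : G.Walk a b) (h : G.Adj a b) : IntDisj p h.toWalk := by
  intro z _ hz
  simpa using hz

theorem isPath_append_of_inter {a b d : V} {p : G.Walk a b} {q : G.Walk b d} (hp : p.IsPath)
    (hq : q.IsPath) (h : ∀ z, z ∈ p.support → z ∈ q.support → z = b) : (p.append q).IsPath := by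
  rw [Walk.isPath_def, Walk.support_append, List.nodup_append']
  refine ⟨hp.support_nodup, hq.support_nodup.tail, fun z hz hz' => ?_⟩
  have hb := h z hz (List.mem_of_mem_tail hz')
  subst hb
  have := hq.support_nodup
  rw [← Walk.cons_tail_support] at this
  exact (List.nodup_cons.1 this).1 hz'

theorem isCycle_append_reverse {a b : V} {p q : G.Walk a b} (hp : p.IsPath) (hq : q.IsPath)
    (hd : IntDisj p q) (h : 3 ≤ p.length + q.length) : (p.append q.reverse).IsCycle := by
  refine hp.isCycle_append hq.reverse ?_ (by rw [Walk.length_reverse]; omega)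
  intro z hz hz'
  have h1 := hp.support_nodup
  rw [← Walk.cons_tail_support] at h1
  have h2 := hq.reverse.support_nodup
  rw [← Walk.cons_tail_support] at h2
  rcases hd z (List.mem_of_mem_tail hz) (by simpa using List.mem_of_mem_tail hz') with rfl | rfl
  · exact (List.nodup_cons.1 h1).1 hz
  · exact (List.nodup_cons.1 h2).1 hz'

theorem length_pos_of_ne {a b : V} (p : G.Walk a b) (hab : a ≠ b) : 1 ≤ p.length := by
  rcases Nat.eq_zero_or_pos p.length with h | h
  · exact absurd (Walk.eq_of_length_eq_zero h) hab
  · exact h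

theorem mem_edges_of_length_eq_one {a b : V} (p : G.Walk a b) (h : p.length = 1) :
    p.edges = [s(a, b)] := by
  cases p with
  | nil => simp at h
  | cons h' q =>
    cases q with
    | nil => simp
    | cons => simp at h

/-- In a graph in `G*`, two odd cycles formed from three parallel paths share a single edge. -/
theorem InGStar.length_le_one (hG : InGStar G) {a b : V} {p q r : G.Walk a b} (hab : a ≠ b)
    (hp : p.IsPath) (hq : q.IsPath) (hr : r.IsPath) (hpq : IntDisj p q) (hpr : IntDisj p r)
    (hqr : IntDisj q r) (h1 : Odd (p.length + q.length)) (h2 : Odd (p.length + r.length))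
    (h3 : 2 ≤ q.length) : p.length ≤ 1 := by
  classical
  by_contra hlt
  have := length_pos_of_ne r hab
  have hc1 := isCycle_append_reverse hp hq hpq (by omega)
  have hc2 := isCycle_append_reverse hp hr hpr (by grind)
  have hne : {e | e ∈ (p.append q.reverse).edges} ≠ {e | e ∈ (p.append r.reverse).edges} := by
    cases q with
    | nil => simp at h3
    | @cons _ y _ hy q' =>
      intro heq
      have hmem : s(a, y) ∈ {e | e ∈ (p.append r.reverse).edges} := by
        rw [← heq]
        simp
      have hyq : y ∈ (Walk.cons hy q').support := by simp
      have hyb : y ≠ b := by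
        rintro rfl
        have := hq.length_eq_one_of_mem_edges (by simp : s(a, y) ∈ (Walk.cons hy q').edges)
        omega
      simp only [Set.mem_ofPred_eq, Walk.edges_append, Walk.edges_reverse, List.mem_append,
        List.mem_reverse] at hmem
      rcases hmem with hm | hm
      · rcases hpq y (Walk.snd_mem_support_of_mem_edges _ hm) hyq with h | h
        · exact hy.ne h.symm
        · exact hyb h
      · rcases hqr y hyq (Walk.snd_mem_support_of_mem_edges _ hm) with h | h
        · exact hy.ne h.symm
        · exact hyb h
  have h := hG _ _ _ _ hc1 hc2 (by simpa using h1) (by simpa using h2) hne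
  have hsub : (p.edges.toFinset : Set (Sym2 V)) ⊆
      {e | e ∈ (p.append q.reverse).edges} ∩ {e | e ∈ (p.append r.reverse).edges} := by
    intro e he
    have he : e ∈ p.edges := by simpa using he
    constructor <;> simp [he]
  have hfin : ({e | e ∈ (p.append q.reverse).edges} ∩
      {e | e ∈ (p.append r.reverse).edges}).Finite :=
    Set.Finite.inter_of_left (List.finite_toSet _) _
  have := Set.ncard_le_ncard hsub hfin
  rw [Set.ncard_coe_finset, List.toFinset_card_of_nodup hp.isTrail.edges_nodup,
    Walk.length_edges] at this
  omega

theorem InGStar.false_of_even_odd (hG : InGStar G) {a b : V} (hab : G.Adj a b) {p r : G.Walk a b}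
    (hp : p.IsPath) (hr : r.IsPath) (hpr : IntDisj p r) (h1 : Even p.length) (h2 : Odd r.length)
    (h3 : 2 ≤ r.length) : False := by
  have h := hG.length_le_one hab.ne hp hr hab.isPath_toWalk hpr (intDisj_toWalk _ _)
    (intDisj_toWalk _ _) (h1.add_odd h2) (h1.add_odd (by simp)) h3
  have := length_pos_of_ne p hab.ne
  grind

theorem exists_split_of_isCycle {u a b : V} {c : G.Walk u u} (hc : c.IsCycle)
    (ha : a ∈ c.support) (hb : b ∈ c.support) (hab : a ≠ b) :
    ∃ A B : G.Walk a b, A.IsPath ∧ B.IsPath ∧ IntDisj A B ∧ A.length + B.length = c.length ∧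
      (∀ e, e ∈ c.edges ↔ e ∈ A.edges ∨ e ∈ B.edges) ∧
      (∀ z, z ∈ c.support ↔ z ∈ A.support ∨ z ∈ B.support) := by
  classical
  set d := c.rotate a ha with hd
  have hdc : d.IsCycle := hc.rotate ha
  have hbd : b ∈ d.support := (Walk.mem_support_rotate_iff c a ha).2 hb
  have hsplit := d.take_spec hbd
  set A := d.takeUntil b hbd
  set B := d.dropUntil b hbd
  have hcy : (A.append B).IsCycle := hsplit ▸ hdc
  refine ⟨A, B.reverse, hcy.isPath_of_append_left (fun h => hab h.eq.symm),
    (hcy.isPath_of_append_right (fun h => hab h.eq)).reverse, ?_, ?_, ?_, ?_⟩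
  · intro z hz hz'
    rw [Walk.support_reverse, List.mem_reverse] at hz'
    have hnd := hcy.support_nodup
    rw [Walk.tail_support_append, List.nodup_append'] at hnd
    rw [← Walk.cons_tail_support, List.mem_cons] at hz hz'
    rcases hz with h | h
    · exact .inl h
    · rcases hz' with h' | h'
      · exact .inr h'
      · exact (hnd.2.2 h h').elim
  · rw [Walk.length_reverse, ← Walk.length_append, hsplit, hd, Walk.length_rotate]
  · intro e
    rw [Walk.edges_reverse, List.mem_reverse, ← List.mem_append, ← Walk.edges_append, hsplit, hd,
      (Walk.rotate_edges c a ha).mem_iff]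
  · intro z
    rw [Walk.support_reverse, List.mem_reverse, ← Walk.mem_support_append_iff, hsplit, hd,
      Walk.mem_support_rotate_iff]

/-- An ear of an odd cycle in a graph in `G*` has even length and adjacent ends. -/
theorem InGStar.ear (hG : InGStar G) {u a b : V} {c : G.Walk u u} (hc : c.IsCycle)
    (hodd : Odd c.length) (ha : a ∈ c.support) (hb : b ∈ c.support) (hab : a ≠ b)
    {P : G.Walk a b} (hP : P.IsPath) (hPc : ∀ z, z ∈ P.support → z ∈ c.support → z = a ∨ z = b)
    (h : 2 ≤ P.length ∨ s(a, b) ∉ c.edges) :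
    Even P.length ∧ ∃ Q : G.Walk a b, Q.IsPath ∧ Even Q.length ∧
      (∀ e, e ∈ c.edges ↔ e ∈ Q.edges ∨ e = s(a, b)) ∧ ∀ z, z ∈ c.support ↔ z ∈ Q.support := by
  obtain ⟨A, B, hA, hB, hAB, hlen, hE, hS, hAo, hBe⟩ : ∃ A B : G.Walk a b, A.IsPath ∧ B.IsPath ∧
      IntDisj A B ∧ A.length + B.length = c.length ∧
      (∀ e, e ∈ c.edges ↔ e ∈ A.edges ∨ e ∈ B.edges) ∧
      (∀ z, z ∈ c.support ↔ z ∈ A.support ∨ z ∈ B.support) ∧ Odd A.length ∧ Even B.length := by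
    obtain ⟨A, B, hA, hB, hAB, hlen, hE, hS⟩ := exists_split_of_isCycle hc ha hb hab
    rcases Nat.even_or_odd B.length with h | h
    · exact ⟨A, B, hA, hB, hAB, hlen, hE, hS, by grind, h⟩
    · exact ⟨B, A, hB, hA, hAB.symm, by omega, fun e => (hE e).trans or_comm,
        fun z => (hS z).trans or_comm, h, by grind⟩
  have hB2 : 2 ≤ B.length := by
    have := length_pos_of_ne B hab
    grind
  have hAP : IntDisj A P := fun z hz hz' => hPc z hz' ((hS z).2 (.inl hz))
  have hBP : IntDisj B P := fun z hz hz' => hPc z hz' ((hS z).2 (.inr hz))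
  rcases Nat.even_or_odd P.length with hPe | hPo
  · have hA1 := hG.length_le_one hab hA hB hP hAB hAP hBP (hAo.add_even hBe) (hAo.add_even hPe) hB2
    have hA1 : A.length = 1 := by grind
    have hAe := mem_edges_of_length_eq_one A hA1
    refine ⟨hPe, B, hB, hBe, fun e => ?_, fun z => ?_⟩
    · rw [hE, hAe, or_comm, List.mem_singleton]
    · rw [hS]
      refine ⟨?_, .inr⟩
      rintro (h | h)
      · cases A with
        | nil => simp at hA1
        | cons h' q =>
          cases q with
          | nil =>
            simp at h
            rcases h with rfl | rfl <;> simp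
          | cons => simp at hA1
      · exact h
  · exfalso
    by_cases hA2 : 2 ≤ A.length
    · have := hG.length_le_one hab hB hA hP hAB.symm hBP hAP (hBe.add_odd hAo) (hBe.add_odd hPo) hA2
      omega
    by_cases hP2 : 2 ≤ P.length
    · have := hG.length_le_one hab hB hP hA hBP hAB.symm hAP.symm (hBe.add_odd hPo)
        (hBe.add_odd hAo) hP2
      omega
    · have := length_pos_of_ne A hab
      have hAe := mem_edges_of_length_eq_one A (by omega)
      rcases h with h | h
      · exact hP2 h
      · exact h ((hE _).2 (.inl (by simp [hAe])))

theorem InGStar.mem_edges_of_adj (hG : InGStar G) {u a b : V} {c : G.Walk u u} (hc : c.IsCycle)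
    (hodd : Odd c.length) (ha : a ∈ c.support) (hb : b ∈ c.support) (hab : G.Adj a b) :
    s(a, b) ∈ c.edges := by
  by_contra h
  have := (hG.ear hc hodd ha hb hab.ne hab.isPath_toWalk (fun z hz _ => by simpa using hz)
    (.inr h)).1
  simp at this

/-- Replacing an edge of a path by a path which is otherwise disjoint from it. -/
theorem exists_isPath_replace {a b x y : V} {Q : G.Walk a b} (hQ : Q.IsPath)
    (hxy : s(x, y) ∈ Q.edges) {P : G.Walk x y} (hP : P.IsPath)
    (hPQ : ∀ z, z ∈ P.support → z ∈ Q.support → z = x ∨ z = y) :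
    ∃ R : G.Walk a b, R.IsPath ∧ R.length + 1 = Q.length + P.length ∧
      ∀ z, z ∈ R.support → z ∈ Q.support ∨ z ∈ P.support := by
  induction Q with
  | nil => simp at hxy
  | @cons a w b h q ih =>
    rw [Walk.cons_isPath_iff] at hQ
    rw [Walk.edges_cons, List.mem_cons] at hxy
    by_cases hq : s(x, y) ∈ q.edges
    · obtain ⟨R, hR, hl, hs⟩ := ih hQ.1 hq (fun z hz hz' => hPQ z hz (by simp [hz']))
      refine ⟨Walk.cons h R, ?_, ?_, ?_⟩
      · rw [Walk.cons_isPath_iff]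
        refine ⟨hR, fun ha => ?_⟩
        rcases hs a ha with h1 | h1
        · exact hQ.2 h1
        · rcases hPQ a h1 (by simp) with rfl | rfl
          · exact hQ.2 (Walk.fst_mem_support_of_mem_edges _ hq)
          · exact hQ.2 (Walk.snd_mem_support_of_mem_edges _ hq)
      · simp only [Walk.length_cons]
        omega
      · intro z hz
        rw [Walk.support_cons, List.mem_cons] at hz ⊢
        rcases hz with rfl | hz
        · exact .inl (.inl rfl)
        · exact (hs z hz).imp .inr id
    · have hxy := hxy.resolve_right hq
      rw [Sym2.eq_iff] at hxy
      rcases hxy with ⟨rfl, rfl⟩ | ⟨rfl, rfl⟩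
      · refine ⟨P.append q, isPath_append_of_inter hP hQ.1 ?_, ?_, ?_⟩
        · intro z hz hz'
          rcases hPQ z hz (by simp [hz']) with rfl | rfl
          · exact absurd hz' hQ.2
          · rfl
        · simp only [Walk.length_append, Walk.length_cons]
          omega
        · intro z hz
          rw [Walk.mem_support_append_iff] at hz
          rcases hz with hz | hz
          · exact .inr hz
          · exact .inl (by simp [hz])
      · refine ⟨P.reverse.append q, isPath_append_of_inter hP.reverse hQ.1 ?_, ?_, ?_⟩
        · intro z hz hz'
          rw [Walk.support_reverse, List.mem_reverse] at hz
          rcases hPQ z hz (by simp [hz']) with rfl | rfl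
          · rfl
          · exact absurd hz' hQ.2
        · simp only [Walk.length_append, Walk.length_cons, Walk.length_reverse]
          omega
        · intro z hz
          rw [Walk.mem_support_append_iff, Walk.support_reverse, List.mem_reverse] at hz
          rcases hz with hz | hz
          · exact .inr hz
          · exact .inl (by simp [hz])

/-- A walk into a set contains a path meeting the set only at its end. -/
theorem exists_isPath_first {T : Set V} {a b : V} (w : G.Walk a b) (hb : b ∈ T) :
    ∃ m ∈ T, ∃ L : G.Walk a m, L.IsPath ∧ (∀ z, z ∈ L.support → z ∈ w.support) ∧
      ∀ z, z ∈ L.support → z ∈ T → z = m := by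
  classical
  suffices h : ∃ m ∈ T, ∃ L : G.Walk a m, (∀ z, z ∈ L.support → z ∈ w.support) ∧
      ∀ z, z ∈ L.support → z ∈ T → z = m by
    obtain ⟨m, hm, L, h1, h2⟩ := h
    exact ⟨m, hm, L.bypass, L.bypass_isPath,
      fun z hz => h1 z (L.support_bypass_subset_support hz),
      fun z hz => h2 z (L.support_bypass_subset_support hz)⟩
  induction w with
  | nil => exact ⟨_, hb, .nil, fun z hz => hz, fun z hz _ => by simpa using hz⟩
  | @cons a x b h q ih =>
    by_cases ha : a ∈ T
    · exact ⟨a, ha, .nil, fun z hz => by simp at hz; simp [hz], fun z hz _ => by simpa using hz⟩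
    · obtain ⟨m, hm, L, h1, h2⟩ := ih hb
      refine ⟨m, hm, .cons h L, ?_, ?_⟩
      · intro z hz
        rw [Walk.support_cons, List.mem_cons] at hz ⊢
        exact hz.imp id (h1 z)
      · intro z hz hzT
        rw [Walk.support_cons, List.mem_cons] at hz
        rcases hz with rfl | hz
        · exact absurd hzT ha
        · exact h2 z hz hzT

/-- `k` is reachable from `u` by a walk avoiding `S`. -/
def ReachAvoiding (G : SimpleGraph V) (S : Set V) (u k : V) : Prop :=
  ∃ w : G.Walk u k, ∀ z, z ∈ w.support → z ∉ S

theorem ReachAvoiding.symm {S : Set V} {u k : V} (h : ReachAvoiding G S u k) :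
    ReachAvoiding G S k u := by
  obtain ⟨w, hw⟩ := h
  exact ⟨w.reverse, fun z hz => hw z (by simpa using hz)⟩

theorem ReachAvoiding.trans {S : Set V} {u k l : V} (h : ReachAvoiding G S u k)
    (h' : ReachAvoiding G S k l) : ReachAvoiding G S u l := by
  obtain ⟨w, hw⟩ := h
  obtain ⟨w', hw'⟩ := h'
  refine ⟨w.append w', fun z hz => ?_⟩
  rw [Walk.mem_support_append_iff] at hz
  exact hz.elim (hw z) (hw' z)

theorem ReachAvoiding.notMem {S : Set V} {u k : V} (h : ReachAvoiding G S u k) : k ∉ S := by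
  obtain ⟨w, hw⟩ := h
  exact hw k w.end_mem_support

theorem ReachAvoiding.refl {S : Set V} {u : V} (h : u ∉ S) : ReachAvoiding G S u u :=
  ⟨.nil, fun z hz => by simp at hz; exact hz ▸ h⟩

theorem ReachAvoiding.adj {S : Set V} {u k l : V} (h : ReachAvoiding G S u k) (hkl : G.Adj k l)
    (hl : l ∉ S) : ReachAvoiding G S u l :=
  h.trans ⟨hkl.toWalk, fun z hz => by
    simp at hz
    rcases hz with rfl | rfl
    · exact h.notMem
    · exact hl⟩

theorem reachAvoiding_of_mem_support {S : Set V} {u k z : V} {w : G.Walk u k}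
    (hw : ∀ z, z ∈ w.support → z ∉ S) (hz : z ∈ w.support) : ReachAvoiding G S u z := by
  classical
  exact ⟨w.takeUntil z hz, fun y hy => hw y (w.support_takeUntil_subset_support hz hy)⟩

/-- `a ∈ S` is adjacent to the component of `u` in `G - S`. -/
def Attached (G : SimpleGraph V) (S : Set V) (u a : V) : Prop :=
  a ∈ S ∧ ∃ k, ReachAvoiding G S u k ∧ G.Adj k a

theorem Attached.of_reach {S : Set V} {u u' a : V} (h : Attached G S u a)
    (hu : ReachAvoiding G S u' u) : Attached G S u' a := by
  obtain ⟨ha, k, hk, hka⟩ := h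
  exact ⟨ha, k, hu.trans hk, hka⟩

theorem Attached.exists_ear {S : Set V} {u a b : V} (ha : Attached G S u a)
    (hb : Attached G S u b) (hab : a ≠ b) :
    ∃ P : G.Walk a b, P.IsPath ∧ 2 ≤ P.length ∧
      ∀ z, z ∈ P.support → z = a ∨ z = b ∨ ReachAvoiding G S u z := by
  classical
  obtain ⟨haS, k, hk, hka⟩ := ha
  obtain ⟨hbS, l, hl, hlb⟩ := hb
  obtain ⟨w, hw⟩ := hk.symm.trans hl
  have hw' : ∀ z, z ∈ w.bypass.support → z ∉ S :=
    fun z hz => hw z (w.support_bypass_subset_support hz)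
  have h1 := w.bypass_isPath.concat (fun h => hw' b h hbS) hlb
  refine ⟨Walk.cons hka.symm (w.bypass.concat hlb), ?_, ?_, ?_⟩
  · refine h1.cons ?_
    simp only [Walk.support_concat, List.mem_append, List.mem_singleton]
    rintro (h | h)
    · exact hw' a h haS
    · exact hab h
  · simp
  · intro z hz
    simp only [Walk.support_cons, Walk.support_concat, List.mem_cons, List.mem_append] at hz
    rcases hz with h | h | h
    · exact .inl h
    · exact .inr (.inr (hk.trans (reachAvoiding_of_mem_support hw' h)))
    · simp at h
      exact .inr (.inl h)

/-- No two edge-disjoint nonempty parts of the graph are separated by at most one vertex. -/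
def NoSep (G : SimpleGraph V) : Prop :=
  ∀ A K : Set V, (∀ k ∈ K, k ∉ A) → (∀ k ∈ K, ∀ w, G.Adj k w → w ∈ K ∨ w ∈ A) →
    (∃ k ∈ K, ∃ w, G.Adj k w) → (∃ x y, G.Adj x y ∧ x ∉ K ∧ y ∉ K) →
    ∃ a ∈ A, ∃ b ∈ A, a ≠ b ∧ (∃ k ∈ K, G.Adj k a) ∧ ∃ k ∈ K, G.Adj k b

theorem NoSep.exists_attached (hsep : NoSep G) {S : Set V} {u k x p q : V} (hp : p ∈ S)
    (hq : q ∈ S) (hpq : G.Adj p q) (hk : ReachAvoiding G S u k) (hkx : G.Adj k x) :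
    ∃ a b, a ≠ b ∧ Attached G S u a ∧ Attached G S u b := by
  obtain ⟨a, ha, b, hb, hab, ⟨k, hk, hka⟩, ⟨l, hl, hlb⟩⟩ := hsep S {z | ReachAvoiding G S u z}
    (fun k hk => hk.notMem)
    (fun k hk w hkw => (em (w ∈ S)).elim .inr (fun h => .inl (ReachAvoiding.adj hk hkw h)))
    ⟨k, hk, x, hkx⟩ ⟨p, q, hpq, fun h => h.notMem hp, fun h => h.notMem hq⟩
  exact ⟨a, b, hab, ⟨ha, k, hk, hka⟩, ⟨hb, l, hl, hlb⟩⟩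

/-- No four pairwise adjacent vertices. -/
def NoK4 (G : SimpleGraph V) : Prop :=
  ∀ a b c d, G.Adj a b → G.Adj a c → G.Adj a d → G.Adj b c → G.Adj b d → G.Adj c d → False

theorem InGStar.length_leg_eq_one (hG : InGStar G) {m a b d : V} {L₁ : G.Walk m a}
    {L₂ : G.Walk m b} {L₃ : G.Walk m d} (h₁ : L₁.IsPath) (h₂ : L₂.IsPath) (h₃ : L₃.IsPath)
    (h₁₂ : ∀ z, z ∈ L₁.support → z ∈ L₂.support → z = m)
    (h₁₃ : ∀ z, z ∈ L₁.support → z ∈ L₃.support → z = m)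
    (h₂₃ : ∀ z, z ∈ L₂.support → z ∈ L₃.support → z = m) (hma : m ≠ a) (hmb : m ≠ b)
    (hab : G.Adj a b) (hdb : G.Adj d b)
    (he₁ : Even (L₁.length + L₂.length)) (he₂ : Even (L₂.length + L₃.length)) : G.Adj m b := by
  have hb1 : b ∉ L₁.support := fun h => hmb (h₁₂ b h L₂.end_mem_support).symm
  have hb3 : b ∉ L₃.support := fun h => hmb (h₂₃ b L₂.end_mem_support h).symm
  have hle := hG.length_le_one hmb h₂ (h₁.concat hb1 hab) (h₃.concat hb3 hdb) (by
      intro z hz hz'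
      simp only [Walk.support_concat, List.mem_append, List.mem_singleton] at hz'
      exact hz'.imp (h₁₂ z · hz) (by simp)) (by
      intro z hz hz'
      simp only [Walk.support_concat, List.mem_append, List.mem_singleton] at hz'
      exact hz'.imp (h₂₃ z hz ·) (by simp)) (by
      intro z hz hz'
      simp only [Walk.support_concat, List.mem_append, List.mem_singleton] at hz hz'
      rcases hz with hz | hz
      · rcases hz' with hz' | hz'
        · exact .inl (h₁₃ z hz hz')
        · exact .inr hz'
      · exact .inr hz) (by simp; grind) (by simp; grind) (by
      have := length_pos_of_ne L₁ hma
      simp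
      omega)
  have := length_pos_of_ne L₂ hmb
  exact L₂.adj_of_mem_edges (by rw [mem_edges_of_length_eq_one L₂ (by omega)]; simp)

/-- In a `K₄`-free graph in `G*`, a component off an odd cycle has at most two attachments. -/
theorem InGStar.not_three_attached (hG : InGStar G) (hK : NoK4 G) {w u a b d : V}
    {c : G.Walk w w} (hc : c.IsCycle) (hodd : Odd c.length)
    (ha : Attached G {z | z ∈ c.support} u a) (hb : Attached G {z | z ∈ c.support} u b)
    (hd : Attached G {z | z ∈ c.support} u d) (hab : a ≠ b) (had : a ≠ d) (hbd : b ≠ d) :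
    False := by
  classical
  set S : Set V := {z | z ∈ c.support} with hS
  obtain ⟨P, hP, hP2, hPS⟩ := ha.exists_ear hb hab
  obtain ⟨y, hy, hya, hyb⟩ : ∃ y ∈ P.support, y ≠ a ∧ y ≠ b := by
    cases P with
    | nil => simp at hP2
    | @cons _ y _ h q =>
      refine ⟨y, by simp, h.ne.symm, ?_⟩
      rintro rfl
      have := hP.length_eq_one_of_mem_edges (by simp : s(a, y) ∈ (Walk.cons h q).edges)
      omega
  have hPi : ∀ z, z ∈ P.support → z ≠ a → z ≠ b → ReachAvoiding G S u z := fun z hz h1 h2 =>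
    ((hPS z hz).resolve_left h1).resolve_left h2
  obtain ⟨hdS, k, hk, hkd⟩ := hd
  obtain ⟨w₀, hw₀⟩ := hk.symm.trans (hPi y hy hya hyb)
  obtain ⟨m, ⟨hmP, hma, hmb⟩, L, hL, hLw, hLT⟩ := exists_isPath_first
    (T := {z | z ∈ P.support ∧ z ≠ a ∧ z ≠ b}) (Walk.cons hkd.symm w₀) ⟨hy, hya, hyb⟩
  have hLS : ∀ z, z ∈ L.support → z ∈ S → z = d := by
    intro z hz hzS
    have := hLw z hz
    rw [Walk.support_cons, List.mem_cons] at this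
    exact this.resolve_right (fun h => hw₀ z h hzS)
  have hmS : m ∉ S := (hPi m hmP hma hmb).notMem
  have hmd : m ≠ d := fun h => hmS (h ▸ hdS)
  have haS := ha.1
  have hbS := hb.1
  have hPS' : ∀ z, z ∈ P.support → z ∈ S → z = a ∨ z = b := by
    intro z hz hzS
    rcases hPS z hz with h | h | h
    · exact .inl h
    · exact .inr h
    · exact absurd hzS h.notMem
  have hLP : ∀ z, z ∈ P.support → z ∈ L.support → z = m := by
    intro z hz hzL
    refine hLT z hzL ⟨hz, ?_, ?_⟩
    · rintro rfl
      exact had (hLS z hzL haS)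
    · rintro rfl
      exact hbd (hLS z hzL hbS)
  have hsplit := P.take_spec hmP
  set A := P.takeUntil m hmP
  set B := P.dropUntil m hmP
  have hA : A.IsPath := hP.takeUntil hmP
  have hB : B.IsPath := hP.dropUntil hmP
  have hAs : ∀ z, z ∈ A.reverse.support → z ∈ P.support := fun z hz => by
    rw [Walk.support_reverse, List.mem_reverse] at hz
    exact P.support_takeUntil_subset_support hmP hz
  have hBs : ∀ z, z ∈ B.support → z ∈ P.support := fun z hz =>
    P.support_dropUntil_subset_support hmP hz
  have hABi : ∀ z, z ∈ A.reverse.support → z ∈ B.support → z = m := by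
    intro z hz hz'
    rw [Walk.support_reverse, List.mem_reverse] at hz
    by_contra hzm
    exact (hsplit.symm ▸ hP).ne_of_mem_support_of_append hzm hz hz' rfl
  have hALi : ∀ z, z ∈ A.reverse.support → z ∈ L.reverse.support → z = m := by
    intro z hz hz'
    rw [Walk.support_reverse, List.mem_reverse] at hz'
    exact hLP z (hAs z hz) hz'
  have hBLi : ∀ z, z ∈ B.support → z ∈ L.reverse.support → z = m := by
    intro z hz hz'
    rw [Walk.support_reverse, List.mem_reverse] at hz'
    exact hLP z (hBs z hz) hz'
  have hEar : ∀ {x y : V} (L₁ : G.Walk m x) (L₂ : G.Walk m y), L₁.IsPath → L₂.IsPath →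
      (∀ z, z ∈ L₁.support → z ∈ L₂.support → z = m) → x ∈ S → y ∈ S → x ≠ y →
      (∀ z, z ∈ L₁.support → z ∈ S → z = x ∨ z = y) →
      (∀ z, z ∈ L₂.support → z ∈ S → z = x ∨ z = y) →
      Even (L₁.length + L₂.length) ∧ G.Adj x y := by
    intro x y L₁ L₂ h1 h2 hi hx hy hxy hs1 hs2
    have hp := isPath_append_of_inter h1.reverse h2 (fun z hz hz' => hi z (by simpa using hz) hz')
    have l1 := length_pos_of_ne L₁ (fun h => hmS (h ▸ hx))
    have l2 := length_pos_of_ne L₂ (fun h => hmS (h ▸ hy))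
    obtain ⟨he, Q, -, -, hQ, -⟩ := hG.ear hc hodd hx hy hxy hp (by
      intro z hz hzS
      rw [Walk.mem_support_append_iff, Walk.support_reverse, List.mem_reverse] at hz
      exact hz.elim (hs1 z · hzS) (hs2 z · hzS)) (.inl (by simp; omega))
    exact ⟨by simpa using he, c.adj_of_mem_edges ((hQ _).2 (.inr rfl))⟩
  have hAS : ∀ z, z ∈ A.reverse.support → z ∈ S → z = a := by
    intro z hz hzS
    rcases hPS' z (hAs z hz) hzS with h | h
    · exact h
    · subst h
      exact absurd (hABi z hz B.end_mem_support) (Ne.symm hmb)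
  have hBS : ∀ z, z ∈ B.support → z ∈ S → z = b := by
    intro z hz hzS
    rcases hPS' z (hBs z hz) hzS with h | h
    · subst h
      exact absurd (hABi z A.reverse.end_mem_support hz) (Ne.symm hma)
    · exact h
  have hLS' : ∀ z, z ∈ L.reverse.support → z ∈ S → z = d := fun z hz =>
    hLS z (by simpa using hz)
  obtain ⟨e₁, j₁⟩ := hEar A.reverse B hA.reverse hB hABi haS hbS hab
    (fun z h h' => .inl (hAS z h h')) (fun z h h' => .inr (hBS z h h'))
  obtain ⟨e₂, j₂⟩ := hEar A.reverse L.reverse hA.reverse hL.reverse hALi haS hdS had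
    (fun z h h' => .inl (hAS z h h')) (fun z h h' => .inr (hLS' z h h'))
  obtain ⟨e₃, j₃⟩ := hEar B L.reverse hB hL.reverse hBLi hbS hdS hbd
    (fun z h h' => .inl (hBS z h h')) (fun z h h' => .inr (hLS' z h h'))
  have k₁ : G.Adj m b := hG.length_leg_eq_one hA.reverse hB hL.reverse hABi hALi hBLi hma hmb j₁
    j₃.symm e₁ e₃
  have k₂ : G.Adj m a := hG.length_leg_eq_one hB hA.reverse hL.reverse
    (fun z h h' => hABi z h' h) hBLi hALi hmb hma j₁.symm j₂.symm (by rwa [add_comm]) e₂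
  have k₃ : G.Adj m d := hG.length_leg_eq_one hA.reverse hL.reverse hB hALi hABi
    (fun z h h' => hBLi z h' h) hma hmd j₂ j₃ e₂ (by rwa [add_comm])
  exact hK m a b d k₂ k₁ k₃ j₁ j₂ j₃

/-- Two components off an odd cycle attach to the same pair of vertices. -/
theorem InGStar.attached_mem_pair (hG : InGStar G) (hK : NoK4 G) (hsep : NoSep G)
    {w u u' a b a' : V} {c : G.Walk w w} (hc : c.IsCycle) (hodd : Odd c.length)
    (ha : Attached G {z | z ∈ c.support} u a) (hb : Attached G {z | z ∈ c.support} u b)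
    (hab : a ≠ b) (ha' : Attached G {z | z ∈ c.support} u' a') : a' = a ∨ a' = b := by
  set S : Set V := {z | z ∈ c.support} with hS
  by_contra hne
  push Not at hne
  by_cases hr : ReachAvoiding G S u u'
  · exact hG.not_three_attached hK hc hodd ha hb (ha'.of_reach hr) hab hne.1.symm hne.2.symm
  obtain ⟨b', hb', hab'⟩ : ∃ b', Attached G S u' b' ∧ a' ≠ b' := by
    obtain ⟨haS, k, hk, hka⟩ := ha'
    obtain ⟨p, q, hpq, hp, hq⟩ : ∃ p q, G.Adj p q ∧ p ∈ c.support ∧ q ∈ c.support := by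
      cases c with
      | nil => simp at hodd
      | cons h q => exact ⟨_, _, h, by simp, by simp⟩
    obtain ⟨x, y, hxy, hx, hy⟩ := hsep.exists_attached (S := S) hp hq hpq hk hka
    by_cases h : a' = x
    · exact ⟨y, hy, h ▸ hxy⟩
    · exact ⟨x, hx, h⟩
  obtain ⟨P, hP, hP2, hPS⟩ := ha.exists_ear hb hab
  obtain ⟨P', hP', hP2', hPS'⟩ := ha'.exists_ear hb' hab'
  have hPc : ∀ z, z ∈ P.support → z ∈ c.support → z = a ∨ z = b := by
    intro z hz hzS
    rcases hPS z hz with h | h | h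
    · exact .inl h
    · exact .inr h
    · exact absurd hzS h.notMem
  have hPc' : ∀ z, z ∈ P'.support → z ∈ c.support → z = a' ∨ z = b' := by
    intro z hz hzS
    rcases hPS' z hz with h | h | h
    · exact .inl h
    · exact .inr h
    · exact absurd hzS h.notMem
  obtain ⟨hPe, Q, hQ, hQe, hQE, hQS⟩ := hG.ear hc hodd ha.1 hb.1 hab hP hPc (.inl hP2)
  obtain ⟨hPe', Q', -, -, hQE', -⟩ := hG.ear hc hodd ha'.1 hb'.1 hab' hP' hPc' (.inl hP2')
  have hadj : G.Adj a b := c.adj_of_mem_edges ((hQE _).2 (.inr rfl))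
  rcases (hQE _).1 ((hQE' _).2 (.inr rfl)) with h | h
  · obtain ⟨R, hR, hRl, hRs⟩ := exists_isPath_replace hQ h hP'
      (fun z hz hz' => hPc' z hz ((hQS z).2 hz'))
    have := length_pos_of_ne Q hab
    refine hG.false_of_even_odd hadj hP hR ?_ hPe (by grind) (by grind)
    intro z hz hzR
    rcases hRs z hzR with h1 | h1
    · exact hPc z hz ((hQS z).2 h1)
    · rcases hPS z hz with h2 | h2 | h2
      · exact .inl h2
      · exact .inr h2
      · rcases hPS' z h1 with h3 | h3 | h3
        · exact absurd ha'.1 (h3 ▸ h2.notMem)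
        · exact absurd hb'.1 (h3 ▸ h2.notMem)
        · exact absurd (h2.trans h3.symm) hr
  · rcases Sym2.eq_iff.1 h with h | h
    · exact hne.1 h.1
    · exact hne.2 h.1

theorem ncard_neighbors_in_cycle {u v : V} {c : G.Walk u u} (hc : c.IsCycle)
    (hv : v ∈ c.support) : {n | s(v, n) ∈ c.edges}.ncard = 2 := by
  rw [← hc.ncard_neighborSet_toSubgraph_eq_two hv]
  congr 1
  ext n
  rw [Subgraph.mem_neighborSet, Walk.adj_toSubgraph_iff_mem_edges]
  rfl

/-- In a `K₄`-free graph in `G*` without separations, every nonisolated vertex off an odd cycle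
lies on an odd cycle which contains all edges at this vertex. -/
theorem InGStar.exists_cycle_off (hG : InGStar G) (hK : NoK4 G) (hsep : NoSep G)
    {w u x : V} {c : G.Walk w w} (hc : c.IsCycle) (hodd : Odd c.length) (hu : u ∉ c.support)
    (hux : G.Adj u x) :
    ∃ (w' : V) (c' : G.Walk w' w'), c'.IsCycle ∧ Odd c'.length ∧ u ∈ c'.support ∧
      (∀ n, G.Adj u n → s(u, n) ∈ c'.edges) ∧ ∃ e, e ∈ c.edges ∧ e ∈ c'.edges := by
  set S : Set V := {z | z ∈ c.support} with hS
  obtain ⟨p, q, hpq, hp, hq⟩ : ∃ p q, G.Adj p q ∧ p ∈ c.support ∧ q ∈ c.support := by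
    cases c with
    | nil => simp at hodd
    | cons h q => exact ⟨_, _, h, by simp, by simp⟩
  obtain ⟨a, b, hab, ha, hb⟩ := hsep.exists_attached (S := S) hp hq hpq (.refl hu) hux
  obtain ⟨P, hP, hP2, hPS⟩ := ha.exists_ear hb hab
  have hPc : ∀ z, z ∈ P.support → z ∈ c.support → z = a ∨ z = b := by
    intro z hz hzS
    rcases hPS z hz with h | h | h
    · exact .inl h
    · exact .inr h
    · exact absurd hzS h.notMem
  obtain ⟨hPe, Q, hQ, hQe, hQE, hQS⟩ := hG.ear hc hodd ha.1 hb.1 hab hP hPc (.inl hP2)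
  have hadj : G.Adj a b := c.adj_of_mem_edges ((hQE _).2 (.inr rfl))
  have hc' := isCycle_append_reverse hP hadj.isPath_toWalk (intDisj_toWalk P hadj)
    (by simp; omega)
  have hodd' : Odd (P.append hadj.toWalk.reverse).length := by simp; grind
  have hsup : ∀ z, z ∈ (P.append hadj.toWalk.reverse).support ↔ z ∈ P.support := by
    intro z
    rw [Walk.mem_support_append_iff]
    refine ⟨?_, .inl⟩
    rintro (h | h)
    · exact h
    · simp at h
      rcases h with rfl | rfl
      · exact P.end_mem_support
      · exact P.start_mem_support
  have hedge : s(a, b) ∈ (P.append hadj.toWalk.reverse).edges := by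
    rw [Walk.edges_append, Walk.edges_reverse]
    simp
  set c' := P.append hadj.toWalk.reverse
  set S' : Set V := {z | z ∈ c'.support} with hS'
  have hQ2 : 2 ≤ Q.length := by
    have := length_pos_of_ne Q hab
    grind
  -- an end of `P` is attached to a component off `c'` containing vertices of `Q`
  have hatt : ∀ {a b : V} (Q : G.Walk a b), Q.IsPath → 2 ≤ Q.length → a ∈ c'.support →
      (∀ z, z ∈ Q.support → z ∈ c'.support → z = a ∨ z = b) → ∃ y, Attached G S' y a := by
    intro a b Q hQ hQ2 ha hQc
    cases Q with
    | nil => simp at hQ2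
    | @cons _ y _ h q =>
      refine ⟨y, ha, y, .refl fun hy => ?_, h.symm⟩
      rcases hQc y (by simp) hy with rfl | rfl
      · exact h.ne rfl
      · have := hQ.length_eq_one_of_mem_edges (by simp : s(a, y) ∈ (Walk.cons h q).edges)
        omega
  have hQc' : ∀ z, z ∈ Q.support → z ∈ c'.support → z = a ∨ z = b :=
    fun z hz hz' => hPc z ((hsup z).1 hz') ((hQS z).2 hz)
  obtain ⟨ya, hya⟩ := hatt Q hQ hQ2 ((hsup a).2 P.start_mem_support) hQc'
  obtain ⟨yb, hyb⟩ := hatt Q.reverse hQ.reverse (by simpa using hQ2)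
    ((hsup b).2 P.end_mem_support) (fun z hz hz' => (hQc' z (by simpa using hz) hz').symm)
  have hstar : ∀ z, z ∈ P.support → z ∉ S → ∀ n, G.Adj z n → s(z, n) ∈ c'.edges := by
    intro z hz hzS n hzn
    by_contra hno
    by_cases hn : n ∈ c'.support
    · exact hno (hG.mem_edges_of_adj hc' hodd' ((hsup z).2 hz) hn hzn)
    have hz1 : Attached G S' n z := ⟨(hsup z).2 hz, n, .refl hn, hzn.symm⟩
    obtain ⟨z₂, hz2, hne⟩ : ∃ z₂, Attached G S' n z₂ ∧ z ≠ z₂ := by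
      obtain ⟨p, q, hpq, hp, hq⟩ := hsep.exists_attached (S := S')
        ((hsup a).2 P.start_mem_support) ((hsup b).2 P.end_mem_support) hadj (.refl hn) hzn.symm
      by_cases h : z = p
      · exact ⟨q, hq, h ▸ hpq⟩
      · exact ⟨p, hp, h⟩
    have h1 := (hG.attached_mem_pair hK hsep hc' hodd' hz1 hz2 hne hya).resolve_left
      (fun h => hzS (h ▸ ha.1))
    have h2 := (hG.attached_mem_pair hK hsep hc' hodd' hz1 hz2 hne hyb).resolve_left
      (fun h => hzS (h ▸ hb.1))
    exact hab (h1.trans h2.symm)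
  have hwalk : ∀ {y u : V} (w : G.Walk y u), (∀ z, z ∈ w.support → z ∉ S) → y ∈ P.support →
      u ∈ P.support := by
    intro y u w
    induction w with
    | nil => exact fun _ h => h
    | cons h q ih =>
      intro hw hy
      refine ih (fun z hz => hw z (by simp [hz])) ?_
      exact (hsup _).1 (Walk.snd_mem_support_of_mem_edges _ (hstar _ hy (hw _ (by simp)) _ h))
  obtain ⟨y, hyP, hy⟩ : ∃ y ∈ P.support, ReachAvoiding G S u y := by
    cases P with
    | nil => simp at hP2
    | @cons _ y _ h q =>
      refine ⟨y, by simp, ((hPS y (by simp)).resolve_left h.ne.symm).resolve_left ?_⟩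
      rintro rfl
      have := hP.length_eq_one_of_mem_edges (by simp : s(a, y) ∈ (Walk.cons h q).edges)
      omega
  obtain ⟨W, hW⟩ := hy.symm
  have huP := hwalk W hW hyP
  exact ⟨a, c', hc', hodd', (hsup u).2 huP, hstar u huP hu, s(a, b), (hQE _).2 (.inr rfl), hedge⟩

/-- The edges off an odd cycle form a bipartite graph. -/
theorem InGStar.even_of_edges_disjoint (hG : InGStar G) (hK : NoK4 G) (hsep : NoSep G)
    {w u : V} {c : G.Walk w w} (hc : c.IsCycle) (hodd : Odd c.length) {d : G.Walk u u}
    (hd : d.IsCycle) (hdisj : ∀ e ∈ d.edges, e ∉ c.edges) : Even d.length := by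
  by_contra hdo
  rw [Nat.not_even_iff_odd] at hdo
  obtain ⟨p, hpd, hpc⟩ : ∃ p ∈ d.support, p ∉ c.support := by
    by_contra hall
    push Not at hall
    cases d with
    | nil => simp at hdo
    | @cons _ y _ h q =>
      exact hdisj s(u, y) (by simp)
        (hG.mem_edges_of_adj hc hodd (hall u (by simp)) (hall y (by simp)) h)
  have h2 := ncard_neighbors_in_cycle hd hpd
  obtain ⟨x, hx⟩ : {n | s(p, n) ∈ d.edges}.Nonempty := by
    rw [← Set.ncard_pos (Set.finite_of_ncard_ne_zero (by omega))]
    omega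
  obtain ⟨w', c', hc', hodd', hpc', hall, e, hec, hec'⟩ :=
    hG.exists_cycle_off hK hsep hc hodd hpc (d.adj_of_mem_edges hx)
  have hle : 2 ≤ ({e | e ∈ d.edges} ∩ {e | e ∈ c'.edges}).ncard := by
    rw [← h2, ← Set.ncard_image_of_injective (f := fun n => s(p, n)) _
      (fun a b h => Sym2.congr_right.1 h)]
    refine Set.ncard_le_ncard ?_ (Set.Finite.inter_of_left (List.finite_toSet _) _)
    rintro _ ⟨n, hn, rfl⟩
    exact ⟨hn, hall n (d.adj_of_mem_edges hn)⟩
  have heq : {e | e ∈ d.edges} = {e | e ∈ c'.edges} := by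
    by_contra hne
    have := hG _ _ _ _ hd hc' hdo hodd' hne
    omega
  have : e ∈ {e | e ∈ d.edges} := heq ▸ hec'
  exact hdisj e this hec

theorem InGStar.false_of_clique_ear (hG : InGStar G) {a b c d : V} (hab : G.Adj a b)
    (hac : G.Adj a c) (hcb : G.Adj c b) (hcd : G.Adj c d) (hdb : G.Adj d b) (had : a ≠ d)
    {R : G.Walk a b} (hR : R.IsPath) (hR2 : 2 ≤ R.length) (hc : c ∉ R.support)
    (hd : d ∉ R.support) : False := by
  rcases Nat.even_or_odd R.length with he | ho
  · refine hG.false_of_even_odd hab hR (r := .cons hac (.cons hcd (.cons hdb .nil))) ?_ ?_ he ?_ ?_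
    · simp [hac.ne, hab.ne, hcb.ne, hcd.ne, hdb.ne, had]
    · intro z hz hz'
      simp at hz'
      grind
    · simp; decide
    · simp
  · have := hG.length_le_one hab.ne (p := .cons hac (.cons hcb .nil)) (q := R) (r := hab.toWalk)
      (by simp [hac.ne, hab.ne, hcb.ne]) hR hab.isPath_toWalk
      (by
        intro z hz hz'
        simp at hz
        grind) (intDisj_toWalk _ _) (intDisj_toWalk _ _) (by simp; grind) (by simp; decide) hR2
    simp at this

/-- A graph in `G*` without separations containing a `K₄` has no other edges. -/
theorem InGStar.mem_of_adj_of_clique (hG : InGStar G) (hsep : NoSep G) {a b c d : V}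
    (hab : G.Adj a b) (hac : G.Adj a c) (had : G.Adj a d) (hbc : G.Adj b c) (hbd : G.Adj b d)
    (hcd : G.Adj c d) {x y : V} (hxy : G.Adj x y) : x = a ∨ x = b ∨ x = c ∨ x = d := by
  by_contra hx
  let S : Set V := {a, b, c, d}
  have hxS : x ∉ S := by simpa [S] using hx
  obtain ⟨p, q, hpq, hp, hq⟩ := hsep.exists_attached (S := S) (by simp [S] : a ∈ S)
    (by simp [S] : b ∈ S) hab (.refl hxS) hxy
  obtain ⟨R, hR, hR2, hRS⟩ := hp.exists_ear hq hpq
  have hmem : ∀ z ∈ S, z ≠ p → z ≠ q → z ∉ R.support := by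
    intro z hz h1 h2 h
    exact (((hRS z h).resolve_left h1).resolve_left h2).notMem hz
  obtain ⟨e, f, heS, hfS, h1, h2, h3, h4, h5, h6, h7⟩ : ∃ e f, e ∈ S ∧ f ∈ S ∧ G.Adj p q ∧
      G.Adj p e ∧ G.Adj e q ∧ G.Adj e f ∧ G.Adj f q ∧ p ≠ f ∧ q ≠ f := by
    have hpS := hp.1
    have hqS := hq.1
    simp only [S, Set.mem_insert_iff, Set.mem_singleton_iff] at hpS hqS
    rcases hpS with h1 | h1 | h1 | h1 <;> rcases hqS with h2 | h2 | h2 | h2 <;> try rw [h1, h2]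
    · exact absurd (h1.trans h2.symm) hpq
    · exact ⟨c, d, by simp [S], by simp [S], hab, hac, hbc.symm, hcd, hbd.symm, had.ne, hbd.ne⟩
    · exact ⟨b, d, by simp [S], by simp [S], hac, hab, hbc, hbd, hcd.symm, had.ne, hcd.ne⟩
    · exact ⟨b, c, by simp [S], by simp [S], had, hab, hbd, hbc, hcd, hac.ne, hcd.symm.ne⟩
    · exact ⟨c, d, by simp [S], by simp [S], hab.symm, hbc, hac.symm, hcd, had.symm, hbd.ne, had.ne⟩
    · exact absurd (h1.trans h2.symm) hpq
    · exact ⟨a, d, by simp [S], by simp [S], hbc, hab.symm, hac, had, hcd.symm, hbd.ne, hcd.ne⟩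
    · exact ⟨a, c, by simp [S], by simp [S], hbd, hab.symm, had, hac, hcd, hbc.ne, hcd.symm.ne⟩
    · exact ⟨b, d, by simp [S], by simp [S],
        hac.symm, hbc.symm, hab.symm, hbd, had.symm, hcd.ne, had.ne⟩
    · exact ⟨a, d, by simp [S], by simp [S], hbc.symm, hac.symm, hab, had, hbd.symm, hcd.ne, hbd.ne⟩
    · exact absurd (h1.trans h2.symm) hpq
    · exact ⟨a, b, by simp [S], by simp [S], hcd, hac.symm, had, hab, hbd, hbc.symm.ne, hbd.symm.ne⟩
    · exact ⟨b, c, by simp [S], by simp [S],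
        had.symm, hbd.symm, hab.symm, hbc, hac.symm, hcd.symm.ne, hac.ne⟩
    · exact ⟨a, c, by simp [S], by simp [S],
        hbd.symm, had.symm, hab, hac, hbc.symm, hcd.symm.ne, hbc.ne⟩
    · exact ⟨a, b, by simp [S], by simp [S],
        hcd.symm, had.symm, hac, hab, hbc, hbd.symm.ne, hbc.symm.ne⟩
    · exact absurd (h1.trans h2.symm) hpq
  exact hG.false_of_clique_ear h1 h2 h3 h4 h5 h6 hR hR2 (hmem e heS h2.ne.symm h3.ne)
    (hmem f hfS h6.symm h7.symm)

end Walks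

section Main

variable {V : Type*} {G : SimpleGraph V}

theorem InGStar.mono {G' : SimpleGraph V} (hG : InGStar G) (hle : G' ≤ G) : InGStar G' := by
  intro u w c₁ c₂ h₁ h₂ ho₁ ho₂ hne
  have := hG u w (c₁.mapLe hle) (c₂.mapLe hle) (h₁.mapLe hle) (h₂.mapLe hle)
    (by simpa using ho₁) (by simpa using ho₂)
  simp only [Walk.edges_mapLe_eq_edges] at this
  exact this hne

theorem ncard_edges_at (E : Set (Sym2 V)) (u : V) :
    {b | b ∈ E ∧ u ∈ b}.ncard = {n | s(u, n) ∈ E}.ncard := by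
  rw [← Set.ncard_image_of_injective (f := fun n => s(u, n)) _
    (fun a b h => Sym2.congr_right.1 h)]
  congr 1
  ext b
  constructor
  · rintro ⟨hb, hu⟩
    obtain ⟨n, rfl⟩ := Sym2.mem_iff_exists.1 hu
    exact ⟨n, hb, rfl⟩
  · rintro ⟨n, hn, rfl⟩
    exact ⟨hn, by simp⟩

theorem deg_eq_ncard_edges (G : SimpleGraph V) (u : V) :
    deg G u = {b | b ∈ G.edgeSet ∧ u ∈ b}.ncard := by
  rw [ncard_edges_at]
  rfl

theorem edgeSet_fromEdgeSet_of_subset {E : Set (Sym2 V)} (hE : E ⊆ G.edgeSet) :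
    (fromEdgeSet E).edgeSet = E := by
  rw [edgeSet_fromEdgeSet]
  ext e
  exact ⟨fun h => h.1, fun h => ⟨h, G.not_isDiag_of_mem_edgeSet (hE h)⟩⟩

theorem fromEdgeSet_le_of_subset {E : Set (Sym2 V)} (hE : E ⊆ G.edgeSet) : fromEdgeSet E ≤ G := by
  rw [← edgeSet_subset_edgeSet, edgeSet_fromEdgeSet_of_subset hE]
  exact hE

theorem deg_fromEdgeSet {E : Set (Sym2 V)} (hE : E ⊆ G.edgeSet) (u : V) :
    deg (fromEdgeSet E) u = {b | b ∈ E ∧ u ∈ b}.ncard := by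
  rw [deg_eq_ncard_edges, edgeSet_fromEdgeSet_of_subset hE]

theorem ncard_add_ncard_le_deg [Finite V] {E₁ E₂ : Set (Sym2 V)} (hdisj : Disjoint E₁ E₂)
    (h₁ : E₁ ⊆ G.edgeSet) (h₂ : E₂ ⊆ G.edgeSet) (u : V) :
    {b | b ∈ E₁ ∧ u ∈ b}.ncard + {b | b ∈ E₂ ∧ u ∈ b}.ncard ≤ deg G u := by
  rw [deg_eq_ncard_edges, ← Set.ncard_union_eq _ (Set.toFinite _) (Set.toFinite _)]
  · refine Set.ncard_le_ncard ?_ (Set.toFinite _)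
    rintro b (⟨hb, hu⟩ | ⟨hb, hu⟩)
    exacts [⟨h₁ hb, hu⟩, ⟨h₂ hb, hu⟩]
  · exact hdisj.mono (fun b hb => hb.1) fun b hb => hb.1

theorem deg_fromEdgeSet_le [Finite V] {E : Set (Sym2 V)} (hE : E ⊆ G.edgeSet) (u : V) :
    deg (fromEdgeSet E) u ≤ deg G u := by
  rw [deg_fromEdgeSet hE, deg_eq_ncard_edges]
  exact Set.ncard_le_ncard (fun b hb => ⟨hE hb.1, hb.2⟩) (Set.toFinite _)

/-- Gluing two edge-disjoint subgraphs which share at most the vertex `u`. -/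
theorem orientableOn_of_one_sum [Finite V] {E₁ E₂ : Set (Sym2 V)} {t : ℕ} {u v : V}
    (hE : E₁ ∪ E₂ = G.edgeSet) (hdisj : Disjoint E₁ E₂) (ht : deg G u ≤ t)
    (hu : ∀ a ∈ E₁, ∀ b ∈ E₂, ∀ x ∈ a, x ∈ b → x = u) (hv : ∀ b ∈ E₂, v ∈ b → v = u)
    (h₁ : OrientableOn E₁ (capAt (fromEdgeSet E₁) t v))
    (h₂ : OrientableOn E₂ (capAt (fromEdgeSet E₂) t u)) :
    OrientableOn G.edgeSet (capAt G t v) := by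
  have hs₁ : E₁ ⊆ G.edgeSet := hE ▸ Set.subset_union_left
  have hs₂ : E₂ ⊆ G.edgeSet := hE ▸ Set.subset_union_right
  rw [← hE]
  refine h₁.union h₂ hdisj ?_ ?_
  · intro e he
    unfold capAt
    split_ifs
    · exact deg_fromEdgeSet_le hs₁ v
    · exact le_rfl
  · intro e he
    by_cases hue : u ∈ e
    · have h3 : {b | b ∈ E₁ ∧ ∃ x, x ∈ e ∧ x ∈ b} = {b | b ∈ E₁ ∧ u ∈ b} := by
        ext b
        constructor
        · rintro ⟨hb, x, hxe, hxb⟩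
          exact ⟨hb, hu b hb e he x hxb hxe ▸ hxb⟩
        · rintro ⟨hb, hub⟩
          exact ⟨hb, u, hue, hub⟩
      have h4 := ncard_add_ncard_le_deg hdisj hs₁ hs₂ u
      rw [h3, capAt, if_pos hue, deg_fromEdgeSet hs₂]
      unfold capAt
      split_ifs with hve
      · rw [hv e he hve]
        omega
      · omega
    · have h3 : {b | b ∈ E₁ ∧ ∃ x, x ∈ e ∧ x ∈ b} = ∅ := by
        rw [Set.eq_empty_iff_forall_notMem]
        rintro b ⟨hb, x, hxe, hxb⟩
        exact hue (hu b hb e he x hxb hxe ▸ hxe)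
      rw [h3, capAt, if_neg hue, capAt, if_neg (fun h => hue (hv e he h ▸ h))]
      simp

theorem ncard_cycle_edges_at {u v : V} {c : G.Walk u u} (hc : c.IsCycle) (hv : v ∈ c.support) :
    {b | b ∈ c.edges ∧ v ∈ b}.ncard = 2 :=
  (ncard_edges_at {b | b ∈ c.edges} v).trans (ncard_neighbors_in_cycle hc hv)

open Classical in
theorem orientableOn_cycle [Finite V] {u v : V} {c : G.Walk u u} (hc : c.IsCycle) :
    OrientableOn {e | e ∈ c.edges} (fun e => if v ∈ e then 2 else 3) := by
  obtain ⟨n, ⟨ι⟩⟩ := Finite.exists_equiv_fin (Sym2 V)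
  set r : Sym2 V → ℕ := fun e => if v ∈ e then (ι e : ℕ) else ι e + n with hr
  have hinj : ∀ a b, r a = r b → a = b := by
    intro a b hab
    have h1 := (ι a).2
    have h2 := (ι b).2
    simp only [hr] at hab
    refine ι.injective (Fin.ext ?_)
    split_ifs at hab <;> omega
  have h1 : ∀ e ∈ c.edges, ∀ x ∈ e, {b | (b ∈ c.edges ∧ x ∈ b) ∧ b ≠ e}.ncard = 1 := by
    intro e he x hx
    have h3 : x ∈ c.support := c.mem_support_of_mem_edges he hx
    have h2 := ncard_cycle_edges_at hc h3
    have h4 : e ∈ {b | b ∈ c.edges ∧ x ∈ b} := ⟨he, hx⟩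
    have : {b | (b ∈ c.edges ∧ x ∈ b) ∧ b ≠ e} = {b | b ∈ c.edges ∧ x ∈ b} \ {e} := rfl
    rw [this, Set.ncard_sdiff_singleton_of_mem h4, h2]
  refine ⟨fun a b => (a ∈ c.edges ∧ b ∈ c.edges ∧ a ≠ b ∧ ∃ x, x ∈ a ∧ x ∈ b) ∧ r b < r a,
    fun a b h => h.1, ?_, fun Z _ => exists_kernel_of_measure _ r (fun a b h => h.2) Z, ?_⟩
  · intro a ha b hb hab hx
    rcases lt_trichotomy (r a) (r b) with h | h | h
    · obtain ⟨x, hxa, hxb⟩ := hx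
      exact .inr ⟨⟨hb, ha, hab.symm, x, hxb, hxa⟩, h⟩
    · exact absurd (hinj _ _ h) hab
    · exact .inl ⟨⟨ha, hb, hab, hx⟩, h⟩
  · intro e he
    simp only
    split_ifs with hve
    · refine Nat.succ_le_succ ((Set.ncard_le_ncard ?_ (Set.toFinite _)).trans (h1 e he v hve).le)
      rintro b ⟨⟨-, hb, hne, -⟩, hlt⟩
      refine ⟨⟨hb, ?_⟩, hne.symm⟩
      by_contra hvb
      have := (ι e).2
      simp only [hr, if_pos hve, if_neg hvb] at hlt
      omega
    · induction e with
      | _ x y =>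
        have hx := h1 _ he x (by simp)
        have hy := h1 _ he y (by simp)
        have := Set.ncard_union_le {b | (b ∈ c.edges ∧ x ∈ b) ∧ b ≠ s(x, y)}
          {b | (b ∈ c.edges ∧ y ∈ b) ∧ b ≠ s(x, y)}
        refine Nat.succ_le_succ (le_trans (Set.ncard_le_ncard ?_ (Set.toFinite _))
          (this.trans (by omega)))
        rintro b ⟨⟨-, hb, hne, z, hz, hzb⟩, -⟩
        rcases Sym2.mem_iff.1 hz with rfl | rfl
        exacts [.inl ⟨⟨hb, hzb⟩, hne.symm⟩, .inr ⟨⟨hb, hzb⟩, hne.symm⟩]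

theorem InGStar.orientableOn_of_oddCycle [Fintype V] (hG : InGStar G) (hK : NoK4 G)
    (hsep : NoSep G) {t : ℕ} (ht4 : 4 ≤ t) (ht : ∀ x, deg G x ≤ t) {u v : V} {c : G.Walk u u}
    (hc : c.IsCycle) (hodd : Odd c.length) (hv : v ∈ c.support) :
    OrientableOn G.edgeSet (capAt G t v) := by
  set C : Set (Sym2 V) := {e | e ∈ c.edges} with hC
  have hs₁ : C ⊆ G.edgeSet := fun e he => c.edges_subset_edgeSet he
  have hs₂ : G.edgeSet \ C ⊆ G.edgeSet := Set.sdiff_subset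
  have hdisj : Disjoint C (G.edgeSet \ C) := Set.disjoint_sdiff_right
  have hdeg : ∀ x ∈ c.support, deg (fromEdgeSet (G.edgeSet \ C)) x + 2 ≤ deg G x := by
    intro x hx
    have h1 := ncard_add_ncard_le_deg hdisj hs₁ hs₂ x
    have h2 := ncard_cycle_edges_at hc hx
    rw [deg_fromEdgeSet hs₂]
    simp only [hC, Set.mem_ofPred_eq] at h1 h2 ⊢
    omega
  have hdeg' : ∀ x, deg (fromEdgeSet (G.edgeSet \ C)) x ≤ t - 2 := by
    intro x
    by_cases hx : x ∈ c.support
    · have := hdeg x hx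
      have := ht x
      omega
    · refine (deg_fromEdgeSet_le hs₂ x).trans ?_
      by_cases hn : ∃ y, G.Adj x y
      · obtain ⟨y, hy⟩ := hn
        obtain ⟨w', c', hc', -, hxc', hall, -⟩ := hG.exists_cycle_off hK hsep hc hodd hx hy
        have h2 := ncard_neighbors_in_cycle hc' hxc'
        have : deg G x ≤ {n | s(x, n) ∈ c'.edges}.ncard :=
          Set.ncard_le_ncard (fun n hn => hall n hn) (Set.toFinite _)
        omega
      · have : G.neighborSet x = ∅ := by
          rw [Set.eq_empty_iff_forall_notMem]
          exact fun y hy => hn ⟨y, hy⟩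
        simp [deg, this]
  obtain ⟨B, hB⟩ := exists_bool_coloring_of_even_cycles (fromEdgeSet (G.edgeSet \ C)) (by
    intro x d hd
    have := hG.even_of_edges_disjoint hK hsep hc hodd (hd.mapLe (fromEdgeSet_le_of_subset hs₂)) (by
      intro e he hec
      rw [Walk.edges_mapLe_eq_edges] at he
      have := d.edges_subset_edgeSet he
      rw [edgeSet_fromEdgeSet_of_subset hs₂] at this
      exact this.2 hec)
    simpa using this)
  have h₂ := orientableOn_bipartite _ B hB (t - 2) hdeg' v
  rw [edgeSet_fromEdgeSet_of_subset hs₂] at h₂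
  rw [← Set.union_sdiff_cancel hs₁]
  refine (orientableOn_cycle (v := v) hc).union h₂ hdisj ?_ ?_
  · intro e he
    unfold capAt
    have := hdeg v hv
    split_ifs <;> omega
  · intro e he
    have hmeet : {b | b ∈ C ∧ ∃ x, x ∈ e ∧ x ∈ b}.ncard ≤ 2 := by
      by_cases hex : ∃ x ∈ e, x ∈ c.support
      · obtain ⟨x, hxe, hx⟩ := hex
        rw [← ncard_cycle_edges_at hc hx]
        refine Set.ncard_le_ncard ?_ (Set.toFinite _)
        rintro b ⟨hb, y, hye, hyb⟩
        refine ⟨hb, ?_⟩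
        by_cases hxy : x = y
        · exact hxy ▸ hyb
        · obtain rfl := (Sym2.mem_and_mem_iff hxy).1 ⟨hxe, hye⟩
          exact absurd (hG.mem_edges_of_adj hc hodd hx (c.mem_support_of_mem_edges hb hyb) he.1)
            he.2
      · have : {b | b ∈ C ∧ ∃ x, x ∈ e ∧ x ∈ b} = ∅ := by
          rw [Set.eq_empty_iff_forall_notMem]
          rintro b ⟨hb, x, hxe, hxb⟩
          exact hex ⟨x, hxe, c.mem_support_of_mem_edges hb hxb⟩
        simp [this]
    change _ + {b | b ∈ C ∧ ∃ x, x ∈ e ∧ x ∈ b}.ncard ≤ _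
    unfold capAt
    have := hdeg v hv
    split_ifs <;> omega

/-- Out-neighbourhoods of a kernel-perfect orientation of the octahedron `L(K₄)`; opposite
vertices are `i` and `i + 3`. -/
def octahedronOut : Fin 6 → Finset (Fin 6) :=
  ![{1, 2}, {2, 3}, {3, 4}, {4, 5}, {0, 2, 5}, {0, 1, 3}]

theorem octahedronOut_kernel : ∀ Z : Fin 6 → Bool, (∀ i, Z i = false) ∨ ∃ i, Z i = true ∧
    ∀ j, Z j = true → j ≠ i → j ≠ i + 3 →
      i ∈ octahedronOut j ∨ Z (i + 3) = true ∧ i + 3 ∈ octahedronOut j := by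
  set_option maxRecDepth 100000 in decide

theorem orientableOn_clique [Finite V] {t : ℕ} (ht4 : 4 ≤ t) {a b c d : V}
    (hab : G.Adj a b) (hac : G.Adj a c) (had : G.Adj a d) (hbc : G.Adj b c) (hbd : G.Adj b d)
    (hcd : G.Adj c d) (hall : ∀ x y, G.Adj x y → x = a ∨ x = b ∨ x = c ∨ x = d) :
    OrientableOn G.edgeSet (capAt G t a) := by
  classical
  have e1 := hab.ne
  have e2 := hac.ne
  have e3 := had.ne
  have e4 := hbc.ne
  have e5 := hbd.ne
  have e6 := hcd.ne
  set φ : Fin 6 → Sym2 V := ![s(a, b), s(a, c), s(a, d), s(c, d), s(b, d), s(b, c)] with hφ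
  have hinj : Function.Injective φ := by
    intro i j
    fin_cases i <;> fin_cases j <;> simp [hφ] <;> grind
  have hmem : ∀ i, φ i ∈ G.edgeSet := by
    intro i
    fin_cases i <;> simpa [hφ]
  have hsurj : ∀ e ∈ G.edgeSet, ∃ i, e = φ i := by
    intro e he
    induction e with
    | _ x y =>
      have hxy : G.Adj x y := he
      have hne := hxy.ne
      rcases hall x y hxy with h | h | h | h <;> rcases hall y x hxy.symm with h' | h' | h' | h' <;>
        subst h <;> subst h' <;> first
        | exact absurd rfl hne
        | (refine ⟨0, ?_⟩; simp [hφ]; done)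
        | (refine ⟨1, ?_⟩; simp [hφ]; done)
        | (refine ⟨2, ?_⟩; simp [hφ]; done)
        | (refine ⟨3, ?_⟩; simp [hφ]; done)
        | (refine ⟨4, ?_⟩; simp [hφ]; done)
        | (refine ⟨5, ?_⟩; simp [hφ])
  have hmeet : ∀ i x, x ∈ φ i → x ∉ φ (i + 3) := by
    intro i x
    fin_cases i <;> simp [hφ] <;> grind
  have hmeet' : ∀ i, ∀ j ∈ octahedronOut i, ∃ x, x ∈ φ i ∧ x ∈ φ j := by
    intro i j
    fin_cases i <;> fin_cases j <;> simp [hφ, octahedronOut]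
  have hout : ∀ i j : Fin 6, i ≠ j → j ≠ i + 3 → j ∈ octahedronOut i ∨ i ∈ octahedronOut j := by
    decide
  have hirr : ∀ i, i ∉ octahedronOut i ∧ i + 3 ∉ octahedronOut i ∧ i ∉ octahedronOut (i + 3) := by
    decide
  refine ⟨fun e f => ∃ i, e = φ i ∧ ∃ j ∈ octahedronOut i, f = φ j, ?_, ?_, ?_, ?_⟩
  · rintro _ _ ⟨i, rfl, j, hj, rfl⟩
    exact ⟨hmem i, hmem j, fun h => (hirr i).1 (by rwa [← hinj h] at hj), hmeet' i j hj⟩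
  · intro e he f hf hne ⟨x, hxe, hxf⟩
    obtain ⟨i, rfl⟩ := hsurj e he
    obtain ⟨j, rfl⟩ := hsurj f hf
    rcases hout i j (fun h => hne (h ▸ rfl)) (fun h => hmeet i x hxe (h ▸ hxf)) with h | h
    · exact .inl ⟨i, rfl, j, h, rfl⟩
    · exact .inr ⟨j, rfl, i, h, rfl⟩
  · intro Z hZ
    rcases octahedronOut_kernel (fun i => decide (φ i ∈ Z)) with h | ⟨i, hi, h⟩
    · refine ⟨∅, by simp, by simp, fun z hz => ?_⟩
      obtain ⟨j, rfl⟩ := hsurj z (hZ hz)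
      exact absurd hz (by simpa using h j)
    · simp only [decide_eq_true_eq] at hi h
      refine ⟨Z ∩ {φ i, φ (i + 3)}, Set.inter_subset_left, ?_, ?_⟩
      · rintro _ ⟨-, h1⟩ _ ⟨-, h2⟩ ⟨j, rfl, k, hk, rfl⟩
        have h3 := hirr i
        simp only [Set.mem_insert_iff, Set.mem_singleton_iff, hinj.eq_iff] at h1 h2
        have h4 := (hirr (i + 3)).1
        rcases h1 with rfl | rfl <;> rcases h2 with rfl | rfl <;> tauto
      · intro z hz hzS
        obtain ⟨j, rfl⟩ := hsurj z (hZ hz)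
        rcases h j hz (fun h => hzS ⟨hz, by simp [h]⟩) (fun h => hzS ⟨hz, by simp [h]⟩) with
          h' | ⟨hZ', h'⟩
        · exact ⟨φ i, ⟨hi, by simp⟩, j, rfl, i, h', rfl⟩
        · exact ⟨φ (i + 3), ⟨hZ', by simp⟩, j, rfl, _, h', rfl⟩
  · intro e he
    obtain ⟨i, rfl⟩ := hsurj e he
    have h1 : {f | ∃ k, φ i = φ k ∧ ∃ j ∈ octahedronOut k, f = φ j} =
        φ '' (octahedronOut i : Set (Fin 6)) := by
      ext f
      constructor
      · rintro ⟨k, hk, j, hj, rfl⟩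
        exact ⟨j, by rw [hinj hk]; exact hj, rfl⟩
      · rintro ⟨j, hj, rfl⟩
        exact ⟨i, rfl, j, hj, rfl⟩
    rw [h1, Set.ncard_image_of_injective _ hinj, Set.ncard_coe_finset]
    have h2 : 3 ≤ deg G a := by
      have : ({b, c, d} : Finset V).card = 3 := by
        rw [Finset.card_eq_three]
        exact ⟨b, c, d, e4, e5, e6, rfl⟩
      rw [← this, ← Set.ncard_coe_finset]
      refine Set.ncard_le_ncard ?_ (Set.toFinite _)
      intro x hx
      simp only [Finset.coe_insert, Finset.coe_singleton, Set.mem_insert_iff,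
        Set.mem_singleton_iff] at hx
      rcases hx with rfl | rfl | rfl <;> assumption
    have h3 : ∀ i, (octahedronOut i).card ≤ 3 ∧ (3 ≤ i ∨ (octahedronOut i).card ≤ 2) := by
      decide
    have h4 : 3 ≤ i → a ∉ φ i := by
      fin_cases i <;> simp [hφ] <;> grind
    have h5 := h3 i
    unfold capAt
    split_ifs with ha
    · have := h5.2.resolve_left (fun h => h4 h ha)
      omega
    · omega

theorem InGStar.orientableOn_capAt [Fintype V] {t : ℕ} (ht4 : 4 ≤ t) (n : ℕ) :
    ∀ G : SimpleGraph V, InGStar G → G.edgeSet.ncard = n → (∀ x, deg G x ≤ t) → ∀ v,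
      OrientableOn G.edgeSet (capAt G t v) := by
  induction n using Nat.strong_induction_on with
  | _ n ih =>
  intro G hG hn ht v
  by_cases hsep : NoSep G
  · by_cases hbip : ∀ (u : V) (c : G.Walk u u), c.IsCycle → Even c.length
    · obtain ⟨B, hB⟩ := exists_bool_coloring_of_even_cycles G hbip
      exact orientableOn_bipartite G B hB t ht v
    push Not at hbip
    obtain ⟨u₀, c, hc, hodd⟩ := hbip
    rw [Nat.not_even_iff_odd] at hodd
    have main : ∀ v x, G.Adj v x → OrientableOn G.edgeSet (capAt G t v) := by
      intro v x hvx
      by_cases hK : NoK4 G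
      · by_cases hvc : v ∈ c.support
        · exact hG.orientableOn_of_oddCycle hK hsep ht4 ht hc hodd hvc
        · obtain ⟨w', c', hc', hodd', hvc', -⟩ := hG.exists_cycle_off hK hsep hc hodd hvc hvx
          exact hG.orientableOn_of_oddCycle hK hsep ht4 ht hc' hodd' hvc'
      · unfold NoK4 at hK
        push Not at hK
        obtain ⟨a, b, c, d, hab, hac, had, hbc, hbd, hcd, -⟩ := hK
        have hall : ∀ x y, G.Adj x y → x = a ∨ x = b ∨ x = c ∨ x = d := fun x y hxy =>
          hG.mem_of_adj_of_clique hsep hab hac had hbc hbd hcd hxy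
        rcases hall v x hvx with rfl | rfl | rfl | rfl
        · exact orientableOn_clique ht4 hab hac had hbc hbd hcd hall
        · exact orientableOn_clique ht4 hab.symm hbc hbd hac had hcd
            (fun x y h => by have := hall x y h; tauto)
        · exact orientableOn_clique ht4 hac.symm hbc.symm hcd hab had hbd
            (fun x y h => by have := hall x y h; tauto)
        · exact orientableOn_clique ht4 had.symm hbd.symm hcd.symm hab hac hbc
            (fun x y h => by have := hall x y h; tauto)
    by_cases hv : ∃ x, G.Adj v x
    · obtain ⟨x, hx⟩ := hv
      exact main v x hx
    · cases c with
      | nil => simp at hodd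
      | @cons _ y _ h q =>
        refine (main _ _ h).mono fun e he => ?_
        have : v ∉ e := by
          intro hve
          obtain ⟨z, rfl⟩ := Sym2.mem_iff_exists.1 hve
          exact hv ⟨z, he⟩
        rw [capAt, capAt, if_neg this]
        split_ifs
        exacts [ht _, le_rfl]
  · unfold NoSep at hsep
    push Not at hsep
    obtain ⟨A, K, hKA, hcl, ⟨k, hk, w, hkw⟩, ⟨x, y, hxy, hx, hy⟩, hone⟩ := hsep
    set E₁ : Set (Sym2 V) := {e | e ∈ G.edgeSet ∧ ∃ z ∈ K, z ∈ e} with hE₁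
    set E₂ : Set (Sym2 V) := {e | e ∈ G.edgeSet ∧ ∀ z ∈ K, z ∉ e} with hE₂
    have hs₁ : E₁ ⊆ G.edgeSet := fun e he => he.1
    have hs₂ : E₂ ⊆ G.edgeSet := fun e he => he.1
    have hdisj : Disjoint E₁ E₂ := by
      rw [Set.disjoint_left]
      rintro e ⟨-, z, hz, hze⟩ ⟨-, h⟩
      exact h z hz hze
    have hE : E₁ ∪ E₂ = G.edgeSet := by
      refine (Set.union_subset hs₁ hs₂).antisymm fun e he => ?_
      by_cases h : ∃ z ∈ K, z ∈ e
      · exact .inl ⟨he, h⟩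
      · push Not at h
        exact .inr ⟨he, h⟩
    have hk₁ : s(k, w) ∈ E₁ := ⟨hkw, k, hk, by simp⟩
    have hx₂ : s(x, y) ∈ E₂ := ⟨hxy, fun z hz h => by
      rcases Sym2.mem_iff.1 h with rfl | rfl
      exacts [hx hz, hy hz]⟩
    have ih' : ∀ E ⊆ G.edgeSet, (∃ e ∈ G.edgeSet, e ∉ E) → ∀ v,
        OrientableOn E (capAt (fromEdgeSet E) t v) := by
      rintro E hEG ⟨e, he, heE⟩ v
      have := ih E.ncard (hn ▸ Set.ncard_lt_ncard ⟨hEG, fun h => heE (h he)⟩ (Set.toFinite _))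
        (fromEdgeSet E) (hG.mono (fromEdgeSet_le_of_subset hEG))
        (by rw [edgeSet_fromEdgeSet_of_subset hEG])
        (fun x => (deg_fromEdgeSet_le hEG x).trans (ht x)) v
      rwa [edgeSet_fromEdgeSet_of_subset hEG] at this
    have h₁ := ih' E₁ hs₁ ⟨_, hxy, Set.disjoint_right.1 hdisj hx₂⟩
    have h₂ := ih' E₂ hs₂ ⟨_, hkw, Set.disjoint_left.1 hdisj hk₁⟩
    have hshare : ∀ a ∈ E₁, ∀ b ∈ E₂, ∀ z ∈ a, z ∈ b → z ∈ A ∧ ∃ l ∈ K, G.Adj l z := by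
      rintro a ⟨ha, l, hl, hla⟩ b ⟨hb, hbK⟩ z hza hzb
      have hzK : z ∉ K := fun h => hbK z h hzb
      have hlz : l ≠ z := fun h => hzK (h ▸ hl)
      obtain rfl := (Sym2.mem_and_mem_iff hlz).1 ⟨hla, hza⟩
      exact ⟨(hcl l hl z ha).resolve_left hzK, l, hl, ha⟩
    have huniq : ∀ z z', (z ∈ A ∧ ∃ l ∈ K, G.Adj l z) → (z' ∈ A ∧ ∃ l ∈ K, G.Adj l z') →
        z = z' := by
      rintro z z' ⟨hz, h⟩ ⟨hz', l, hl, hlz⟩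
      by_contra hne
      exact hone z hz z' hz' hne h l hl hlz
    obtain ⟨u, hu⟩ : ∃ u, ∀ a ∈ E₁, ∀ b ∈ E₂, ∀ z ∈ a, z ∈ b → z = u := by
      by_cases h : ∃ u, u ∈ A ∧ ∃ l ∈ K, G.Adj l u
      · obtain ⟨u, hu⟩ := h
        exact ⟨u, fun a ha b hb z hza hzb => huniq _ _ (hshare a ha b hb z hza hzb) hu⟩
      · exact ⟨v, fun a ha b hb z hza hzb => absurd ⟨z, hshare a ha b hb z hza hzb⟩ h⟩
    by_cases hv : ∀ b ∈ E₂, v ∈ b → v = u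
    · exact orientableOn_of_one_sum hE hdisj (ht u) hu hv (h₁ v) (h₂ u)
    · push Not at hv
      obtain ⟨b, hb, hvb, hvu⟩ := hv
      exact orientableOn_of_one_sum ((Set.union_comm _ _).trans hE) hdisj.symm (ht u)
        (fun a ha b hb z hza hzb => hu b hb a ha z hzb hza)
        (fun a ha hva => hu a ha b hb v hva hvb) (h₂ v) (h₁ u)

end Main

/-- if `G ∈ G*` and `t ≥ max{4, Δ(G)}`, then `G` is
`t`-edge-orientable. -/
theorem stmt17 {V : Type*} [Fintype V] (G : SimpleGraph V) (hG : InGStar G)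
    (t : ℕ) (ht4 : 4 ≤ t) (htΔ : maxDeg G ≤ t) :
    EdgeOrientable G (fun _ => t) := by
  have hdeg : ∀ x, deg G x ≤ t := fun x =>
    (le_csSup (Set.finite_range _).bddAbove ⟨x, rfl⟩).trans htΔ
  rcases isEmpty_or_nonempty V with hV | ⟨⟨v⟩⟩
  · exact ⟨fun _ _ => False, ⟨by simp, fun a => (hV.elim a.1.out.1)⟩,
      fun Z => ⟨∅, by simp, by simp, fun a => (hV.elim a.1.out.1)⟩, fun a => (hV.elim a.1.out.1)⟩
  · refine OrientableOn.edgeOrientable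
      ((InGStar.orientableOn_capAt ht4 _ G hG rfl hdeg v).mono fun e _ => ?_)
    unfold capAt
    split_ifs
    exacts [hdeg v, le_rfl]
end
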